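/- For any computable consistent extensions T and U of PA and any n ≥ 1, there exists a Δ_{n+1}(PA) sentence φ such that φ ∈ Cons(B(Σ_n),T) ∩ Cons(B(Σ_n),U), T ⊬ φ, and U ⊬ φ. -/

import Mathlib

open FirstOrder Language
open scoped FirstOrder

namespace Guaspari

/-- The first-order language of arithmetic: a constant `0`, a unary function `S`,
binary functions `+` (coded `false`) and `·` (coded `true`), and a binary relation `≤`. -/
def LA : FirstOrder.Language :=
  ⟨fun n => match n with | 0 => Unit | 1 => Unit | 2 => Bool | _ => Empty,
   fun n => match n with | 2 => Unit | _ => Empty⟩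

/-- Sentences of the language of arithmetic. -/
abbrev Snt : Type := LA.Sentence

/-- Theories (sets of sentences) in the language of arithmetic. -/
abbrev Thy : Type := LA.Theory

/-- The term `0`. -/
def zeroT {α : Type} {n : ℕ} : LA.Term (α ⊕ Fin n) :=
  Constants.term (show LA.Constants from Unit.unit)

/-- The term `S t`. -/
def succT {α : Type} {n : ℕ} (t : LA.Term (α ⊕ Fin n)) : LA.Term (α ⊕ Fin n) :=
  Functions.apply₁ (show LA.Functions 1 from Unit.unit) t

/-- The term `t + u`. -/
def addT {α : Type} {n : ℕ} (t u : LA.Term (α ⊕ Fin n)) : LA.Term (α ⊕ Fin n) :=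
  Functions.apply₂ (show LA.Functions 2 from false) t u

/-- The term `t * u`. -/
def mulT {α : Type} {n : ℕ} (t u : LA.Term (α ⊕ Fin n)) : LA.Term (α ⊕ Fin n) :=
  Functions.apply₂ (show LA.Functions 2 from true) t u

/-- The atomic formula `t ≤ u`. -/
def leF {α : Type} {n : ℕ} (t u : LA.Term (α ⊕ Fin n)) : LA.BoundedFormula α n :=
  Relations.boundedFormula₂ (show LA.Relations 2 from Unit.unit) t u

/-- The `i`-th (de Bruijn-indexed) bound variable as a term. -/
def vT {m : ℕ} (i : Fin m) : LA.Term (Empty ⊕ Fin m) := Term.var (Sum.inr i)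

/-- The induction axiom for the formula `φ(x₀,…,x_{k-1}, x_k)` with induction on `x_k`,
universally closed over the parameters `x₀,…,x_{k-1}`. -/
def indAxiom {k : ℕ} (φ : LA.BoundedFormula Empty (k + 1)) : Snt :=
  let base := ∀' ((vT (Fin.last k) =' zeroT) ⟹ φ)
  let step := ∀' (φ ⟹
    ∀' ((vT (Fin.last (k + 1)) =' succT (vT (Fin.castSucc (Fin.last k)))) ⟹ φ.liftAt 1 k))
  ((base ⊓ step) ⟹ ∀' φ).alls

/-- The axioms of Peano arithmetic `PA`: the basic axioms for `0`, `S`, `+`, `·`, `≤`,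
together with the full induction scheme. -/
def PAAx : Thy :=
  {∀' ∼(succT (vT 0) =' zeroT),
   ∀' ∀' ((succT (vT 0) =' succT (vT 1)) ⟹ (vT 0 =' vT 1)),
   ∀' (addT (vT 0) zeroT =' vT 0),
   ∀' ∀' (addT (vT 0) (succT (vT 1)) =' succT (addT (vT 0) (vT 1))),
   ∀' (mulT (vT 0) zeroT =' zeroT),
   ∀' ∀' (mulT (vT 0) (succT (vT 1)) =' addT (mulT (vT 0) (vT 1)) (vT 0)),
   ∀' ∀' (leF (vT 0) (vT 1) ⇔ ∃' (addT (vT 2) (vT 0) =' vT 1))} ∪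
  {φ | ∃ (k : ℕ) (ψ : LA.BoundedFormula Empty (k + 1)), φ = indAxiom ψ}

/-- `Prv T φ`: the sentence `φ` is provable from the theory `T` (equivalently, by the
Gödel completeness theorem, `φ` holds in every model of `T`). -/
def Prv (T : Thy) (φ : Snt) : Prop := T ⊨ᵇ φ

/-- `Th T`: the set of sentences provable from `T`. -/
def Th (T : Thy) : Set Snt := {φ | Prv T φ}

/-- `Con T`: the theory `T` is consistent. -/
def Con (T : Thy) : Prop := ¬ Prv T ⊥

/-- The theory `T + φ`. -/
def add (T : Thy) (φ : Snt) : Thy := insert φ T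

/-- `T` is an extension of `PA`. -/
def ExtPA (T : Thy) : Prop := ∀ φ ∈ PAAx, Prv T φ

/-- `V` is a subtheory of `T` (containing `PA`, as assumed throughout the paper). -/
def SubThy (V T : Thy) : Prop := ExtPA V ∧ ∀ φ, Prv V φ → Prv T φ

/-- Δ₀ (bounded) formulas. -/
inductive IsDelta0 : ∀ {m : ℕ}, LA.BoundedFormula Empty m → Prop
  | falsum {m : ℕ} : IsDelta0 (⊥ : LA.BoundedFormula Empty m)
  | equal {m : ℕ} (t u : LA.Term (Empty ⊕ Fin m)) : IsDelta0 (t =' u)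
  | le {m : ℕ} (t u : LA.Term (Empty ⊕ Fin m)) : IsDelta0 (leF t u)
  | imp {m : ℕ} {φ ψ : LA.BoundedFormula Empty m} :
      IsDelta0 φ → IsDelta0 ψ → IsDelta0 (φ ⟹ ψ)
  | ball {m : ℕ} (t : LA.Term (Empty ⊕ Fin m)) {φ : LA.BoundedFormula Empty (m + 1)} :
      IsDelta0 φ →
      IsDelta0 (∀' (leF (vT (Fin.last m)) (t.relabel (Sum.map id Fin.castSucc)) ⟹ φ))
  | bex {m : ℕ} (t : LA.Term (Empty ⊕ Fin m)) {φ : LA.BoundedFormula Empty (m + 1)} :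
      IsDelta0 φ →
      IsDelta0 (∃' (leF (vT (Fin.last m)) (t.relabel (Sum.map id Fin.castSucc)) ⊓ φ))

mutual
  /-- `Σ_k` formulas (cumulatively: every `Π_k` formula is `Σ_{k+1}`). -/
  inductive IsSigmaFml : ℕ → ∀ {m : ℕ}, LA.BoundedFormula Empty m → Prop
    | ofDelta0 {m : ℕ} {φ : LA.BoundedFormula Empty m} : IsDelta0 φ → IsSigmaFml 0 φ
    | ofPi {k : ℕ} {m : ℕ} {φ : LA.BoundedFormula Empty m} :
        IsPiFml k φ → IsSigmaFml (k + 1) φ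
    | ex {k : ℕ} {m : ℕ} {φ : LA.BoundedFormula Empty (m + 1)} :
        IsSigmaFml (k + 1) φ → IsSigmaFml (k + 1) (∃' φ)
  /-- `Π_k` formulas (cumulatively: every `Σ_k` formula is `Π_{k+1}`). -/
  inductive IsPiFml : ℕ → ∀ {m : ℕ}, LA.BoundedFormula Empty m → Prop
    | ofDelta0 {m : ℕ} {φ : LA.BoundedFormula Empty m} : IsDelta0 φ → IsPiFml 0 φ
    | ofSigma {k : ℕ} {m : ℕ} {φ : LA.BoundedFormula Empty m} :
        IsSigmaFml k φ → IsPiFml (k + 1) φ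
    | all {k : ℕ} {m : ℕ} {φ : LA.BoundedFormula Empty (m + 1)} :
        IsPiFml (k + 1) φ → IsPiFml (k + 1) (∀' φ)
end

/-- The set of `Σ_k` sentences. -/
def SigmaS (k : ℕ) : Set Snt := {φ | IsSigmaFml k φ}

/-- The set of `Π_k` sentences. -/
def PiS (k : ℕ) : Set Snt := {φ | IsPiFml k φ}

/-- The set of `Σ_k ∧ Π_k` sentences, i.e. sentences of the form `σ ∧ π` with
`σ` a `Σ_k` sentence and `π` a `Π_k` sentence. -/
def SigAndPiS (k : ℕ) : Set Snt :=
  {φ | ∃ σ ∈ SigmaS k, ∃ π ∈ PiS k, φ = σ ⊓ π}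

/-- `B(Σ_k)` sentences: Boolean combinations of `Σ_k` sentences. -/
inductive IsBoolSigma (k : ℕ) : Snt → Prop
  | base {φ : Snt} : φ ∈ SigmaS k → IsBoolSigma k φ
  | not {φ : Snt} : IsBoolSigma k φ → IsBoolSigma k (∼φ)
  | imp {φ ψ : Snt} : IsBoolSigma k φ → IsBoolSigma k ψ → IsBoolSigma k (φ ⟹ ψ)
  | inf {φ ψ : Snt} : IsBoolSigma k φ → IsBoolSigma k ψ → IsBoolSigma k (φ ⊓ ψ)
  | sup {φ ψ : Snt} : IsBoolSigma k φ → IsBoolSigma k ψ → IsBoolSigma k (φ ⊔ ψ)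

/-- The set of `B(Σ_k)` sentences. -/
def BSigmaS (k : ℕ) : Set Snt := {φ | IsBoolSigma k φ}

/-- The set of `Γ` sentences provable in `T`, `Th_Γ(T)`. -/
def ThIn (Γ : Set Snt) (T : Thy) : Set Snt := Γ ∩ Th T

instance (i : ℕ) : Encodable (LA.Functions i) :=
  match i with
  | 0 => inferInstanceAs (Encodable Unit)
  | 1 => inferInstanceAs (Encodable Unit)
  | 2 => inferInstanceAs (Encodable Bool)
  | (_ + 3) => inferInstanceAs (Encodable Empty)

instance (i : ℕ) : Encodable (LA.Relations i) :=
  match i with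
  | 0 => inferInstanceAs (Encodable Empty)
  | 1 => inferInstanceAs (Encodable Empty)
  | 2 => inferInstanceAs (Encodable Unit)
  | (_ + 3) => inferInstanceAs (Encodable Empty)

/-- A Gödel numbering of sentences, via Mathlib's encoding of bounded formulas. -/
def gnum (φ : Snt) : ℕ :=
  Encodable.encode
    (show List ((Σ k, LA.Term (Empty ⊕ Fin k)) ⊕ ((Σ n, LA.Relations n) ⊕ ℕ)) from
      BoundedFormula.encoding.encode (⟨0, φ⟩ : Σ n, LA.BoundedFormula Empty n))

/-- The (axiom set of the) theory `T` is computable. -/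
def CompThy (T : Thy) : Prop :=
  ComputablePred (fun m : ℕ => ∃ φ ∈ T, gnum φ = m)

/-- `T` is a computable consistent extension of `PA`. -/
def GoodThy (T : Thy) : Prop := CompThy T ∧ Con T ∧ ExtPA T

/-- `φ` is `Γ`-conservative over `T` for a class of sentences `Γ`:
every `Γ` sentence provable in `T + φ` is provable in `T`. -/
def ConsIn (Γ : Set Snt) (T : Thy) (φ : Snt) : Prop :=
  ∀ γ ∈ Γ, Prv (add T φ) γ → Prv T γ

/-- `φ` is hereditarily `Γ`-conservative over `T`: `Γ`-conservative over every
subtheory of `T` (containing `PA`). -/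
def HConsIn (Γ : Set Snt) (T : Thy) (φ : Snt) : Prop :=
  ∀ V : Thy, SubThy V T → ConsIn Γ V φ

/-- `φ` is `Σ_k↓Π_k`-conservative over `V`. -/
def SPCons (k : ℕ) (V : Thy) (φ : Snt) : Prop :=
  ∀ σ ∈ SigmaS k, ∀ π ∈ PiS k, Prv (add V φ) (σ ⊓ π) → Prv V (σ ⊔ π)

/-- `φ` is hereditarily `Σ_k↓Π_k`-conservative over `T`. -/
def HSPCons (k : ℕ) (T : Thy) (φ : Snt) : Prop :=
  ∀ V : Thy, SubThy V T → SPCons k V φ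

/-- The theory `S` is `Σ_k↓Π_k`-conservative over `PA`. -/
def ThySPConsPA (k : ℕ) (S : Thy) : Prop :=
  ∀ σ ∈ SigmaS k, ∀ π ∈ PiS k, Prv S (σ ⊓ π) → Prv PAAx (σ ⊔ π)

/-- `δ` is a `Δ_k(S)` sentence: `S`-provably equivalent to both a `Σ_k` sentence
and a `Π_k` sentence. -/
def IsDeltaIn (k : ℕ) (S : Thy) (δ : Snt) : Prop :=
  (∃ σ ∈ SigmaS k, Prv S (δ ⇔ σ)) ∧ ∃ π ∈ PiS k, Prv S (δ ⇔ π)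

/-- `φ` is `Δ_k(S)`-conservative over `V`. -/
def DeltaConsRel (k : ℕ) (S V : Thy) (φ : Snt) : Prop :=
  ∀ δ : Snt, IsDeltaIn k S δ → Prv (add V φ) δ → Prv V δ

/-- `φ` is `Δ_k`-conservative over `T`, i.e. `Δ_k(Th(T))`-conservative over `T`. -/
def DeltaCons (k : ℕ) (T : Thy) (φ : Snt) : Prop := DeltaConsRel k (Th T) T φ

/-- `φ` is hereditarily `Δ_k`-conservative over `T`. -/
def HDeltaCons (k : ℕ) (T : Thy) (φ : Snt) : Prop :=
  ∀ V : Thy, SubThy V T → DeltaConsRel k (Th V) V φ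

/-- `φ` is doubly `Π_k`-conservative over `T`: `φ` is `Π_k`-conservative and `¬φ` is
`Σ_k`-conservative over `T`. -/
def DCons (k : ℕ) (T : Thy) (φ : Snt) : Prop :=
  ConsIn (PiS k) T φ ∧ ConsIn (SigmaS k) T (∼φ)

/-- `φ` is hereditarily doubly `Π_k`-conservative over `T`. -/
def HDCons (k : ℕ) (T : Thy) (φ : Snt) : Prop :=
  ∀ V : Thy, SubThy V T → DCons k V φ

/-- `(T,U)` is a `B_n`-pair. -/
def Bpair (n : ℕ) (T U : Thy) : Prop :=
  (¬ ThIn (PiS n) T ⊆ Th U ∨ Con (T ∪ ThIn (PiS n) U)) ∧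
  (¬ ThIn (PiS n) U ⊆ Th T ∨ Con (U ∪ ThIn (PiS n) T))

/-- `(T,U)` is a `C_n`-pair. -/
def Cpair (n : ℕ) (T U : Thy) : Prop :=
  Con (T ∪ ThIn (PiS n) U) ∧ Con (U ∪ ThIn (PiS n) T)

/-- `(T,U)` is a `C⁻_n`-pair. -/
def Cmpair (n : ℕ) (T U : Thy) : Prop :=
  Con (T ∪ ThIn (PiS n) U) ∨ Con (U ∪ ThIn (PiS n) T)

/-- `(T,U)` is a `C^∧_n`-pair. -/
def Capair (n : ℕ) (T U : Thy) : Prop :=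
  Con (T ∪ ThIn (SigAndPiS n) U) ∧ Con (U ∪ ThIn (SigAndPiS n) T)

/-- `(T,U)` is a `C^B_n`-pair. -/
def CBpair (n : ℕ) (T U : Thy) : Prop :=
  Con (T ∪ ThIn (BSigmaS n) U)




section Part2


/-- Bundled models of `PA`. -/
structure PAM where
  C : Type
  [str : LA.Structure C]
  pa : C ⊨ PAAx

instance : CoeSort PAM Type := ⟨PAM.C⟩
instance (M : PAM) : LA.Structure M := M.str

section basic
variable {M : PAM}

instance : Zero M := ⟨Structure.funMap (L := LA) (n := 0) (show LA.Functions 0 from Unit.unit) ![]⟩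
def sc (x : M) : M := Structure.funMap (L := LA) (n := 1) (show LA.Functions 1 from Unit.unit) ![x]
instance : Add M := ⟨fun x y => Structure.funMap (L := LA) (n := 2) (show LA.Functions 2 from false) ![x, y]⟩
instance : Mul M := ⟨fun x y => Structure.funMap (L := LA) (n := 2) (show LA.Functions 2 from true) ![x, y]⟩
instance : LE M := ⟨fun x y => Structure.RelMap (L := LA) (n := 2) (show LA.Relations 2 from Unit.unit) ![x, y]⟩

@[simp] theorem rz_zeroT {α : Type} {n : ℕ} (v : α ⊕ Fin n → M) : (zeroT : LA.Term (α ⊕ Fin n)).realize v = 0 := by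
  show (Constants.term _ : LA.Term _).realize v = _
  rw [Term.realize_constants]
  show Structure.funMap _ _ = Structure.funMap _ _
  congr 1
@[simp] theorem rz_succT {α : Type} {n : ℕ} (v : α ⊕ Fin n → M) (t : LA.Term (α ⊕ Fin n)) :
    (succT t).realize v = sc (t.realize v) := Term.realize_functions_apply₁
@[simp] theorem rz_addT {α : Type} {n : ℕ} (v : α ⊕ Fin n → M) (t u : LA.Term (α ⊕ Fin n)) :
    (addT t u).realize v = t.realize v + u.realize v := Term.realize_functions_apply₂
@[simp] theorem rz_mulT {α : Type} {n : ℕ} (v : α ⊕ Fin n → M) (t u : LA.Term (α ⊕ Fin n)) :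
    (mulT t u).realize v = t.realize v * u.realize v := Term.realize_functions_apply₂
@[simp] theorem rz_leF {α : Type} {n : ℕ} (v : α → M) (xs : Fin n → M) (t u : LA.Term (α ⊕ Fin n)) :
    (leF t u).Realize v xs ↔ t.realize (Sum.elim v xs) ≤ u.realize (Sum.elim v xs) :=
  BoundedFormula.realize_rel₂
@[simp] theorem rz_vT {n : ℕ} (v : Empty → M) (xs : Fin n → M) (i : Fin n) :
    (vT i).realize (Sum.elim v xs) = xs i := rfl

theorem PAM.ax (M : PAM) {φ : Snt} (h : φ ∈ PAAx) : φ.Realize M := M.pa.realize_of_mem φ h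

theorem sn0 (x y : M) : (Fin.snoc (Fin.snoc (default : Fin 0 → M) x : Fin 1 → M) y : Fin 2 → M) = ![x, y] := by
  funext i; fin_cases i <;> simp [Fin.snoc]
theorem sn1 (x : M) : (Fin.snoc (default : Fin 0 → M) x : Fin 1 → M) = ![x] := by
  funext i; fin_cases i; simp [Fin.snoc]
theorem sn2 (x y z : M) : (Fin.snoc ![x, y] z : Fin 3 → M) = ![x, y, z] := by
  funext i; fin_cases i <;> simp [Fin.snoc]

theorem sc_ne_zero (x : M) : sc x ≠ 0 := by
  have h := M.ax (φ := ∀' ∼(succT (vT 0) =' zeroT)) (by left; simp)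
  have h := h x
  simpa [sn1, BoundedFormula.realize_not] using h
theorem sc_inj {x y : M} (h0 : sc x = sc y) : x = y := by
  have h := M.ax (φ := ∀' ∀' ((succT (vT 0) =' succT (vT 1)) ⟹ (vT 0 =' vT 1))) (by left; simp)
  have h := h x y
  simp [sn0] at h
  exact h h0
theorem add_zero0 (x : M) : x + 0 = x := by
  have h := M.ax (φ := ∀' (addT (vT 0) zeroT =' vT 0)) (by left; simp)
  have h := h x
  simpa [sn1] using h
theorem add_sc (x y : M) : x + sc y = sc (x + y) := by
  have h := M.ax (φ := ∀' ∀' (addT (vT 0) (succT (vT 1)) =' succT (addT (vT 0) (vT 1)))) (by left; simp)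
  have h := h x y
  simpa [sn0] using h
theorem mul_zero0 (x : M) : x * 0 = 0 := by
  have h := M.ax (φ := ∀' (mulT (vT 0) zeroT =' zeroT)) (by left; simp)
  have h := h x
  simpa [sn1] using h
theorem mul_sc (x y : M) : x * sc y = x * y + x := by
  have h := M.ax (φ := ∀' ∀' (mulT (vT 0) (succT (vT 1)) =' addT (mulT (vT 0) (vT 1)) (vT 0))) (by left; simp)
  have h := h x y
  simpa [sn0] using h
theorem le_iff0 (x y : M) : x ≤ y ↔ ∃ z, z + x = y := by
  have h := M.ax (φ := ∀' ∀' (leF (vT 0) (vT 1) ⇔ ∃' (addT (vT 2) (vT 0) =' vT 1))) (by left; simp)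
  have h := h x y
  simpa [sn0, sn2] using h

/-- Induction axiom for one formula. -/
theorem ind_ax {k : ℕ} (φ : LA.BoundedFormula Empty (k + 1)) (a : Fin k → M)
    (h0 : φ.Realize default (Fin.snoc a 0 : Fin (k+1) → M))
    (hs : ∀ x : M, φ.Realize default (Fin.snoc a x : Fin (k+1) → M) →
      φ.Realize default (Fin.snoc a (sc x) : Fin (k+1) → M)) (x : M) :
    φ.Realize default (Fin.snoc a x : Fin (k+1) → M) := by
  have h := M.ax (φ := indAxiom φ) (Or.inr ⟨k, φ, rfl⟩)
  unfold indAxiom at h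
  have h := (BoundedFormula.realize_alls (M := M)).1 h a
  rw [BoundedFormula.realize_imp] at h
  refine h ?_ x
  rw [BoundedFormula.realize_inf]
  constructor
  · intro y hy
    have : y = 0 := by simpa using hy
    rw [this]; exact h0
  · intro y hy z hz
    have : z = sc y := by simpa using hz
    subst this
    rw [BoundedFormula.realize_liftAt_one (by omega)]
    convert hs y hy using 1
    funext i
    refine Fin.lastCases ?_ (fun j => ?_) i
    · simp only [Function.comp, Fin.val_last, lt_irrefl, if_false, Fin.snoc_last]
      have : Fin.succ (Fin.last k) = Fin.last (k+1) := rfl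
      rw [this, Fin.snoc_last]
    · simp only [Function.comp, Fin.val_castSucc, Fin.is_lt, if_true, Fin.snoc_castSucc]

/-- Definable with parameters. -/
class DP {m : ℕ} (P : (Fin m → M) → Prop) : Prop where
  out : ∃ φ : LA.BoundedFormula M m, ∀ v, φ.Realize id v ↔ P v
/-- Terms with parameters. -/
class DT {m : ℕ} (f : (Fin m → M) → M) : Prop where
  out : ∃ t : LA.Term (M ⊕ Fin m), ∀ v, t.realize (Sum.elim id v) = f v

section inst
variable {m : ℕ}
instance (priority := 2000) DT.var (i : Fin m) : DT (fun v : Fin m → M => v i) := ⟨Term.var (Sum.inr i), fun _ => rfl⟩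
instance (priority := 1900) DT.const (a : M) : DT (fun _ : Fin m → M => a) := ⟨Term.var (Sum.inl a), fun _ => rfl⟩
instance DT.sc (f : (Fin m → M) → M) [hf : DT f] : DT (fun v => sc (f v)) := by
  obtain ⟨t, ht⟩ := hf; exact ⟨succT t, fun v => by simp [ht]⟩
instance DT.add (f g : (Fin m → M) → M) [hf : DT f] [hg : DT g] : DT (fun v => f v + g v) := by
  obtain ⟨t, ht⟩ := hf; obtain ⟨u, hu⟩ := hg; exact ⟨addT t u, fun v => by simp [ht, hu]⟩
instance DT.mul (f g : (Fin m → M) → M) [hf : DT f] [hg : DT g] : DT (fun v => f v * g v) := by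
  obtain ⟨t, ht⟩ := hf; obtain ⟨u, hu⟩ := hg; exact ⟨mulT t u, fun v => by simp [ht, hu]⟩
instance DP.eq (f g : (Fin m → M) → M) [hf : DT f] [hg : DT g] : DP (fun v => f v = g v) := by
  obtain ⟨t, ht⟩ := hf; obtain ⟨u, hu⟩ := hg; exact ⟨t =' u, fun v => by simp [ht, hu]⟩
instance DP.le (f g : (Fin m → M) → M) [hf : DT f] [hg : DT g] : DP (fun v => f v ≤ g v) := by
  obtain ⟨t, ht⟩ := hf; obtain ⟨u, hu⟩ := hg; exact ⟨leF t u, fun v => by simp [ht, hu]⟩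
instance DP.imp (P Q : (Fin m → M) → Prop) [hf : DP P] [hg : DP Q] : DP (fun v => P v → Q v) := by
  obtain ⟨t, ht⟩ := hf; obtain ⟨u, hu⟩ := hg; exact ⟨t ⟹ u, fun v => by simp [ht, hu]⟩
instance DP.iff (P Q : (Fin m → M) → Prop) [hf : DP P] [hg : DP Q] : DP (fun v => P v ↔ Q v) := by
  obtain ⟨t, ht⟩ := hf; obtain ⟨u, hu⟩ := hg; exact ⟨t ⇔ u, fun v => by simp [ht, hu]⟩
instance DP.and (P Q : (Fin m → M) → Prop) [hf : DP P] [hg : DP Q] : DP (fun v => P v ∧ Q v) := by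
  obtain ⟨t, ht⟩ := hf; obtain ⟨u, hu⟩ := hg; exact ⟨t ⊓ u, fun v => by simp [ht, hu]⟩
instance DP.or (P Q : (Fin m → M) → Prop) [hf : DP P] [hg : DP Q] : DP (fun v => P v ∨ Q v) := by
  obtain ⟨t, ht⟩ := hf; obtain ⟨u, hu⟩ := hg; exact ⟨t ⊔ u, fun v => by simp [ht, hu]⟩
instance DP.not (P : (Fin m → M) → Prop) [hf : DP P] : DP (fun v => ¬ P v) := by
  obtain ⟨t, ht⟩ := hf; exact ⟨∼t, fun v => by simp [ht]⟩
instance DP.prop (p : Prop) : DP (fun _ : Fin m → M => p) := by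
  by_cases h : p
  · exact ⟨⊤, fun v => by simp [h]⟩
  · exact ⟨⊥, fun v => by simp [h]⟩
instance DP.ex (P : M → (Fin m → M) → Prop)
    [hf : DP (fun w : Fin (m+1) → M => P (w (Fin.last m)) (fun i => w i.castSucc))] : DP (fun v => ∃ x, P x v) := by
  obtain ⟨t, ht⟩ := hf; exact ⟨∃' t, fun v => by simp [ht]⟩
instance DP.all (P : M → (Fin m → M) → Prop)
    [hf : DP (fun w : Fin (m+1) → M => P (w (Fin.last m)) (fun i => w i.castSucc))] : DP (fun v => ∀ x, P x v) := by
  obtain ⟨t, ht⟩ := hf; exact ⟨∀' t, fun v => by simp [ht]⟩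

theorem DP.congr {P Q : (Fin m → M) → Prop} (hP : DP P) (h : ∀ v, P v ↔ Q v) : DP Q := by
  obtain ⟨t, ht⟩ := hP; exact ⟨t, fun v => by rw [ht, h]⟩

theorem DP.subst {k : ℕ} {P : (Fin k → M) → Prop} (hP : DP P) (f : Fin k → (Fin m → M) → M)
    (hf : ∀ i, DT (f i)) : DP (fun v => P (fun i => f i v)) := by
  obtain ⟨φ, hφ⟩ := hP
  choose t ht using fun i => (hf i).out
  refine ⟨(BoundedFormula.relabel (n := m) (id : M ⊕ Fin m → M ⊕ Fin m)
    (φ.toFormula.subst (Sum.elim (fun a => Term.var (Sum.inl a)) t)) : LA.BoundedFormula M (m + 0)), fun v => ?_⟩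
  rw [BoundedFormula.realize_relabel, BoundedFormula.realize_subst]
  rw [← hφ]
  have := BoundedFormula.realize_toFormula φ (Sum.elim id (fun i => f i v))
  have h2 : Sum.elim (id : M → M) (fun i => f i v) ∘ Sum.inl = id := rfl
  have h3 : Sum.elim (id : M → M) (fun i => f i v) ∘ Sum.inr = (fun i => f i v) := rfl
  rw [h2, h3] at this
  rw [← this, Formula.Realize]
  have h4 : (fun a => Term.realize (Sum.elim id (v ∘ Fin.castAdd 0) ∘ id) (Sum.elim (fun a => Term.var (Sum.inl a)) t a)) =
    Sum.elim (id : M → M) (fun i => f i v) := by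
    funext a
    rcases a with a | a
    · rfl
    · simp only [Sum.elim_inr]; rw [← ht]; rfl
  rw [h4]
  exact Iff.of_eq (congrArg _ (funext fun i => i.elim0))
end inst

/-- Induction for definable predicates. -/
theorem ind0 (D : M → Prop) [hD : DP (fun v : Fin 1 → M => D (v 0))] (h0 : D 0)
    (hs : ∀ x, D x → D (sc x)) (x : M) : D x := by
  classical
  obtain ⟨φ, hφ⟩ := hD
  let s := φ.freeVarFinset
  let e : s ≃ Fin s.card := s.equivFin
  let ψ : LA.BoundedFormula Empty (s.card + 1) :=
    (φ.restrictFreeVar e).relabel (Sum.inr : Fin s.card → Empty ⊕ Fin s.card)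
  let a : Fin s.card → M := fun i => (e.symm i : M)
  have key : ∀ x : M, ψ.Realize default (Fin.snoc a x : Fin (s.card+1) → M) ↔ D x := by
    intro x
    rw [BoundedFormula.realize_relabel]
    rw [BoundedFormula.realize_restrictFreeVar (v' := (id : M → M))]
    · rw [hφ]
      have : (Fin.natAdd s.card (0 : Fin 1)) = Fin.last s.card := rfl
      simp only [Function.comp, this, Fin.snoc_last]
    · intro b
      show (Fin.snoc a x : Fin (s.card+1) → M) (Fin.castAdd 1 (e b)) = b
      have : Fin.castAdd 1 (e b) = Fin.castSucc (e b) := rfl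
      rw [this, Fin.snoc_castSucc]; simp [a]
  rw [← key]
  refine ind_ax ψ a ((key _).2 h0) (fun y hy => (key _).2 (hs y ((key _).1 hy))) x

end basic

end Part2

section Part3

section alg
variable {M : PAM}

theorem zero_add0 (x : M) : 0 + x = x :=
  ind0 (fun x : M => 0 + x = x) (add_zero0 _) (fun x h => by rw [add_sc, h]) x
theorem sc_add (x y : M) : sc x + y = sc (x + y) :=
  ind0 (fun y : M => sc x + y = sc (x + y)) (by simp [add_zero0]) (fun y h => by rw [add_sc, h, add_sc]) y
theorem add_comm0 (x y : M) : x + y = y + x :=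
  ind0 (fun y : M => x + y = y + x) (by rw [add_zero0, zero_add0]) (fun y h => by rw [add_sc, h, sc_add]) y
theorem add_assoc0 (x y z : M) : x + y + z = x + (y + z) :=
  ind0 (fun z : M => x + y + z = x + (y + z)) (by simp [add_zero0]) (fun y h => by simp [add_sc, h]) z
theorem mul_add0 (x y z : M) : x * (y + z) = x * y + x * z :=
  ind0 (fun z : M => x * (y + z) = x * y + x * z) (by simp [add_zero0, mul_zero0])
    (fun y h => by rw [add_sc, mul_sc, h, mul_sc, add_assoc0]) z
theorem zero_mul0 (x : M) : 0 * x = 0 :=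
  ind0 (fun x : M => 0 * x = 0) (mul_zero0 _) (fun x h => by rw [mul_sc, h, add_zero0]) x
theorem sc_mul (x y : M) : sc x * y = x * y + y :=
  ind0 (fun y : M => sc x * y = x * y + y) (by simp [add_zero0, mul_zero0])
    (fun y h => by rw [mul_sc, h, mul_sc, add_sc, add_sc, add_assoc0, add_assoc0, add_comm0 y x]) y
theorem mul_comm0 (x y : M) : x * y = y * x :=
  ind0 (fun y : M => x * y = y * x) (by rw [mul_zero0, zero_mul0]) (fun y h => by rw [mul_sc, h, sc_mul]) y
theorem mul_assoc0 (x y z : M) : x * y * z = x * (y * z) :=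
  ind0 (fun z : M => x * y * z = x * (y * z)) (by simp [mul_zero0]) (fun y h => by simp [mul_sc, h, mul_add0]) z

instance : One M := ⟨sc 0⟩
theorem one_def : (1 : M) = sc 0 := rfl
theorem mul_one0 (x : M) : x * 1 = x := by rw [one_def, mul_sc, mul_zero0, zero_add0]

instance : CommSemiring M where
  add_assoc := add_assoc0
  zero_add := zero_add0
  add_zero := add_zero0
  add_comm := add_comm0
  nsmul := nsmulRec
  left_distrib := mul_add0
  right_distrib x y z := by rw [mul_comm0, mul_add0, mul_comm0 z, mul_comm0 z]
  zero_mul := zero_mul0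
  mul_zero := mul_zero0
  mul_assoc := mul_assoc0
  one_mul x := by rw [mul_comm0, mul_one0]
  mul_one := mul_one0
  mul_comm := mul_comm0

theorem sc_eq (x : M) : sc x = x + 1 := by rw [one_def, add_sc, add_zero]

theorem ind (D : M → Prop) [hD : DP (fun v : Fin 1 → M => D (v 0))] (h0 : D 0)
    (hs : ∀ x, D x → D (x + 1)) (x : M) : D x :=
  ind0 D h0 (fun x h => by rw [sc_eq]; exact hs x h) x

theorem add_left_cancel0 (x y z : M) (h : x + y = x + z) : y = z := by
  have : ∀ x : M, x + y = x + z → y = z := ind0 (fun x : M => x + y = x + z → y = z)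
    (by simp) (fun x h h2 => h (by rw [sc_add, sc_add] at h2; exact sc_inj h2))
  exact this x h

theorem zero_or_sc (x : M) : x = 0 ∨ ∃ y, x = y + 1 :=
  ind (fun x : M => x = 0 ∨ ∃ y, x = y + 1) (Or.inl rfl) (fun x _ => Or.inr ⟨x, rfl⟩) x

theorem add_eq_zero0 (x y : M) (h : x + y = 0) : y = 0 := by
  rcases zero_or_sc y with h1 | ⟨z, rfl⟩
  · exact h1
  · rw [← add_assoc, ← sc_eq] at h; exact absurd h (sc_ne_zero _)

theorem le_def (x y : M) : x ≤ y ↔ ∃ z, y = x + z := by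
  rw [le_iff0]; exact exists_congr fun z => by rw [add_comm]; exact eq_comm

theorem le_total0 (x y : M) : x ≤ y ∨ y ≤ x := by
  refine ind (fun y : M => x ≤ y ∨ y ≤ x) ?_ ?_ y
  · right; rw [le_def]; exact ⟨x, by simp⟩
  · intro y h
    simp only [le_def] at *
    rcases h with ⟨z, rfl⟩ | ⟨z, rfl⟩
    · left; exact ⟨z + 1, by ring⟩
    · rcases zero_or_sc z with rfl | ⟨w, rfl⟩
      · left; exact ⟨1, by ring⟩
      · right; exact ⟨w, by ring⟩

noncomputable instance : LinearOrder M where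
  le_refl x := (le_def _ _).2 ⟨0, by simp⟩
  le_trans x y z := by
    simp only [le_def]; rintro ⟨a, rfl⟩ ⟨b, rfl⟩; exact ⟨a + b, by ring⟩
  le_antisymm x y := by
    simp only [le_def]; rintro ⟨a, rfl⟩ ⟨b, h⟩
    have : a + b = 0 := add_left_cancel0 x _ _ (by rw [← add_assoc, ← h, add_zero])
    rw [add_eq_zero0 b a (by rw [add_comm]; exact this), add_zero]
  le_total := le_total0
  toDecidableLE := Classical.decRel _

instance : IsCancelAdd M where
  add_left_cancel x y z h := add_left_cancel0 x y z h
  add_right_cancel x y z h := add_left_cancel0 x y z (by simpa [add_comm] using h)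

instance : Nontrivial M := ⟨0, 1, fun h => sc_ne_zero _ h.symm⟩

instance : IsStrictOrderedRing M where
  add_le_add_left x y h z := by
    rw [le_def] at *; obtain ⟨a, rfl⟩ := h; exact ⟨a, by ring⟩
  zero_le_one := (le_def _ _).2 ⟨1, by simp⟩
  le_of_add_le_add_left x y z h := by
    rw [le_def] at *; obtain ⟨a, h⟩ := h; exact ⟨a, add_left_cancel0 x _ _ (by rw [h]; ring)⟩
  mul_lt_mul_of_pos_left a ha b c h := by
    have hbc := h.le
    rw [le_def] at hbc; obtain ⟨z, rfl⟩ := hbc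
    refine lt_of_le_of_ne ((le_def _ _).2 ⟨a * z, by ring⟩) ?_
    intro he
    have : a * z = 0 := (add_left_cancel0 (a*b) 0 (a * z) (by rw [add_zero]; simpa [mul_add] using he)).symm
    rcases zero_or_sc z with rfl | ⟨w, rfl⟩
    · simp at h
    · rcases zero_or_sc a with rfl | ⟨a', rfl⟩
      · exact lt_irrefl _ ha
      · have h1 : (a' * w + a' + w) + 1 = 0 := by rw [← this]; ring
        exact absurd h1 (by rw [← sc_eq]; exact sc_ne_zero _)
  mul_lt_mul_of_pos_right a ha b c h := by
    have hbc := h.le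
    rw [le_def] at hbc; obtain ⟨z, rfl⟩ := hbc
    refine lt_of_le_of_ne ((le_def _ _).2 ⟨a * z, by ring⟩) ?_
    intro he
    have : a * z = 0 := (add_left_cancel0 (a*b) 0 (a * z) (by rw [add_zero]; simpa [mul_add, add_mul, mul_comm] using he)).symm
    rcases zero_or_sc z with rfl | ⟨w, rfl⟩
    · simp at h
    · rcases zero_or_sc a with rfl | ⟨a', rfl⟩
      · exact lt_irrefl _ ha
      · have h1 : (a' * w + a' + w) + 1 = 0 := by rw [← this]; ring
        exact absurd h1 (by rw [← sc_eq]; exact sc_ne_zero _)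

instance : CanonicallyOrderedAdd M where
  exists_add_of_le h := (le_def _ _).1 h
  le_self_add a b := (le_def _ _).2 ⟨b, rfl⟩
  le_add_self a b := (le_def _ _).2 ⟨b, by ring⟩

theorem lt_iff (x y : M) : x < y ↔ x + 1 ≤ y := by
  constructor
  · intro h
    obtain ⟨z, rfl⟩ := (le_def _ _).1 h.le
    rcases zero_or_sc z with rfl | ⟨w, rfl⟩
    · simp at h
    · exact (le_def _ _).2 ⟨w, by ring⟩
  · intro h; exact lt_of_lt_of_le (lt_add_one x) h
theorem lt_succ (x y : M) : x < y + 1 ↔ x ≤ y := by rw [lt_iff]; simp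
theorem le_succ (x y : M) : x ≤ y + 1 ↔ x ≤ y ∨ x = y + 1 := by
  rw [← lt_succ x y]; exact le_iff_lt_or_eq

instance DT.one {m : ℕ} : DT (fun _ : Fin m → M => (1 : M)) := inferInstance
instance DP.lt {m : ℕ} (f g : (Fin m → M) → M) [hf : DT f] [hg : DT g] : DP (fun v => f v < g v) :=
  DP.congr (P := fun v => f v + 1 ≤ g v) inferInstance (fun _ => (lt_iff _ _).symm)
instance DP.ne {m : ℕ} (f g : (Fin m → M) → M) [hf : DT f] [hg : DT g] : DP (fun v => f v ≠ g v) :=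
  DP.not (fun v => f v = g v)

/-- strong induction -/
theorem sind (D : M → Prop) [hD : DP (fun v : Fin 1 → M => D (v 0))]
    (hs : ∀ x, (∀ y < x, D y) → D x) (x : M) : D x := by
  have : ∀ x : M, ∀ y < x, D y := by
    refine ind (hD := ?_) (fun x : M => ∀ y < x, D y) (by simp) ?_
    · refine @DP.all _ _ _ (@DP.imp _ _ _ _ inferInstance ?_)
      exact DP.subst hD (fun _ w => w (Fin.last 1)) (fun _ => inferInstance)
    · intro x h y hy
      rw [lt_succ] at hy
      rcases hy.lt_or_eq with h1 | rfl
      · exact h y h1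
      · exact hs y h
  exact this (x + 1) x (lt_add_one x)

theorem least (D : M → Prop) [hD : DP (fun v : Fin 1 → M => D (v 0))] (x : M) (hx : D x) :
    ∃ y, y ≤ x ∧ D y ∧ ∀ z < y, ¬ D z := by
  by_contra hc
  push Not at hc
  have := sind (fun y : M => y ≤ x → ¬ D y) (hD := ?_) ?_ x le_rfl hx
  · exact this
  · exact @DP.imp _ _ _ _ inferInstance (@DP.not _ _ _ hD)
  · intro y hy hyx h
    obtain ⟨z, hz, hz2⟩ := hc y hyx h
    exact hy z hz (hz.le.trans hyx) hz2

theorem le_nat (n : ℕ) : ∀ x : M, x ≤ (n : M) → ∃ k : ℕ, k ≤ n ∧ x = k := by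
  induction n with
  | zero => intro x h; exact ⟨0, le_rfl, by simpa using h⟩
  | succ n ih =>
    intro x h
    push_cast at h
    rcases (le_succ _ _).1 h with h | h
    · obtain ⟨k, hk, rfl⟩ := ih x h; exact ⟨k, by omega, rfl⟩
    · exact ⟨n + 1, le_rfl, by rw [h]; push_cast; rfl⟩

end alg

/-- the standard structure -/
@[reducible] def natStr : LA.Structure ℕ where
  funMap {n} f v := match n, f, v with
    | 0, _, _ => 0
    | 1, _, v => v 0 + 1
    | 2, false, v => v 0 + v 1
    | 2, true, v => v 0 * v 1
  RelMap {n} r v := match n, r, v with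
    | 2, _, v => v 0 ≤ v 1

theorem nat_pa : @Theory.Model LA ℕ natStr PAAx := by
  let _ := natStr
  have z : ∀ {α : Type} {n : ℕ} (v : α ⊕ Fin n → ℕ), (zeroT : LA.Term (α ⊕ Fin n)).realize v = 0 := fun v => rfl
  have s : ∀ {α : Type} {n : ℕ} (v : α ⊕ Fin n → ℕ) (t : LA.Term (α ⊕ Fin n)),
    (succT t).realize v = t.realize v + 1 := fun v t => rfl
  have a : ∀ {α : Type} {n : ℕ} (v : α ⊕ Fin n → ℕ) (t u : LA.Term (α ⊕ Fin n)),
    (addT t u).realize v = t.realize v + u.realize v := fun v t u => rfl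
  have m : ∀ {α : Type} {n : ℕ} (v : α ⊕ Fin n → ℕ) (t u : LA.Term (α ⊕ Fin n)),
    (mulT t u).realize v = t.realize v * u.realize v := fun v t u => rfl
  have l : ∀ {n : ℕ} (v : Empty → ℕ) (xs : Fin n → ℕ) (t u : LA.Term (Empty ⊕ Fin n)),
    (leF t u).Realize v xs ↔ t.realize (Sum.elim v xs) ≤ u.realize (Sum.elim v xs) := fun v xs t u => Iff.rfl
  have hv : ∀ {n : ℕ} (v : Empty → ℕ) (xs : Fin n → ℕ) (i : Fin n),
    (vT i).realize (Sum.elim v xs) = xs i := fun v xs t => rfl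
  constructor
  rintro φ (h | ⟨k, ψ, rfl⟩)
  · simp only [Set.mem_insert_iff, Set.mem_singleton_iff] at h
    rcases h with rfl | rfl | rfl | rfl | rfl | rfl | rfl
    all_goals simp only [Sentence.Realize, Formula.Realize, BoundedFormula.realize_all, BoundedFormula.realize_not,
      BoundedFormula.realize_imp, BoundedFormula.realize_iff, BoundedFormula.realize_ex, BoundedFormula.realize_bdEqual, z, s, a, m, l, hv]
    · intro x; omega
    · intro x y h; omega
    · intro x; omega
    · intro x y; omega
    · intro x; simp
    · intro x y; ring
    · intro x y
      show x ≤ y ↔ ∃ z, z + x = y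
      exact ⟨fun h => ⟨y - x, by omega⟩, fun ⟨z, h⟩ => by omega⟩
  · unfold indAxiom
    refine (BoundedFormula.realize_alls (M := ℕ)).2 (fun v => ?_)
    rw [BoundedFormula.realize_imp, BoundedFormula.realize_inf]
    rintro ⟨h1, h2⟩ x
    induction x with
    | zero => exact h1 0 (by simp [z, hv])
    | succ n ih =>
      have := h2 n ih (n + 1) (by simp [s, hv])
      rw [BoundedFormula.realize_liftAt_one (by omega)] at this
      convert this using 1
      funext i
      refine Fin.lastCases ?_ (fun j => ?_) i
      · simp only [Function.comp, Fin.val_last, lt_irrefl, if_false, Fin.snoc_last]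
        have : Fin.succ (Fin.last k) = Fin.last (k+1) := rfl
        rw [this, Fin.snoc_last]
      · simp only [Function.comp, Fin.val_castSucc, Fin.is_lt, if_true, Fin.snoc_castSucc]

def N0 : PAM := @PAM.mk ℕ natStr nat_pa
def ofN (n : ℕ) : N0 := n
def toN (x : N0) : ℕ := x
theorem N0_cast (n : ℕ) : (Nat.cast n : N0) = ofN n := by
  induction n with
  | zero => exact Nat.cast_zero
  | succ n ih => rw [Nat.cast_succ, ih, ← sc_eq]; rfl
theorem exists_std : ∃ N : PAM, ∀ x : N, ∃ n : ℕ, x = Nat.cast n := 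
  ⟨N0, fun x => ⟨toN x, (N0_cast (toN x)).symm⟩⟩

/-- the standard model -/
noncomputable def NN : PAM := exists_std.choose
theorem NN_std (x : NN) : ∃ n : ℕ, x = n := exists_std.choose_spec x
instance (M : PAM) : CharZero M := inferInstance

end Part3

section Part4


/-- uniform families of relations on models of PA -/
abbrev Fam (m : ℕ) := ∀ M : PAM, (Fin m → M) → Prop

class UT {m : ℕ} (f : ∀ M : PAM, (Fin m → M) → M) : Prop where
  out : ∃ t : LA.Term (Empty ⊕ Fin m), ∀ M v, t.realize (Sum.elim default v) = f M v

section
variable {m : ℕ}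
instance (priority := 2000) UT.var (i : Fin m) : UT (fun (M : PAM) (v : Fin m → M) => v i) :=
  ⟨Term.var (Sum.inr i), fun _ _ => rfl⟩
instance UT.zero : UT (fun (M : PAM) (_ : Fin m → M) => (0 : M)) := ⟨zeroT, fun M v => by simp⟩
instance UT.one : UT (fun (M : PAM) (_ : Fin m → M) => (1 : M)) := ⟨succT zeroT, fun M v => by simp [one_def]⟩
instance UT.add (f g : ∀ M : PAM, (Fin m → M) → M) [hf : UT f] [hg : UT g] : UT (fun M v => f M v + g M v) := by
  obtain ⟨t, ht⟩ := hf; obtain ⟨u, hu⟩ := hg; exact ⟨addT t u, fun M v => by simp [ht, hu]⟩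
instance UT.mul (f g : ∀ M : PAM, (Fin m → M) → M) [hf : UT f] [hg : UT g] : UT (fun M v => f M v * g M v) := by
  obtain ⟨t, ht⟩ := hf; obtain ⟨u, hu⟩ := hg; exact ⟨mulT t u, fun M v => by simp [ht, hu]⟩
instance UT.nat (n : ℕ) : UT (fun (M : PAM) (_ : Fin m → M) => (n : M)) := by
  induction n with
  | zero => simpa using UT.zero
  | succ n ih => simpa using UT.add _ _ (hf := ih) (hg := UT.one)
instance UT.ofnat (n : ℕ) [n.AtLeastTwo] : UT (fun (M : PAM) (_ : Fin m → M) => (OfNat.ofNat n : M)) :=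
  UT.nat n
end

/-- uniformly definable -/
def UD {m : ℕ} (P : Fam m) : Prop :=
  ∃ φ : LA.BoundedFormula Empty m, ∀ M v, φ.Realize default v ↔ P M v

def D0 {m : ℕ} (P : Fam m) : Prop :=
  ∃ φ : LA.BoundedFormula Empty m, IsDelta0 φ ∧ ∀ M v, φ.Realize default v ↔ P M v

theorem UD.dp {k m : ℕ} {P : Fam k} (hP : UD P) {M : PAM} (f : Fin k → (Fin m → M) → M)
    (hf : ∀ i, DT (f i)) : DP (fun v => P M (fun i => f i v)) := by
  obtain ⟨φ, hφ⟩ := hP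
  refine DP.subst (P := P M) ?_ f hf
  refine ⟨(BoundedFormula.relabel (n := 0) (Empty.elim : Empty → M ⊕ Fin 0) φ).castLE (by omega), fun v => ?_⟩
  rw [BoundedFormula.realize_castLE_of_eq (by omega), BoundedFormula.realize_relabel, ← hφ]
  apply Iff.of_eq; congr 1
  · funext i; exact i.elim
  · funext i; simp only [Function.comp]; congr 1; ext; simp

theorem IsDelta0.not {m : ℕ} {φ : LA.BoundedFormula Empty m} (h : IsDelta0 φ) : IsDelta0 (∼φ) := h.imp .falsum

theorem D0.not {m : ℕ} {P : Fam m} (h : D0 P) : D0 (fun M v => ¬ P M v) := by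
  obtain ⟨φ, h1, h2⟩ := h; exact ⟨∼φ, h1.not, fun M v => by simp [h2]⟩
theorem D0.imp {m : ℕ} {P Q : Fam m} (h : D0 P) (h' : D0 Q) : D0 (fun M v => P M v → Q M v) := by
  obtain ⟨φ, h1, h2⟩ := h; obtain ⟨ψ, h3, h4⟩ := h'; exact ⟨φ ⟹ ψ, h1.imp h3, fun M v => by simp [h2, h4]⟩
theorem D0.congr {m : ℕ} {P Q : Fam m} (h : D0 P) (h' : ∀ M v, P M v ↔ Q M v) : D0 Q := by
  obtain ⟨φ, h1, h2⟩ := h; exact ⟨φ, h1, fun M v => by rw [h2, h']⟩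
theorem D0.and {m : ℕ} {P Q : Fam m} (h : D0 P) (h' : D0 Q) : D0 (fun M v => P M v ∧ Q M v) :=
  (h.imp h'.not).not.congr (fun M v => by tauto)
theorem D0.or {m : ℕ} {P Q : Fam m} (h : D0 P) (h' : D0 Q) : D0 (fun M v => P M v ∨ Q M v) :=
  (h.not.imp h').congr (fun M v => by tauto)
theorem D0.eq {m : ℕ} (f g : ∀ M : PAM, (Fin m → M) → M) [hf : UT f] [hg : UT g] : D0 (fun M v => f M v = g M v) := by
  obtain ⟨t, ht⟩ := hf; obtain ⟨u, hu⟩ := hg; exact ⟨t =' u, .equal _ _, fun M v => by simp [ht, hu]⟩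
theorem D0.le {m : ℕ} (f g : ∀ M : PAM, (Fin m → M) → M) [hf : UT f] [hg : UT g] : D0 (fun M v => f M v ≤ g M v) := by
  obtain ⟨t, ht⟩ := hf; obtain ⟨u, hu⟩ := hg; exact ⟨leF t u, .le _ _, fun M v => by simp [ht, hu]⟩
theorem snoc_rl {m : ℕ} {M : PAM} (t : LA.Term (Empty ⊕ Fin m)) (v : Fin m → M) (x : M) :
    (t.relabel (Sum.map id Fin.castSucc)).realize (Sum.elim default (Fin.snoc v x : Fin (m+1) → M)) = t.realize (Sum.elim default v) := by
  rw [Term.realize_relabel]; congr 1; funext i; rcases i with i | i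
  · exact i.elim
  · simp
theorem snoc_rl' {m : ℕ} {M : PAM} (t : LA.Term (Empty ⊕ Fin m)) (v : Fin m → M) (x : M) :
    t.realize (Sum.elim default (Fin.snoc v x : Fin (m+1) → M) ∘ (Sum.map id Fin.castSucc)) = t.realize (Sum.elim default v) := by
  rw [← snoc_rl t v x, Term.realize_relabel]
theorem D0.ball {m : ℕ} (f : ∀ M : PAM, (Fin m → M) → M) [hf : UT f] {P : Fam (m+1)} (h : D0 P) :
    D0 (fun M v => ∀ x, x ≤ f M v → P M (Fin.snoc v x)) := by
  obtain ⟨t, ht⟩ := hf; obtain ⟨φ, h1, h2⟩ := h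
  exact ⟨_, .ball t h1, fun M v => by simp [← h2, ← ht, snoc_rl']⟩
theorem D0.bex {m : ℕ} (f : ∀ M : PAM, (Fin m → M) → M) [hf : UT f] {P : Fam (m+1)} (h : D0 P) :
    D0 (fun M v => ∃ x, x ≤ f M v ∧ P M (Fin.snoc v x)) :=
  (D0.ball f h.not).not.congr (fun M v => by push Not; rfl)

theorem tsub_rz {m k : ℕ} {M : PAM} (t : Fin m → LA.Term (Empty ⊕ Fin k)) (u : LA.Term (Empty ⊕ Fin m)) (v : Fin k → M) :
    (u.subst (Sum.elim (fun e => e.elim) t)).realize (Sum.elim default v) =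
    u.realize (Sum.elim default (fun i => (t i).realize (Sum.elim default v))) := by
  rw [Term.realize_subst]; congr 1; funext i; rcases i with i | i
  · exact i.elim
  · rfl

theorem delta0_subst {m : ℕ} {φ : LA.BoundedFormula Empty m} (h : IsDelta0 φ) :
    ∀ (k : ℕ) (t : Fin m → LA.Term (Empty ⊕ Fin k)),
    D0 (fun (M : PAM) (v : Fin k → M) => φ.Realize default (fun i => (t i).realize (Sum.elim default v))) := by
  have aux : ∀ {m k : ℕ} (t : Fin m → LA.Term (Empty ⊕ Fin k)) (M : PAM) (v : Fin k → M) (x : M),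
      (fun i => ((Fin.snoc (fun i => (t i).relabel (Sum.map id Fin.castSucc)) (vT (Fin.last k)) :
        Fin (m+1) → LA.Term (Empty ⊕ Fin (k+1))) i).realize (Sum.elim default (Fin.snoc v x : Fin (k+1) → M))) =
      (Fin.snoc (fun i => (t i).realize (Sum.elim default v)) x : Fin (m+1) → M) := by
    intro m k t M v x
    funext i
    refine Fin.lastCases ?_ (fun j => ?_) i
    · simp
    · simp [snoc_rl']
  induction h with
  | falsum => intro k t; exact ⟨⊥, .falsum, fun M v => Iff.rfl⟩
  | equal a b => intro k t; exact ⟨_, .equal _ _, fun M v => by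
      beta_reduce; rw [BoundedFormula.realize_bdEqual, BoundedFormula.realize_bdEqual, ← tsub_rz, ← tsub_rz]⟩
  | le a b => intro k t; exact ⟨_, .le _ _, fun M v => by beta_reduce; rw [rz_leF, rz_leF, ← tsub_rz, ← tsub_rz]⟩
  | imp h1 h2 ih1 ih2 => intro k t; exact ((ih1 k t).imp (ih2 k t)).congr (fun M v => by simp)
  | @ball m u ψ h ih =>
    intro k t
    refine (D0.ball (fun M v => (u.subst (Sum.elim (fun e => e.elim) t)).realize (Sum.elim default v)) (hf := ⟨_, fun M v => rfl⟩)
      (ih (k+1) (Fin.snoc (fun i => (t i).relabel (Sum.map id Fin.castSucc)) (vT (Fin.last k))))).congr (fun M v => ?_)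
    simp only [aux, tsub_rz]
    simp [snoc_rl']
  | @bex m u ψ h ih =>
    intro k t
    refine (D0.bex (fun M v => (u.subst (Sum.elim (fun e => e.elim) t)).realize (Sum.elim default v)) (hf := ⟨_, fun M v => rfl⟩)
      (ih (k+1) (Fin.snoc (fun i => (t i).relabel (Sum.map id Fin.castSucc)) (vT (Fin.last k))))).congr (fun M v => ?_)
    simp only [aux, tsub_rz]
    simp [snoc_rl']

theorem D0.subst {m k : ℕ} {P : Fam m} (h : D0 P) (f : Fin m → ∀ M : PAM, (Fin k → M) → M) (hf : ∀ i, UT (f i)) :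
    D0 (fun M v => P M (fun i => f i M v)) := by
  obtain ⟨φ, h1, h2⟩ := h
  choose t ht using fun i => (hf i).out
  refine (delta0_subst h1 k t).congr (fun M v => ?_)
  rw [← h2]; simp only [ht]

/-- collection -/
theorem collection {M : PAM} (R : M → M → Prop) (hR : DP (fun v : Fin 2 → M => R (v 0) (v 1))) (t : M) :
    ∃ z, ∀ x ≤ t, (∃ y, R x y) → ∃ y ≤ z, R x y := by
  refine ind (fun t : M => ∃ z, ∀ x ≤ t, (∃ y, R x y) → ∃ y ≤ z, R x y) (hD := ?_) ?_ ?_ t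
  · have h1 : DP (fun w : Fin 4 → M => R (w 2) (w 3)) := DP.subst hR ![fun w => w 2, fun w => w 3]
      (fun i => by fin_cases i <;> exact DT.var _)
    have h2 : DP (fun w : Fin 3 → M => ∃ y, R (w 2) y) := DP.ex (fun y w => R (w 2) y) (hf := h1)
    have h3 : DP (fun w : Fin 3 → M => ∃ y, y ≤ w 1 ∧ R (w 2) y) :=
      DP.ex (fun y w => y ≤ w 1 ∧ R (w 2) y) (hf := @DP.and _ _ _ _ inferInstance h1)
    exact @DP.ex _ _ _ (@DP.all _ _ _ (@DP.imp _ _ _ _ (DP.le (fun w : Fin 3 → M => w 2) (fun w => w 0)) (@DP.imp _ _ _ _ h2 h3)))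
  · by_cases h : ∃ y, R 0 y
    · obtain ⟨y, hy⟩ := h
      exact ⟨y, fun x hx _ => ⟨y, le_rfl, by rwa [show x = 0 by simpa using hx]⟩⟩
    · exact ⟨0, fun x hx h2 => absurd (by rwa [show x = 0 by simpa using hx] at h2) h⟩
  · rintro t ⟨z, hz⟩
    by_cases h : ∃ y, R (t+1) y
    · obtain ⟨y, hy⟩ := h
      refine ⟨z + y, fun x hx h3 => ?_⟩
      rcases (le_succ _ _).1 hx with h1 | rfl
      · obtain ⟨y', h4, h5⟩ := hz x h1 h3
        exact ⟨y', h4.trans le_self_add, h5⟩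
      · exact ⟨y, le_add_self, hy⟩
    · refine ⟨z, fun x hx h3 => ?_⟩
      rcases (le_succ _ _).1 hx with h1 | rfl
      · exact hz x h1 h3
      · exact absurd h3 h

/-- semantic Σ_k families -/
def SigF : ℕ → ∀ {m : ℕ}, Fam m → Prop
  | 0, _, P => D0 P
  | k + 1, m, P => ∃ Q : Fam (m+1), SigF k Q ∧ ∀ M v, P M v ↔ ∃ y, ¬ Q M (Fin.snoc v y)

theorem SigF.congr {k m : ℕ} {P Q : Fam m} (h : SigF k P) (h' : ∀ M v, P M v ↔ Q M v) : SigF k Q := by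
  have : P = Q := by funext M v; exact propext (h' M v)
  rwa [← this]

theorem SigF.subst {k : ℕ} : ∀ {m l : ℕ} {P : Fam m} (_ : SigF k P) (f : Fin m → ∀ M : PAM, (Fin l → M) → M) (_ : ∀ i, UT (f i)),
    SigF k (fun M v => P M (fun i => f i M v)) := by
  induction k with
  | zero => intro m l P h f hf; exact D0.subst h f hf
  | succ k ih =>
    rintro m l P ⟨Q, hQ, hP⟩ f hf
    refine ⟨_, ih hQ (Fin.snoc (α := fun _ => ∀ M : PAM, (Fin (l+1) → M) → M)
      (fun i M w => f i M (fun j => w j.castSucc)) (fun M w => w (Fin.last l))) ?_, fun M v => ?_⟩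
    · intro i
      refine Fin.lastCases ?_ (fun j => ?_) i
      · simp only [Fin.snoc_last]; infer_instance
      · simp only [Fin.snoc_castSucc]
        obtain ⟨t, ht⟩ := (hf j).out
        refine ⟨t.relabel (Sum.map id Fin.castSucc), fun M v => ?_⟩
        rw [← ht, Term.realize_relabel]; congr 1; funext i; rcases i with i | i
        · exact i.elim
        · rfl
    · beta_reduce; rw [hP]
      refine exists_congr fun y => not_congr (Iff.of_eq (congrArg _ ?_))
      funext i
      refine Fin.lastCases ?_ (fun j => ?_) i
      · simp
      · simp

theorem SigF.ud {k : ℕ} : ∀ {m : ℕ} {P : Fam m}, SigF k P → UD P := by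
  induction k with
  | zero => rintro m P ⟨φ, _, h⟩; exact ⟨φ, h⟩
  | succ k ih =>
    rintro m P ⟨Q, hQ, hP⟩
    obtain ⟨φ, h⟩ := ih hQ
    exact ⟨∃' ∼φ, fun M v => by simp [hP, h]⟩

/-- closure package -/
structure Clo (k : ℕ) : Prop where
  and : ∀ {m : ℕ} {P Q : Fam m}, SigF k P → SigF k Q → SigF k (fun M v => P M v ∧ Q M v)
  or : ∀ {m : ℕ} {P Q : Fam m}, SigF k P → SigF k Q → SigF k (fun M v => P M v ∨ Q M v)
  ball : ∀ {m : ℕ} (f : ∀ M : PAM, (Fin m → M) → M) (_ : UT f) {P : Fam (m+1)}, SigF k P →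
    SigF k (fun M v => ∀ x, x ≤ f M v → P M (Fin.snoc v x))
  bex : ∀ {m : ℕ} (f : ∀ M : PAM, (Fin m → M) → M) (_ : UT f) {P : Fam (m+1)}, SigF k P →
    SigF k (fun M v => ∃ x, x ≤ f M v ∧ P M (Fin.snoc v x))

theorem UT.lift {m : ℕ} {f : ∀ M : PAM, (Fin m → M) → M} (h : UT f) :
    UT (fun (M : PAM) (w : Fin (m+1) → M) => f M (fun j => w j.castSucc)) := by
  obtain ⟨t, ht⟩ := h
  refine ⟨t.relabel (Sum.map id Fin.castSucc), fun M v => ?_⟩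
  rw [← ht, Term.realize_relabel]; congr 1; funext i; rcases i with i | i
  · exact i.elim
  · rfl

/-- substitution of a family in `m+1` variables: drop an intermediate variable -/
theorem SigF.skip {k m : ℕ} {Q : Fam (m+1)} (h : SigF k Q) :
    SigF k (fun (M : PAM) (w : Fin (m+1+1) → M) => Q M (Fin.snoc (fun j => w j.castSucc.castSucc) (w (Fin.last _)))) := by
  refine (h.subst (Fin.snoc (α := fun _ => ∀ M : PAM, (Fin (m+1+1) → M) → M)
      (fun i M w => w i.castSucc.castSucc) (fun M w => w (Fin.last _))) ?_).congr ?_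
  · intro i
    refine Fin.lastCases ?_ (fun j => ?_) i
    · simp only [Fin.snoc_last]; infer_instance
    · simp only [Fin.snoc_castSucc]; infer_instance
  · intro M v
    apply Iff.of_eq; congr 1; funext i
    refine Fin.lastCases ?_ (fun j => ?_) i <;> simp
/-- drop the two intermediate variables swapped: `w = v, z, x, y` to `v, x, y` -/
theorem SigF.skip2 {k m : ℕ} {Q : Fam (m+1+1)} (h : SigF k Q) :
    SigF k (fun (M : PAM) (w : Fin (m+1+1+1) → M) => Q M (Fin.snoc (Fin.snoc (fun j => w j.castSucc.castSucc.castSucc)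
      (w (Fin.last (m+1)).castSucc) : Fin (m+1) → M) (w (Fin.last _)))) := by
  refine (h.subst (Fin.snoc (α := fun _ => ∀ M : PAM, (Fin (m+1+1+1) → M) → M) (Fin.snoc (α := fun _ => ∀ M : PAM, (Fin (m+1+1+1) → M) → M)
      (fun i M w => w i.castSucc.castSucc.castSucc) (fun M w => w (Fin.last (m+1)).castSucc)) (fun M w => w (Fin.last _))) ?_).congr ?_
  · intro i
    refine Fin.lastCases ?_ (fun j => ?_) i
    · simp only [Fin.snoc_last]; infer_instance
    · simp only [Fin.snoc_castSucc]
      refine Fin.lastCases ?_ (fun j => ?_) j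
      · simp only [Fin.snoc_last]; infer_instance
      · simp only [Fin.snoc_castSucc]; infer_instance
  · intro M v
    apply Iff.of_eq; congr 1; funext i
    refine Fin.lastCases ?_ (fun j => ?_) i
    · simp
    · refine Fin.lastCases ?_ (fun j => ?_) j <;> simp

theorem clo : ∀ k, Clo k
  | 0 => ⟨fun h h' => D0.and h h', fun h h' => D0.or h h', fun f _ _ h => D0.ball f h, fun f _ _ h => D0.bex f h⟩
  | k + 1 => by
    have ih := clo k
    have last : ∀ m : ℕ, UT (fun (M : PAM) (w : Fin (m+1) → M) => w (Fin.last m)) := fun m => inferInstance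
    have last' : ∀ m : ℕ, UT (fun (M : PAM) (w : Fin (m+1+1) → M) => w (Fin.last m).castSucc) := fun m => inferInstance
    refine ⟨?_, ?_, ?_, ?_⟩
    · rintro m P Q ⟨A, hA, hA2⟩ ⟨B, hB, hB2⟩
      refine ⟨_, ih.or (ih.ball _ (last m) hA.skip) (ih.ball _ (last m) hB.skip), fun M v => ?_⟩
      beta_reduce; rw [hA2, hB2]; push Not; simp only [Fin.snoc_last, Fin.snoc_castSucc]
      constructor
      · rintro ⟨⟨x, hx⟩, y, hy⟩
        exact ⟨x + y, ⟨x, le_self_add, hx⟩, y, le_add_self, hy⟩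
      · rintro ⟨z, ⟨x, _, hx⟩, y, _, hy⟩; exact ⟨⟨x, hx⟩, y, hy⟩
    · rintro m P Q ⟨A, hA, hA2⟩ ⟨B, hB, hB2⟩
      refine ⟨_, ih.and hA hB, fun M v => ?_⟩
      beta_reduce; rw [hA2, hB2, ← exists_or]; simp only [not_and_or]
    · rintro m f hf P ⟨A, hA, hA2⟩
      refine ⟨_, ih.bex _ hf.lift (ih.ball _ (last' m) hA.skip2), fun M v => ?_⟩
      simp only [hA2]; push Not; simp only [Fin.snoc_last, Fin.snoc_castSucc]
      constructor
      · intro h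
        obtain ⟨z, hz⟩ := collection (fun x y => ¬ A M (Fin.snoc (Fin.snoc v x : Fin (m+1) → M) y)) (by
          apply DP.not (hf := ?_)
          refine hA.ud.dp (fun i w => (Fin.snoc (Fin.snoc v (w 0) : Fin (m+1) → M) (w 1) : Fin (m+1+1) → M) i) ?_
          intro i
          refine Fin.lastCases ?_ (fun j => ?_) i
          · simp only [Fin.snoc_last]; infer_instance
          · simp only [Fin.snoc_castSucc]
            refine Fin.lastCases ?_ (fun j => ?_) j
            · simp only [Fin.snoc_last]; infer_instance
            · simp only [Fin.snoc_castSucc]; infer_instance) (f M v)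
        exact ⟨z, fun x hx => hz x hx (h x hx)⟩
      · rintro ⟨z, hz⟩ x hx
        obtain ⟨y, _, h⟩ := hz x hx
        exact ⟨y, h⟩
    · rintro m f hf P ⟨A, hA, hA2⟩
      refine ⟨_, ih.ball _ hf.lift (ih.ball _ (last' m) hA.skip2), fun M v => ?_⟩
      simp only [hA2]; push Not; simp only [Fin.snoc_last, Fin.snoc_castSucc]
      constructor
      · rintro ⟨x, hx, y, hy⟩; exact ⟨y, x, hx, y, le_rfl, hy⟩
      · rintro ⟨z, x, hx, y, _, hy⟩; exact ⟨x, hx, y, hy⟩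

theorem SigF.ex {k m : ℕ} {P : Fam (m+1)} (h : SigF (k+1) P) : SigF (k+1) (fun M v => ∃ x, P M (Fin.snoc v x)) := by
  obtain ⟨A, hA, hA2⟩ := h
  have last : ∀ m : ℕ, UT (fun (M : PAM) (w : Fin (m+1) → M) => w (Fin.last m)) := fun m => inferInstance
  have last' : ∀ m : ℕ, UT (fun (M : PAM) (w : Fin (m+1+1) → M) => w (Fin.last m).castSucc) := fun m => inferInstance
  refine ⟨_, (clo k).ball _ (last m) ((clo k).ball _ (last' m) hA.skip2), fun M v => ?_⟩
  simp only [hA2]; push Not; simp only [Fin.snoc_last, Fin.snoc_castSucc]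
  constructor
  · rintro ⟨x, y, hy⟩; exact ⟨x + y, x, le_self_add, y, le_add_self, hy⟩
  · rintro ⟨z, x, hx, y, _, hy⟩; exact ⟨x, y, hy⟩

theorem SigF.dummy {k m : ℕ} {P : Fam m} (h : SigF k P) : SigF k (fun (M : PAM) (w : Fin (m+1) → M) => P M (fun i => w i.castSucc)) :=
  h.subst (fun i M w => w i.castSucc) (fun _ => inferInstance)

theorem SigF.neg_succ {k m : ℕ} {P : Fam m} (h : SigF k P) : SigF (k+1) (fun M v => ¬ P M v) :=
  ⟨_, h.dummy, fun M v => by simp⟩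
theorem SigF.succ {k : ℕ} : ∀ {m : ℕ} {P : Fam m}, SigF k P → SigF (k+1) P := by
  induction k with
  | zero => intro m P h; exact (SigF.neg_succ (k := 0) (D0.not h)).congr (fun M v => not_not)
  | succ k ih => rintro m P ⟨Q, hQ, h⟩; exact ⟨Q, ih hQ, h⟩
theorem SigF.of_d0 {k m : ℕ} {P : Fam m} (h : D0 P) : SigF k P := by
  induction k with
  | zero => exact h
  | succ k ih => exact ih.succ

theorem SigF.fml {k : ℕ} : ∀ {m : ℕ} {P : Fam m}, SigF k P →
    (∃ φ : LA.BoundedFormula Empty m, IsSigmaFml k φ ∧ ∀ M v, φ.Realize default v ↔ P M v) ∧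
    ∃ φ : LA.BoundedFormula Empty m, IsPiFml k φ ∧ ∀ M v, φ.Realize default v ↔ ¬ P M v := by
  induction k with
  | zero =>
    intro m P h
    obtain ⟨φ, h1, h2⟩ := id h
    obtain ⟨ψ, h3, h4⟩ := D0.not h
    exact ⟨⟨φ, .ofDelta0 h1, h2⟩, ψ, .ofDelta0 h3, h4⟩
  | succ k ih =>
    rintro m P ⟨Q, hQ, h⟩
    obtain ⟨⟨φ, h1, h2⟩, ψ, h3, h4⟩ := ih hQ
    exact ⟨⟨∃' ψ, .ex (.ofPi h3), fun M v => by simp [h, h4]⟩, ∀' φ, .all (.ofSigma h1), fun M v => by simp [h, h2]⟩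

end Part4

section Part5


class Sg (k : ℕ) {m : ℕ} (P : Fam m) : Prop where
  out : SigF k P
class Dl (k : ℕ) {m : ℕ} (P : Fam m) : Prop where
  pos : SigF k P
  neg : SigF k (fun M v => ¬ P M v)

section
variable {k m : ℕ}
theorem Dl.congr {P Q : Fam m} (h : Dl k P) (h' : ∀ M v, P M v ↔ Q M v) : Dl k Q :=
  ⟨h.pos.congr h', h.neg.congr (fun M v => not_congr (h' M v))⟩
theorem Sg.congr {P Q : Fam m} (h : Sg k P) (h' : ∀ M v, P M v ↔ Q M v) : Sg k Q := ⟨h.out.congr h'⟩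
theorem Dl.of_d0 {P : Fam m} (h : D0 P) : Dl k P := ⟨.of_d0 h, .of_d0 h.not⟩
theorem Dl.of_sg {P : Fam m} (h : Sg k P) : Dl (k+1) P := ⟨h.out.succ, h.out.neg_succ⟩
theorem Dl.succ {P : Fam m} (h : Dl k P) : Dl (k+1) P := ⟨h.pos.succ, h.pos.neg_succ⟩
theorem Sg.succ {P : Fam m} (h : Sg k P) : Sg (k+1) P := ⟨h.out.succ⟩
theorem Sg.mono {P : Fam m} (h : Sg k P) {l : ℕ} (hl : k ≤ l) : Sg l P := by
  induction hl with
  | refl => exact h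
  | step _ ih => exact ih.succ
theorem Dl.subst {n : ℕ} {P : Fam n} (h : Dl k P) (f : Fin n → ∀ M : PAM, (Fin m → M) → M) (hf : ∀ i, UT (f i)) :
    Dl k (fun M v => P M (fun i => f i M v)) := ⟨h.pos.subst f hf, h.neg.subst f hf⟩
theorem Sg.subst {n : ℕ} {P : Fam n} (h : Sg k P) (f : Fin n → ∀ M : PAM, (Fin m → M) → M) (hf : ∀ i, UT (f i)) :
    Sg k (fun M v => P M (fun i => f i M v)) := ⟨h.out.subst f hf⟩
theorem Sg.dp {n : ℕ} {P : Fam n} (h : Sg k P) {M : PAM} (f : Fin n → (Fin m → M) → M)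
    (hf : ∀ i, DT (f i)) : DP (fun v => P M (fun i => f i v)) := h.out.ud.dp f hf

instance (priority := 500) Sg.of_dl (P : Fam m) [h : Dl k P] : Sg k P := ⟨h.pos⟩
instance Dl.eq (f g : ∀ M : PAM, (Fin m → M) → M) [UT f] [UT g] : Dl k (fun M v => f M v = g M v) := .of_d0 (D0.eq f g)
instance Dl.le (f g : ∀ M : PAM, (Fin m → M) → M) [UT f] [UT g] : Dl k (fun M v => f M v ≤ g M v) := .of_d0 (D0.le f g)
instance Dl.lt (f g : ∀ M : PAM, (Fin m → M) → M) [UT f] [UT g] : Dl k (fun M v => f M v < g M v) :=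
  (Dl.le (fun M v => f M v + 1) g).congr (fun _ _ => (lt_iff _ _).symm)
instance Dl.not (P : Fam m) [h : Dl k P] : Dl k (fun M v => ¬ P M v) := ⟨h.neg, h.pos.congr (fun _ _ => not_not.symm)⟩
instance Dl.ne (f g : ∀ M : PAM, (Fin m → M) → M) [UT f] [UT g] : Dl k (fun M v => f M v ≠ g M v) :=
  Dl.not (fun M v => f M v = g M v)
instance Dl.and (P Q : Fam m) [h : Dl k P] [h' : Dl k Q] : Dl k (fun M v => P M v ∧ Q M v) :=
  ⟨(clo k).and h.pos h'.pos, ((clo k).or h.neg h'.neg).congr (fun _ _ => not_and_or.symm)⟩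
instance Dl.or (P Q : Fam m) [h : Dl k P] [h' : Dl k Q] : Dl k (fun M v => P M v ∨ Q M v) :=
  ⟨(clo k).or h.pos h'.pos, ((clo k).and h.neg h'.neg).congr (fun _ _ => not_or.symm)⟩
instance Dl.imp (P Q : Fam m) [h : Dl k P] [h' : Dl k Q] : Dl k (fun M v => P M v → Q M v) :=
  (Dl.or (fun M v => ¬ P M v) Q).congr (fun M v => by tauto)
instance Dl.iff (P Q : Fam m) [h : Dl k P] [h' : Dl k Q] : Dl k (fun M v => P M v ↔ Q M v) :=
  (Dl.and (fun M v => P M v → Q M v) (fun M v => Q M v → P M v)).congr (fun M v => by tauto)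
instance Dl.false : Dl k (fun (M : PAM) (_ : Fin m → M) => False) := 
  (Dl.eq (fun M _ => (0 : M)) (fun M _ => (1 : M))).congr (fun M v => by simp)
instance Dl.true : Dl k (fun (M : PAM) (_ : Fin m → M) => True) := 
  (Dl.eq (fun M _ => (0 : M)) (fun M _ => (0 : M))).congr (fun M v => by simp)

instance Sg.and (P Q : Fam m) [h : Sg k P] [h' : Sg k Q] : Sg k (fun M v => P M v ∧ Q M v) := ⟨(clo k).and h.out h'.out⟩
instance Sg.or (P Q : Fam m) [h : Sg k P] [h' : Sg k Q] : Sg k (fun M v => P M v ∨ Q M v) := ⟨(clo k).or h.out h'.out⟩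
instance Sg.imp (P Q : Fam m) [h : Dl k P] [h' : Sg k Q] : Sg k (fun M v => P M v → Q M v) :=
  (Sg.or (fun M v => ¬ P M v) Q).congr (fun M v => by tauto)

theorem snoc_cs {M : PAM} (w : Fin (m+1) → M) : (Fin.snoc (fun i => w i.castSucc) (w (Fin.last m)) : Fin (m+1) → M) = w := by
  funext i; refine Fin.lastCases ?_ (fun j => ?_) i <;> simp
theorem cs_snoc {M : PAM} (v : Fin m → M) (x : M) : (fun i : Fin m => (Fin.snoc v x : Fin (m+1) → M) i.castSucc) = v := by
  funext i; simp

instance Sg.ex (P : ∀ M : PAM, M → (Fin m → M) → Prop)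
    [h : Sg (k+1) (fun (M : PAM) (w : Fin (m+1) → M) => P M (w (Fin.last m)) (fun i => w i.castSucc))] :
    Sg (k+1) (fun M v => ∃ x, P M x v) := by
  refine ⟨(SigF.ex h.out).congr fun M v => ?_⟩
  simp only [Fin.snoc_last, Fin.snoc_castSucc]
instance Sg.bex (P : ∀ M : PAM, M → (Fin m → M) → Prop) (f : ∀ M : PAM, (Fin m → M) → M) [hf : UT f]
    [h : Sg k (fun (M : PAM) (w : Fin (m+1) → M) => P M (w (Fin.last m)) (fun i => w i.castSucc))] :
    Sg k (fun M v => ∃ x, x ≤ f M v ∧ P M x v) := by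
  refine ⟨((clo k).bex f hf h.out).congr fun M v => ?_⟩
  simp only [Fin.snoc_last, Fin.snoc_castSucc]
instance Sg.ball (P : ∀ M : PAM, M → (Fin m → M) → Prop) (f : ∀ M : PAM, (Fin m → M) → M) [hf : UT f]
    [h : Sg k (fun (M : PAM) (w : Fin (m+1) → M) => P M (w (Fin.last m)) (fun i => w i.castSucc))] :
    Sg k (fun M v => ∀ x, x ≤ f M v → P M x v) := by
  refine ⟨((clo k).ball f hf h.out).congr fun M v => ?_⟩
  simp only [Fin.snoc_last, Fin.snoc_castSucc]
instance Dl.bex (P : ∀ M : PAM, M → (Fin m → M) → Prop) (f : ∀ M : PAM, (Fin m → M) → M) [hf : UT f]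
    [h : Dl k (fun (M : PAM) (w : Fin (m+1) → M) => P M (w (Fin.last m)) (fun i => w i.castSucc))] :
    Dl k (fun M v => ∃ x, x ≤ f M v ∧ P M x v) := by
  refine ⟨((clo k).bex f hf h.pos).congr fun M v => ?_, ((clo k).ball f hf h.neg).congr fun M v => ?_⟩
  · simp only [Fin.snoc_last, Fin.snoc_castSucc]
  · simp only [Fin.snoc_last, Fin.snoc_castSucc]; push Not; rfl
instance Dl.ball (P : ∀ M : PAM, M → (Fin m → M) → Prop) (f : ∀ M : PAM, (Fin m → M) → M) [hf : UT f]
    [h : Dl k (fun (M : PAM) (w : Fin (m+1) → M) => P M (w (Fin.last m)) (fun i => w i.castSucc))] :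
    Dl k (fun M v => ∀ x, x ≤ f M v → P M x v) := by
  refine ⟨((clo k).ball f hf h.pos).congr fun M v => ?_, ((clo k).bex f hf h.neg).congr fun M v => ?_⟩
  · simp only [Fin.snoc_last, Fin.snoc_castSucc]
  · simp only [Fin.snoc_last, Fin.snoc_castSucc]; push Not; rfl

end

/-- pairing -/
def pp {M : PAM} (x y : M) : M := (x + y) * (x + y) + x

section
variable {M : PAM}
instance {m : ℕ} (f g : (Fin m → M) → M) [DT f] [DT g] : DT (fun v => pp (f v) (g v)) := by unfold pp; infer_instance
instance {m : ℕ} (f g : ∀ M : PAM, (Fin m → M) → M) [UT f] [UT g] : UT (fun M v => pp (f M v) (g M v)) := by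
  unfold pp; infer_instance

theorem le_sq (x : M) : x ≤ x * x := by
  rcases zero_or_sc x with rfl | ⟨y, rfl⟩
  · simp
  · exact (le_def _ _).2 ⟨y * y + y, by ring⟩
theorem le_pp_left (x y : M) : x ≤ pp x y := le_add_self
theorem le_pp_right (x y : M) : y ≤ pp x y := 
  (le_add_self.trans (le_sq (x+y))).trans le_self_add
theorem pp_mono {x y x' y' : M} (h : x ≤ x') (h' : y ≤ y') : pp x y ≤ pp x' y' := by
  unfold pp; gcongr
theorem pp_inj {x y x' y' : M} (h : pp x y = pp x' y') : x = x' ∧ y = y' := by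
  have key : ∀ x y x' y' : M, x + y < x' + y' → pp x y ≠ pp x' y' := by
    intro x y x' y' h
    rw [lt_iff] at h
    obtain ⟨z, hz⟩ := (le_def _ _).1 h
    unfold pp
    rw [hz]
    refine ne_of_lt ?_
    calc (x+y)*(x+y) + x < (x+y)*(x+y) + x + (x + y + y + 1) := by
          refine lt_of_lt_of_le (lt_add_one _) ?_
          rw [add_assoc _ x]
          rw [add_assoc _ x]; gcongr; exact le_add_self
      _ ≤ (x + y + 1 + z) * (x + y + 1 + z) + x' := (le_def _ _).2 ⟨2 * (x+y+1) * z + z * z + x', by ring⟩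
  have hs : x + y = x' + y' := by
    rcases lt_trichotomy (x+y) (x'+y') with h1 | h1 | h1
    · exact absurd h (key _ _ _ _ h1)
    · exact h1
    · exact absurd h.symm (key _ _ _ _ h1)
  unfold pp at h
  rw [hs] at h
  have hx := add_left_cancel h
  subst hx
  exact ⟨rfl, add_left_cancel hs⟩
@[simp] theorem pp_iff {x y x' y' : M} : pp x y = pp x' y' ↔ x = x' ∧ y = y' :=
  ⟨pp_inj, fun ⟨h, h'⟩ => by rw [h, h']⟩
theorem pp_lt_right {x : M} (y : M) (h : 0 < x) : y < pp x y := by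
  unfold pp
  calc y < y + x := lt_add_of_pos_right _ h
    _ = x + y := add_comm _ _
    _ ≤ _ := (le_sq _).trans le_self_add
end

/-! ### absoluteness -/
theorem term_abs {m : ℕ} (t : LA.Term (Empty ⊕ Fin m)) (v : Fin m → ℕ) :
    ∃ n : ℕ, ∀ M : PAM, t.realize (Sum.elim default (fun i => (v i : M))) = n := by
  induction t with
  | var i => rcases i with i | i
             · exact i.elim
             · exact ⟨v i, fun M => rfl⟩
  | @func l f ts ih =>
    choose n hn using ih
    match l, f, ts, n, hn with
    | 0, f, ts, n, hn =>
      refine ⟨0, fun M => ?_⟩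
      rw [Nat.cast_zero, Term.realize_func]
      show _ = Structure.funMap _ _
      congr 1; funext i; exact i.elim0
    | 1, f, ts, n, hn =>
      refine ⟨n 0 + 1, fun M => ?_⟩
      rw [Nat.cast_succ, ← hn 0 M, ← sc_eq, Term.realize_func]
      show _ = Structure.funMap _ _
      congr 1; funext i; fin_cases i; rfl
    | 2, false, ts, n, hn =>
      refine ⟨n 0 + n 1, fun M => ?_⟩
      rw [Nat.cast_add, ← hn 0 M, ← hn 1 M]
      show Structure.funMap _ _ = Structure.funMap _ _
      congr 1; funext i; fin_cases i <;> rfl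
    | 2, true, ts, n, hn =>
      refine ⟨n 0 * n 1, fun M => ?_⟩
      rw [Nat.cast_mul, ← hn 0 M, ← hn 1 M]
      show Structure.funMap _ _ = Structure.funMap _ _
      congr 1; funext i; fin_cases i <;> rfl

theorem snoc_cast {m : ℕ} (M : PAM) (v : Fin m → ℕ) (k : ℕ) :
    (Fin.snoc (fun i => (v i : M)) (k : M) : Fin (m+1) → M) = fun i => (((Fin.snoc v k : Fin (m+1) → ℕ) i : ℕ) : M) := by
  funext i; refine Fin.lastCases ?_ (fun j => ?_) i <;> simp

theorem delta0_abs {m : ℕ} {φ : LA.BoundedFormula Empty m} (h : IsDelta0 φ) :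
    ∀ v : Fin m → ℕ, ∃ p : Prop, ∀ M : PAM, φ.Realize default (fun i => (v i : M)) ↔ p := by
  induction h with
  | falsum => intro v; exact ⟨False, fun M => Iff.rfl⟩
  | equal t u =>
    intro v; obtain ⟨a, ha⟩ := term_abs t v; obtain ⟨b, hb⟩ := term_abs u v
    exact ⟨a = b, fun M => by rw [BoundedFormula.realize_bdEqual, ha, hb, Nat.cast_inj]⟩
  | le t u =>
    intro v; obtain ⟨a, ha⟩ := term_abs t v; obtain ⟨b, hb⟩ := term_abs u v
    exact ⟨a ≤ b, fun M => by rw [rz_leF, ha, hb, Nat.cast_le]⟩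
  | imp h1 h2 ih1 ih2 =>
    intro v; obtain ⟨p, hp⟩ := ih1 v; obtain ⟨q, hq⟩ := ih2 v
    exact ⟨p → q, fun M => by rw [BoundedFormula.realize_imp, hp, hq]⟩
  | @ball m u ψ h ih =>
    intro v
    choose p hp using fun k => ih (Fin.snoc v k)
    obtain ⟨a, ha⟩ := term_abs u v
    refine ⟨∀ k ≤ a, p k, fun M => ?_⟩
    simp only [BoundedFormula.realize_all, BoundedFormula.realize_imp, rz_leF, snoc_rl, ha, rz_vT, Fin.snoc_last]
    constructor
    · intro h k hk; rw [← hp k M, ← snoc_cast]; exact h k (by exact_mod_cast hk)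
    · intro h x hx
      obtain ⟨k, hk, rfl⟩ := le_nat a x hx
      rw [snoc_cast, hp]; exact h k hk
  | @bex m u ψ h ih =>
    intro v
    choose p hp using fun k => ih (Fin.snoc v k)
    obtain ⟨a, ha⟩ := term_abs u v
    refine ⟨∃ k ≤ a, p k, fun M => ?_⟩
    simp only [BoundedFormula.realize_ex, BoundedFormula.realize_inf, rz_leF, snoc_rl, ha, rz_vT, Fin.snoc_last]
    constructor
    · rintro ⟨x, hx, h⟩
      obtain ⟨k, hk, rfl⟩ := le_nat a x hx
      exact ⟨k, hk, by rwa [snoc_cast, hp] at h⟩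
    · rintro ⟨k, hk, h⟩; exact ⟨k, by exact_mod_cast hk, by rwa [snoc_cast, hp]⟩

theorem Dl.abs {m : ℕ} {P : Fam m} (h : Dl 0 P) (M : PAM) (v : Fin m → ℕ) :
    P M (fun i => (v i : M)) ↔ P NN (fun i => (v i : NN)) := by
  obtain ⟨φ, h1, h2⟩ := h.pos
  obtain ⟨p, hp⟩ := delta0_abs h1 v
  rw [← h2, ← h2, hp, hp]

end Part5

section Part6


/-- membership in coded finite sets -/
def Mem {M : PAM} (i W : M) : Prop :=
  ∃ c ≤ W, ∃ d ≤ W, ∃ b ≤ W, W = pp (pp c d) b ∧ i ≤ b ∧ ∃ q ≤ c, c = q * (1 + (i + 1) * d)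

section
variable {M : PAM}
instance {m : ℕ} (f g : (Fin m → M) → M) [DT f] [DT g] : DP (fun v => Mem (f v) (g v)) := by
  unfold Mem
  exact DP.subst (P := fun u : Fin 2 → M => ∃ c ≤ u 1, ∃ d ≤ u 1, ∃ b ≤ u 1, u 1 = pp (pp c d) b ∧ u 0 ≤ b ∧ ∃ q ≤ c, c = q * (1 + (u 0 + 1) * d))
    inferInstance ![f, g] (by intro i; fin_cases i <;> (dsimp; infer_instance))
instance {k m : ℕ} (f g : ∀ M : PAM, (Fin m → M) → M) [UT f] [UT g] : Dl k (fun M v => Mem (f M v) (g M v)) := by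
  unfold Mem
  exact Dl.subst (P := fun M (u : Fin 2 → M) => ∃ c ≤ u 1, ∃ d ≤ u 1, ∃ b ≤ u 1, u 1 = pp (pp c d) b ∧ u 0 ≤ b ∧ ∃ q ≤ c, c = q * (1 + (u 0 + 1) * d))
    inferInstance ![f, g] (by intro i; fin_cases i <;> (dsimp; infer_instance))

theorem Mem.le {i W : M} (h : Mem i W) : i ≤ W := by
  obtain ⟨c, hc, d, hd, b, hb, h1, h2, _⟩ := h; exact h2.trans hb

theorem dvd_of_add {x y z : M} (h : x ∣ y + z) (h' : x ∣ y) : x ∣ z := by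
  obtain ⟨a, ha⟩ := h
  obtain ⟨b, rfl⟩ := h'
  rcases le_total b a with hba | hba
  · obtain ⟨c, rfl⟩ := (le_def _ _).1 hba
    rw [mul_add] at ha
    exact ⟨c, add_left_cancel ha⟩
  · obtain ⟨c, rfl⟩ := (le_def _ _).1 hba
    have : x * c + z = 0 := by
      have : x * a + (x * c + z) = x * a + 0 := by rw [add_zero, ← add_assoc, ← mul_add]; exact ha
      exact add_left_cancel this
    rw [(add_eq_zero.1 this).2]; exact dvd_zero _

theorem cop_aux {d i e z : M} (he : e ∣ d) (h : (1 + (i + 1) * d) ∣ e * d * z) : (1 + (i + 1) * d) ∣ z := by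
  obtain ⟨q, hq⟩ := he
  have h1 : (1 + (i + 1) * d) ∣ ((i + 1) * d) * ((i + 1) * d) * z := by
    have : ((i + 1) * d) * ((i + 1) * d) * z = (e * d * z) * ((i+1)*(i+1)*q) := by
      conv_lhs => rw [hq]
      conv_rhs => rw [hq]
      ring
    rw [this]; exact h.mul_right _
  have h2 : (1 + (i + 1) * d) ∣ ((i + 1) * d) * z := by
    refine dvd_of_add (y := ((i + 1) * d) * ((i + 1) * d) * z) ?_ h1
    exact ⟨(i+1)*d*z, by ring⟩
  refine dvd_of_add (y := ((i + 1) * d) * z) ?_ h2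
  exact ⟨z, by ring⟩

theorem cop {b d i j z : M} (hd : ∀ e, e ≤ b → e + 1 ∣ d) (hi : i ≤ b) (hj : j ≤ b) (hij : i ≠ j)
    (h : (1 + (i + 1) * d) ∣ (1 + (j + 1) * d) * z) : (1 + (i + 1) * d) ∣ z := by
  rcases lt_or_gt_of_ne hij with hl | hl
  · obtain ⟨e, rfl⟩ := (le_def _ _).1 ((lt_iff _ _).1 hl)
    have he : e ≤ b := le_trans le_add_self hj
    refine cop_aux (hd e he) ?_
    refine dvd_of_add (y := (1 + (i + 1) * d) * z) ?_ (Dvd.intro _ rfl)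
    convert h using 1; ring
  · obtain ⟨e, rfl⟩ := (le_def _ _).1 ((lt_iff _ _).1 hl)
    have he : e ≤ b := le_trans le_add_self hi
    refine cop_aux (hd e he) ?_
    refine dvd_of_add (y := (1 + (j + 1) * d) * z) ?_ h
    exact ⟨z, by ring⟩

theorem ex_mult (b : M) : ∃ d : M, 1 ≤ d ∧ ∀ e, e ≤ b → ∃ q, d = (e + 1) * q := by
  refine ind (fun b : M => ∃ d : M, 1 ≤ d ∧ ∀ e, e ≤ b → ∃ q, d = (e + 1) * q) ?_ ?_ b
  · exact ⟨1, le_rfl, fun e he => ⟨1, by simp at he; rw [he]; simp⟩⟩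
  · rintro b ⟨d, h1, h2⟩
    refine ⟨d * (b + 1 + 1), ?_, fun e he => ?_⟩
    · calc (1 : M) = 1 * 1 := by ring
        _ ≤ _ := by gcongr; exact le_add_self
    · rcases (le_succ _ _).1 he with he | rfl
      · obtain ⟨q, rfl⟩ := h2 e he; exact ⟨q * (b+1+1), by ring⟩
      · exact ⟨d, by ring⟩

/-- comprehension -/
theorem comp (D : M → Prop) [hD : DP (fun v : Fin 1 → M => D (v 0))] (b : M) :
    ∃ W, ∀ i, Mem i W ↔ i ≤ b ∧ D i := by
  obtain ⟨d, hd1, hd⟩ := ex_mult b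
  have : ∀ (m : ℕ) (f : (Fin m → M) → M) [DT f], DP (fun v => D (f v)) := fun m f hf =>
    DP.subst (P := fun u : Fin 1 → M => D (u 0)) hD (fun _ => f) (fun _ => hf)
  have key : ∀ k : M, ∃ c : M, ∀ i, i ≤ b → ((∃ q, c = q * (1 + (i + 1) * d)) ↔ i < k ∧ D i) := by
    intro k
    refine ind (fun k : M => ∃ c : M, ∀ i, i ≤ b → ((∃ q, c = q * (1 + (i + 1) * d)) ↔ i < k ∧ D i)) ?_ ?_ k
    · refine ⟨1, fun i _ => ⟨?_, fun h => absurd h.1 not_lt_zero⟩⟩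
      rintro ⟨q, hq⟩
      exfalso
      have hq0 : 1 ≤ q := by
        rcases zero_or_sc q with rfl | ⟨y, rfl⟩
        · simp at hq
        · exact le_add_self
      have : (1 : M) < 1 := by
        calc (1 : M) < 1 + 1 := lt_add_one _
          _ = 1 * (1 + 1 * 1) := by ring
          _ ≤ q * (1 + (i+1) * d) := by gcongr; exact le_add_self
          _ = 1 := hq.symm
      exact lt_irrefl _ this
    · rintro k ⟨c, hc⟩
      by_cases hk : k ≤ b ∧ D k
      · refine ⟨c * (1 + (k+1) * d), fun i hi => ?_⟩
        rw [lt_succ]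
        by_cases hik : i = k
        · subst hik; exact ⟨fun _ => ⟨le_rfl, hk.2⟩, fun _ => ⟨c, rfl⟩⟩
        · have h1 := hc i hi
          have h2 : (∃ q, c * (1 + (k+1) * d) = q * (1 + (i + 1) * d)) ↔ ∃ q, c = q * (1 + (i + 1) * d) := by
            constructor
            · rintro ⟨q, hq⟩
              obtain ⟨r, hr⟩ := cop (z := c) (fun e he => hd e he) hi hk.1 hik ⟨q, by rw [mul_comm, hq, mul_comm]⟩
              exact ⟨r, by rw [hr, mul_comm]⟩
            · rintro ⟨q, hq⟩; exact ⟨q * (1 + (k+1) * d), by rw [hq]; ring⟩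
          rw [h2, h1, le_iff_lt_or_eq]; simp [hik]
      · refine ⟨c, fun i hi => ?_⟩
        rw [hc i hi, lt_succ]
        constructor
        · rintro ⟨h, h'⟩; exact ⟨h.le, h'⟩
        · rintro ⟨h, h'⟩
          refine ⟨lt_of_le_of_ne h ?_, h'⟩
          rintro rfl; exact hk ⟨hi, h'⟩
  obtain ⟨c, hc⟩ := key (b+1)
  refine ⟨pp (pp c d) b, fun i => ⟨?_, ?_⟩⟩
  · rintro ⟨c', _, d', _, b', _, h, hi, q, _, hq⟩
    simp only [pp_iff] at h
    obtain ⟨⟨rfl, rfl⟩, rfl⟩ := h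
    exact ⟨hi, ((hc i hi).1 ⟨q, hq⟩).2⟩
  · rintro ⟨hi, h⟩
    obtain ⟨q, hq⟩ := (hc i hi).2 ⟨(lt_succ _ _).2 hi, h⟩
    refine ⟨c, (le_pp_left c d).trans (le_pp_left _ _), d, (le_pp_right c d).trans (le_pp_left _ _), b, le_pp_right _ _, rfl, hi, q, ?_, hq⟩
    calc q = q * 1 := by ring
      _ ≤ q * (1 + (i+1)*d) := by gcongr; exact le_self_add
      _ = c := hq.symm
end

end Part6

section Part7


section
variable {M : PAM}

def Basic (O : M → Prop) (e s v : M) : Prop :=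
  (e = pp 0 1 ∧ v = s) ∨ (e = pp 0 2 ∧ v = 0) ∨ (e = pp 0 3 ∧ v = s + 1) ∨
  (e = pp 0 4 ∧ ∃ y ≤ s, s = pp v y) ∨ (e = pp 0 5 ∧ ∃ y ≤ s, s = pp y v) ∨
  (e = pp 0 6 ∧ ∃ x ≤ s, ∃ y ≤ s, s = pp x y ∧ v = x + y) ∨
  (e = pp 0 7 ∧ ∃ x ≤ s, ∃ y ≤ s, s = pp x y ∧ v = x * y) ∨
  (e = pp 0 8 ∧ ∃ x ≤ s, ∃ y ≤ s, s = pp x y ∧ (x = y ∧ v = 1 ∨ x ≠ y ∧ v = 0)) ∨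
  (e = pp 0 9 ∧ ∃ x ≤ s, ∃ y ≤ s, s = pp x y ∧ (x ≤ y ∧ v = 1 ∨ ¬ x ≤ y ∧ v = 0)) ∨
  (e = pp 0 10 ∧ ∃ x ≤ s, ∃ y ≤ s, s = pp x y ∧ ((x = 1 → y = 1) ∧ v = 1 ∨ ¬ (x = 1 → y = 1) ∧ v = 0)) ∨
  (e = pp 0 11 ∧ (O s ∧ v = 1 ∨ ¬ O s ∧ v = 0)) ∨
  e = pp 1 v

def JPair (S : M → Prop) (e s v : M) : Prop :=
  ∃ e1 ≤ e, ∃ e2 ≤ e, ∃ v1 ≤ v, ∃ v2 ≤ v, e = pp 2 (pp e1 e2) ∧ v = pp v1 v2 ∧ S (pp e1 (pp s v1)) ∧ S (pp e2 (pp s v2))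
def JComp (S : M → Prop) (W e s v : M) : Prop :=
  ∃ e1 ≤ e, ∃ e2 ≤ e, ∃ u ≤ W, e = pp 3 (pp e1 e2) ∧ S (pp e2 (pp s u)) ∧ S (pp e1 (pp u v))
def JBall (S : M → Prop) (e s v : M) : Prop :=
  ∃ e1 ≤ e, ∃ t ≤ s, ∃ r ≤ s, e = pp 4 e1 ∧ s = pp t r ∧
    ((v = 1 ∧ ∀ x ≤ t, S (pp e1 (pp (pp x r) 1))) ∨ (v = 0 ∧ ∃ x ≤ t, S (pp e1 (pp (pp x r) 0))))

def Just (O : M → Prop) (W e s v : M) : Prop :=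
  Basic O e s v ∨ JPair (fun x => Mem x W) e s v ∨ JComp (fun x => Mem x W) W e s v ∨ JBall (fun x => Mem x W) e s v

def Good (O : M → Prop) (W : M) : Prop :=
  ∀ e ≤ W, ∀ s ≤ W, ∀ v ≤ W, Mem (pp e (pp s v)) W → Just O W e s v

theorem DP.ap1 {m : ℕ} {P : M → Prop} (hP : DP (fun u : Fin 1 → M => P (u 0))) (f : (Fin m → M) → M) (hf : DT f) :
    DP (fun v => P (f v)) := DP.subst (P := fun u : Fin 1 → M => P (u 0)) hP (fun _ => f) (fun _ => hf)

set_option synthInstance.maxSize 2000 in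
set_option synthInstance.maxHeartbeats 400000 in
set_option maxHeartbeats 1000000 in
instance good_dp (O : M → Prop) [hO : DP (fun u : Fin 1 → M => O (u 0))] {m : ℕ} (g : (Fin m → M) → M) [hg : DT g] :
    DP (fun v => Good O (g v)) := by
  refine DP.ap1 ?_ g hg
  have : ∀ (m : ℕ) (f : (Fin m → M) → M) [DT f], DP (fun v => O (f v)) := fun m f hf => DP.ap1 hO f hf
  unfold Good Just Basic JPair JComp JBall; beta_reduce
  infer_instance
end

theorem Dl.ap1 {k m : ℕ} {P : ∀ M : PAM, M → Prop} (hP : Dl k (fun (M : PAM) (u : Fin 1 → M) => P M (u 0)))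
    (f : ∀ M : PAM, (Fin m → M) → M) (hf : UT f) :
    Dl k (fun M v => P M (f M v)) := Dl.subst (P := fun M (u : Fin 1 → M) => P M (u 0)) hP (fun _ => f) (fun _ => hf)
theorem Sg.ap1 {k m : ℕ} {P : ∀ M : PAM, M → Prop} (hP : Sg k (fun (M : PAM) (u : Fin 1 → M) => P M (u 0)))
    (f : ∀ M : PAM, (Fin m → M) → M) (hf : UT f) :
    Sg k (fun M v => P M (f M v)) := Sg.subst (P := fun M (u : Fin 1 → M) => P M (u 0)) hP (fun _ => f) (fun _ => hf)

set_option synthInstance.maxSize 2000 in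
set_option synthInstance.maxHeartbeats 400000 in
set_option maxHeartbeats 1000000 in
theorem good_dl {k : ℕ} (O : ∀ M : PAM, M → Prop) (hO : Dl k (fun (M : PAM) (u : Fin 1 → M) => O M (u 0)))
    {m : ℕ} (g : ∀ M : PAM, (Fin m → M) → M) [hg : UT g] :
    Dl k (fun M v => Good (O M) (g M v)) := by
  refine Dl.ap1 (P := fun M x => Good (O M) x) ?_ g hg
  have : ∀ (m : ℕ) (f : ∀ M : PAM, (Fin m → M) → M) [UT f], Dl k (fun M v => O M (f M v)) := fun m f hf => Dl.ap1 hO f hf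
  unfold Good Just Basic JPair JComp JBall; beta_reduce
  infer_instance

end Part7

section Part8


section
variable {M : PAM}

def Ev (O : M → Prop) (e s v : M) : Prop := ∃ W, Good O W ∧ Mem (pp e (pp s v)) W

instance ev_dp (O : M → Prop) [hO : DP (fun u : Fin 1 → M => O (u 0))] {m : ℕ} (f g h : (Fin m → M) → M) [DT f] [DT g] [DT h] :
    DP (fun v => Ev O (f v) (g v) (h v)) := by
  refine DP.subst (P := fun u : Fin 3 → M => Ev O (u 0) (u 1) (u 2)) ?_ ![f, g, h] (by intro i; fin_cases i <;> (dsimp; infer_instance))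
  unfold Ev; infer_instance

/-- unbounded form of the justification clauses -/
def Jst (O : M → Prop) (S : M → M → M → Prop) (e s v : M) : Prop :=
  Basic O e s v ∨
  (∃ e1 e2 v1 v2, e = pp 2 (pp e1 e2) ∧ v = pp v1 v2 ∧ S e1 s v1 ∧ S e2 s v2) ∨
  (∃ e1 e2 u, e = pp 3 (pp e1 e2) ∧ S e2 s u ∧ S e1 u v) ∨
  (∃ e1 t r, e = pp 4 e1 ∧ s = pp t r ∧
    ((v = 1 ∧ ∀ x ≤ t, S e1 (pp x r) 1) ∨ (v = 0 ∧ ∃ x ≤ t, S e1 (pp x r) 0)))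

theorem le_in2 (a b c : M) : b ≤ pp a (pp b c) := (le_pp_left _ _).trans (le_pp_right _ _)
theorem le_in3 (a b c : M) : c ≤ pp a (pp b c) := (le_pp_right _ _).trans (le_pp_right _ _)

theorem just_iff (O : M → Prop) (W e s v : M) :
    Just O W e s v ↔ Jst O (fun e s v => Mem (pp e (pp s v)) W) e s v := by
  unfold Just Jst JPair JComp JBall
  refine or_congr Iff.rfl (or_congr ?_ (or_congr ?_ ?_))
  · constructor
    · rintro ⟨e1, _, e2, _, v1, _, v2, _, h⟩; exact ⟨e1, e2, v1, v2, h⟩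
    · rintro ⟨e1, e2, v1, v2, h1, h2, h⟩
      refine ⟨e1, h1 ▸ le_in2 _ _ _, e2, h1 ▸ le_in3 _ _ _, v1, h2 ▸ le_pp_left _ _, v2, h2 ▸ le_pp_right _ _, h1, h2, h⟩
  · constructor
    · rintro ⟨e1, _, e2, _, u, _, h⟩; exact ⟨e1, e2, u, h⟩
    · rintro ⟨e1, e2, u, h1, h2, h⟩
      refine ⟨e1, h1 ▸ le_in2 _ _ _, e2, h1 ▸ le_in3 _ _ _, u, (le_in3 _ _ _).trans h2.le, h1, h2, h⟩
  · constructor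
    · rintro ⟨e1, _, t, _, r, _, h⟩; exact ⟨e1, t, r, h⟩
    · rintro ⟨e1, t, r, h1, h2, h⟩
      exact ⟨e1, h1 ▸ le_pp_right _ _, t, h2 ▸ le_pp_left _ _, r, h2 ▸ le_pp_right _ _, h1, h2, h⟩

theorem good_iff (O : M → Prop) (W : M) :
    Good O W ↔ ∀ e s v, Mem (pp e (pp s v)) W → Jst O (fun e s v => Mem (pp e (pp s v)) W) e s v := by
  constructor
  · intro h e s v hm
    exact (just_iff _ _ _ _ _).1 (h e ((le_pp_left _ _).trans hm.le) s ((le_in2 _ _ _).trans hm.le) v ((le_in3 _ _ _).trans hm.le) hm)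
  · intro h e _ s _ v _ hm; exact (just_iff _ _ _ _ _).2 (h e s v hm)

theorem Jst.mono {O : M → Prop} {S S' : M → M → M → Prop} (hS : ∀ e s v, S e s v → S' e s v) {e s v : M}
    (h : Jst O S e s v) : Jst O S' e s v := by
  rcases h with h | ⟨e1, e2, v1, v2, h1, h2, h3, h4⟩ | ⟨e1, e2, u, h1, h2, h3⟩ | ⟨e1, t, r, h1, h2, h⟩
  · exact .inl h
  · exact .inr (.inl ⟨e1, e2, v1, v2, h1, h2, hS _ _ _ h3, hS _ _ _ h4⟩)
  · exact .inr (.inr (.inl ⟨e1, e2, u, h1, hS _ _ _ h2, hS _ _ _ h3⟩))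
  · refine .inr (.inr (.inr ⟨e1, t, r, h1, h2, ?_⟩))
    rcases h with ⟨hv, h⟩ | ⟨hv, x, hx, h⟩
    · exact .inl ⟨hv, fun x hx => hS _ _ _ (h x hx)⟩
    · exact .inr ⟨hv, x, hx, hS _ _ _ h⟩

variable (O : M → Prop)

theorem Ev.jst {O : M → Prop} {e s v : M} (h : Ev O e s v) : Jst O (Ev O) e s v := by
  obtain ⟨W, h1, h2⟩ := h
  exact ((good_iff _ _).1 h1 _ _ _ h2).mono (fun e s v h => ⟨W, h1, h⟩)

variable [hO : DP (fun u : Fin 1 → M => O (u 0))]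

theorem ev_of (B : M) {e s v : M} (h : Jst O (fun e s v => ∃ W ≤ B, Good O W ∧ Mem (pp e (pp s v)) W) e s v) : Ev O e s v := by
  obtain ⟨W, hW⟩ := comp (fun i : M => i = pp e (pp s v) ∨ ∃ W ≤ B, Good O W ∧ Mem i W) (B + pp e (pp s v))
  have hs : ∀ e s v, (∃ W ≤ B, Good O W ∧ Mem (pp e (pp s v)) W) → Mem (pp e (pp s v)) W := by
    rintro e s v ⟨W', h1, h2, h3⟩
    exact (hW _).2 ⟨(h3.le.trans h1).trans le_self_add, .inr ⟨W', h1, h2, h3⟩⟩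
  refine ⟨W, (good_iff _ _).2 fun e' s' v' hm => ?_, (hW _).2 ⟨le_add_self, .inl rfl⟩⟩
  rcases ((hW _).1 hm).2 with h' | ⟨W', h1, h2, h3⟩
  · simp only [pp_iff] at h'
    obtain ⟨rfl, rfl, rfl⟩ := h'
    exact h.mono hs
  · exact ((good_iff _ _).1 h2 _ _ _ h3).mono (fun e s v h => hs _ _ _ ⟨W', h1, h2, h⟩)

theorem ev_iff {e s v : M} : Ev O e s v ↔ Jst O (Ev O) e s v := by
  refine ⟨Ev.jst, fun h => ?_⟩
  rcases h with h | ⟨e1, e2, v1, v2, h1, h2, ⟨W1, h3⟩, ⟨W2, h4⟩⟩ | ⟨e1, e2, u, h1, ⟨W1, h3⟩, ⟨W2, h4⟩⟩ | ⟨e1, t, r, h1, h2, h⟩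
  · exact ev_of O 0 (.inl h)
  · exact ev_of O (W1 + W2) (.inr (.inl ⟨e1, e2, v1, v2, h1, h2, ⟨W1, le_self_add, h3⟩, ⟨W2, le_add_self, h4⟩⟩))
  · exact ev_of O (W1 + W2) (.inr (.inr (.inl ⟨e1, e2, u, h1, ⟨W1, le_self_add, h3⟩, ⟨W2, le_add_self, h4⟩⟩)))
  · rcases h with ⟨hv, h⟩ | ⟨hv, x, hx, ⟨W, h⟩⟩
    · obtain ⟨B, hB⟩ := collection (fun x W => Good O W ∧ Mem (pp e1 (pp (pp x r) 1)) W) inferInstance t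
      refine ev_of O B (.inr (.inr (.inr ⟨e1, t, r, h1, h2, .inl ⟨hv, fun x hx => hB x hx (h x hx)⟩⟩)))
    · exact ev_of O W (.inr (.inr (.inr ⟨e1, t, r, h1, h2, .inr ⟨hv, x, hx, W, le_rfl, h⟩⟩)))

theorem ev_pair {a b s v : M} : Ev O (pp 2 (pp a b)) s v ↔ ∃ x y, v = pp x y ∧ Ev O a s x ∧ Ev O b s y := by
  rw [ev_iff]; unfold Jst Basic; simp
theorem ev_comp {a b s v : M} : Ev O (pp 3 (pp a b)) s v ↔ ∃ u, Ev O b s u ∧ Ev O a u v := by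
  rw [ev_iff]; unfold Jst Basic; simp
theorem ev_ball {a s v : M} : Ev O (pp 4 a) s v ↔ ∃ t r, s = pp t r ∧
    ((v = 1 ∧ ∀ x ≤ t, Ev O a (pp x r) 1) ∨ (v = 0 ∧ ∃ x ≤ t, Ev O a (pp x r) 0)) := by
  rw [ev_iff]; unfold Jst Basic; simp
theorem ev_const {a s v : M} : Ev O (pp 1 a) s v ↔ v = a := by
  rw [ev_iff]; unfold Jst Basic; simp [eq_comm]
theorem ev_id {s v : M} : Ev O (pp 0 1) s v ↔ v = s := by
  rw [ev_iff]; unfold Jst Basic; simp 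
theorem ev_zero {s v : M} : Ev O (pp 0 2) s v ↔ v = 0 := by
  rw [ev_iff]; unfold Jst Basic; simp 
theorem ev_succ {s v : M} : Ev O (pp 0 3) s v ↔ v = s + 1 := by
  rw [ev_iff]; unfold Jst Basic; simp 
theorem ev_fst {s v : M} : Ev O (pp 0 4) s v ↔ ∃ y, s = pp v y := by
  rw [ev_iff]; unfold Jst Basic; simp 
  exact ⟨fun ⟨y, _, h⟩ => ⟨y, h⟩, fun ⟨y, h⟩ => ⟨y, h ▸ le_pp_right _ _, h⟩⟩
theorem ev_snd {s v : M} : Ev O (pp 0 5) s v ↔ ∃ y, s = pp y v := by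
  rw [ev_iff]; unfold Jst Basic; simp 
  exact ⟨fun ⟨y, _, h⟩ => ⟨y, h⟩, fun ⟨y, h⟩ => ⟨y, h ▸ le_pp_left _ _, h⟩⟩
theorem bex2 {s : M} {R : M → M → Prop} : (∃ x ≤ s, ∃ y ≤ s, s = pp x y ∧ R x y) ↔ ∃ x y, s = pp x y ∧ R x y :=
  ⟨fun ⟨x, _, y, _, h⟩ => ⟨x, y, h⟩, fun ⟨x, y, h, h'⟩ => ⟨x, h ▸ le_pp_left _ _, y, h ▸ le_pp_right _ _, h, h'⟩⟩
theorem ev_add {x y v : M} : Ev O (pp 0 6) (pp x y) v ↔ v = x + y := by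
  rw [ev_iff]; unfold Jst Basic; simp only [bex2]; simp
theorem ev_mul {x y v : M} : Ev O (pp 0 7) (pp x y) v ↔ v = x * y := by
  rw [ev_iff]; unfold Jst Basic; simp only [bex2]; simp
open Classical in
theorem ev_eq {x y v : M} : Ev O (pp 0 8) (pp x y) v ↔ v = if x = y then 1 else 0 := by
  rw [ev_iff]; unfold Jst Basic; simp only [bex2]; split_ifs <;> simp [*]
open Classical in
theorem ev_le {x y v : M} : Ev O (pp 0 9) (pp x y) v ↔ v = if x ≤ y then 1 else 0 := by
  rw [ev_iff]; unfold Jst Basic; simp only [bex2]; split_ifs with h <;> simp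
  · simp [h, not_lt.2 h]
  · simp [h, not_le.1 h]
open Classical in
theorem ev_imp {x y v : M} : Ev O (pp 0 10) (pp x y) v ↔ v = if (x = 1 → y = 1) then 1 else 0 := by
  rw [ev_iff]; unfold Jst Basic; simp only [bex2]; split_ifs with h <;> simp
  · tauto
  · tauto
open Classical in
theorem ev_orc {s v : M} : Ev O (pp 0 11) s v ↔ v = if O s then 1 else 0 := by
  rw [ev_iff]; unfold Jst Basic; split_ifs with h <;> simp [h]

theorem ev_uniq (e : M) : ∀ s v v', Ev O e s v → Ev O e s v' → v = v' := by
  refine sind (fun e : M => ∀ s v v', Ev O e s v → Ev O e s v' → v = v') (fun e ih s v v' hh h' => ?_) e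
  rcases hh.jst with h | ⟨e1, e2, v1, v2, rfl, rfl, h1, h2⟩ | ⟨e1, e2, u, rfl, h1, h2⟩ | ⟨e1, t, r, rfl, rfl, h⟩
  · rcases h with ⟨rfl, rfl⟩ | ⟨rfl, rfl⟩ | ⟨rfl, rfl⟩ | ⟨rfl, h⟩ | ⟨rfl, h⟩ | ⟨rfl, h⟩ | ⟨rfl, h⟩ | ⟨rfl, h⟩ | ⟨rfl, h⟩ | ⟨rfl, h⟩ | ⟨rfl, h⟩ | rfl
    · rw [ev_id] at h'; exact h'.symm
    · rw [ev_zero] at h'; exact h'.symm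
    · rw [ev_succ] at h'; exact h'.symm
    · obtain ⟨y, _, rfl⟩ := h; rw [ev_fst] at h'; obtain ⟨y', h'⟩ := h'; exact (pp_inj h').1
    · obtain ⟨y, _, rfl⟩ := h; rw [ev_snd] at h'; obtain ⟨y', h'⟩ := h'; exact (pp_inj h').2
    · obtain ⟨x, _, y, _, rfl, rfl⟩ := h; rw [ev_add] at h'; exact h'.symm
    · obtain ⟨x, _, y, _, rfl, rfl⟩ := h; rw [ev_mul] at h'; exact h'.symm
    · obtain ⟨x, _, y, _, rfl, _⟩ := h; rw [ev_eq] at hh h'; rw [hh, h']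
    · obtain ⟨x, _, y, _, rfl, _⟩ := h; rw [ev_le] at hh h'; rw [hh, h']
    · obtain ⟨x, _, y, _, rfl, _⟩ := h; rw [ev_imp] at hh h'; rw [hh, h']
    · rw [ev_orc] at hh h'; rw [hh, h']
    · rw [ev_const] at h'; exact h'.symm
  · rw [ev_pair] at h'
    obtain ⟨x, y, rfl, h3, h4⟩ := h'
    have hl : pp e1 e2 < pp 2 (pp e1 e2) := pp_lt_right _ (by simp)
    rw [ih e1 ((le_pp_left _ _).trans_lt hl) _ _ _ h1 h3, ih e2 ((le_pp_right _ _).trans_lt hl) _ _ _ h2 h4]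
  · rw [ev_comp] at h'
    obtain ⟨x, h3, h4⟩ := h'
    have hl : pp e1 e2 < pp 3 (pp e1 e2) := pp_lt_right _ (by simp)
    have := ih e2 ((le_pp_right _ _).trans_lt hl) _ _ _ h1 h3
    subst this
    exact ih e1 ((le_pp_left _ _).trans_lt hl) _ _ _ h2 h4
  · rw [ev_ball] at h'
    obtain ⟨t', r', h1, h2⟩ := h'
    simp only [pp_iff] at h1
    obtain ⟨rfl, rfl⟩ := h1
    have hl : e1 < pp 4 e1 := pp_lt_right _ (by simp)
    rcases h with ⟨rfl, h⟩ | ⟨rfl, x, hx, h⟩ <;> rcases h2 with ⟨rfl, h2⟩ | ⟨rfl, x', hx', h2⟩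
    · rfl
    · exact ih e1 hl _ _ _ (h x' hx') h2
    · exact ih e1 hl _ _ _ h (h2 x hx)
    · rfl
end

end Part8

section Part9


/-- The universal predicates. -/
def Orc : ℕ → ∀ M : PAM, M → Prop
  | 0 => fun _ _ => False
  | k+1 => fun M z => ∃ a s y, z = pp a s ∧ Ev (Orc k M) a (pp y s) 1

theorem orc_sg : ∀ k : ℕ, Sg k (fun (M : PAM) (u : Fin 1 → M) => Orc k M (u 0))
  | 0 => by unfold Orc; infer_instance
  | k+1 => by
    have : ∀ (m : ℕ) (f : ∀ M : PAM, (Fin m → M) → M) [UT f], Dl (k+1) (fun M v => Good (Orc k M) (f M v)) :=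
      fun m f hf => good_dl _ (Dl.of_sg (orc_sg k)) f
    unfold Orc Ev; infer_instance

instance orc_sg' (k : ℕ) {m : ℕ} (f : ∀ M : PAM, (Fin m → M) → M) [hf : UT f] : Sg k (fun M v => Orc k M (f M v)) :=
  Sg.ap1 (orc_sg k) f hf
instance orc_dl' (k : ℕ) {m : ℕ} (f : ∀ M : PAM, (Fin m → M) → M) [hf : UT f] : Dl (k+1) (fun M v => Orc k M (f M v)) :=
  Dl.of_sg (orc_sg' k f)
instance orc_dp (k : ℕ) (M : PAM) : DP (fun u : Fin 1 → M => Orc k M (u 0)) :=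
  (orc_sg k).dp (fun _ v => v 0) (fun _ => inferInstance)
instance orc_dp' (k : ℕ) {M : PAM} {m : ℕ} (f : (Fin m → M) → M) [hf : DT f] : DP (fun v => Orc k M (f v)) :=
  DP.ap1 (orc_dp k M) f hf

theorem orc_succ {k : ℕ} {M : PAM} {a s : M} : Orc (k+1) M (pp a s) ↔ ∃ y, Ev (Orc k M) a (pp y s) 1 := by
  simp [Orc]

def stk {M : PAM} : ∀ {m : ℕ}, (Fin m → M) → M
  | 0, _ => 0
  | m+1, v => pp (v (Fin.last m)) (stk (fun i => v i.castSucc))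

theorem stk_snoc {M : PAM} {m : ℕ} (v : Fin m → M) (x : M) : stk (Fin.snoc v x : Fin (m+1) → M) = pp x (stk v) := by
  simp [stk]

def npp (x y : ℕ) : ℕ := (x + y) * (x + y) + x
theorem npp_cast {M : PAM} (x y : ℕ) : ((npp x y : ℕ) : M) = pp (x : M) y := by simp [npp, pp]
theorem npp_inj {x y x' y' : ℕ} : npp x y = npp x' y' ↔ x = x' ∧ y = y' := by
  have h : ((npp x y : ℕ) : NN) = (npp x' y' : ℕ) ↔ (x : NN) = x' ∧ (y : NN) = y' := by
    rw [npp_cast, npp_cast]; exact pp_iff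
  exact_mod_cast h

def Cf (k : ℕ) {m : ℕ} (f : ∀ M : PAM, (Fin m → M) → M) : Prop :=
  ∃ e : ℕ, ∀ M v, Ev (Orc k M) (e : M) (stk v) (f M v)
open Classical in
def Cd (k : ℕ) {m : ℕ} (P : Fam m) : Prop := Cf k (fun M v => if P M v then 1 else 0)

section
variable {k m : ℕ}
theorem Cf.app1 {f : ∀ M : PAM, (Fin m → M) → M} (hf : Cf k f) (c : ℕ) {g : ∀ M : PAM, M → M}
    (hc : ∀ M s, Ev (Orc k M) (c : M) s (g M s)) : Cf k (fun M v => g M (f M v)) := by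
  obtain ⟨e, he⟩ := hf
  refine ⟨npp 3 (npp c e), fun M v => ?_⟩
  simp only [npp_cast, Nat.cast_ofNat]; rw [ev_comp]
  exact ⟨_, he M v, hc M _⟩
theorem Cf.app2 {f g : ∀ M : PAM, (Fin m → M) → M} (hf : Cf k f) (hg : Cf k g) (c : ℕ) {h : ∀ M : PAM, M → M → M}
    (hc : ∀ M x y, Ev (Orc k M) (c : M) (pp x y) (h M x y)) : Cf k (fun M v => h M (f M v) (g M v)) := by
  obtain ⟨e, he⟩ := hf; obtain ⟨e', he'⟩ := hg
  refine ⟨npp 3 (npp c (npp 2 (npp e e'))), fun M v => ?_⟩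
  simp only [npp_cast, Nat.cast_ofNat]; rw [ev_comp]
  exact ⟨_, (ev_pair _).2 ⟨_, _, rfl, he M v, he' M v⟩, hc M _ _⟩
theorem Cf.const (c : ℕ) : Cf k (fun (M : PAM) (_ : Fin m → M) => (c : M)) := by
  refine ⟨npp 1 c, fun M v => ?_⟩
  simp only [npp_cast, Nat.cast_one]; rw [ev_const]
theorem Cf.id : Cf k (fun (M : PAM) (v : Fin m → M) => stk v) := by
  refine ⟨npp 0 1, fun M v => ?_⟩
  simp only [npp_cast, Nat.cast_one, Nat.cast_zero]; rw [ev_id]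
theorem Cf.var : ∀ {m : ℕ} (i : Fin m), Cf k (fun (M : PAM) (v : Fin m → M) => v i)
  | m+1, i => by
    refine Fin.lastCases ?_ (fun j => ?_) i
    · refine ⟨npp 0 4, fun M v => ?_⟩
      simp only [npp_cast, Nat.cast_ofNat, Nat.cast_zero]; rw [ev_fst]; exact ⟨_, rfl⟩
    · obtain ⟨e, he⟩ := Cf.var j
      refine ⟨npp 3 (npp e (npp 0 5)), fun M v => ?_⟩
      simp only [npp_cast, Nat.cast_ofNat, Nat.cast_zero]; rw [ev_comp]
      exact ⟨_, (ev_snd _).2 ⟨_, rfl⟩, he M (fun i => v i.castSucc)⟩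
theorem Cf.term {m : ℕ} (t : LA.Term (Empty ⊕ Fin m)) : Cf k (fun M v => t.realize (Sum.elim default v)) := by
  induction t with
  | var i => rcases i with i | i
             · exact i.elim
             · exact Cf.var i
  | @func l f ts ih =>
    match l, f, ts, ih with
    | 0, f, ts, ih =>
      have := Cf.const (k := k) (m := m) 0
      convert this using 3 with M v
      rw [Nat.cast_zero]
      show Structure.funMap _ _ = Structure.funMap _ _
      congr 1; funext i; exact i.elim0
    | 1, f, ts, ih =>
      have := Cf.app1 (ih 0) (npp 0 3) (g := fun M x => x + 1) 
        (fun M s => by simp only [npp_cast, Nat.cast_ofNat, Nat.cast_zero]; rw [ev_succ])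
      convert this using 3 with M v
      rw [← sc_eq]
      show Structure.funMap _ _ = Structure.funMap _ _
      congr 1; funext i; fin_cases i; rfl
    | 2, false, ts, ih =>
      have := Cf.app2 (ih 0) (ih 1) (npp 0 6) (h := fun M x y => x + y) 
        (fun M x y => by simp only [npp_cast, Nat.cast_ofNat, Nat.cast_zero]; rw [ev_add])
      convert this using 3 with M v
      show Structure.funMap _ _ = Structure.funMap _ _
      congr 1; funext i; fin_cases i <;> rfl
    | 2, true, ts, ih =>
      have := Cf.app2 (ih 0) (ih 1) (npp 0 7) (h := fun M x y => x * y) 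
        (fun M x y => by simp only [npp_cast, Nat.cast_ofNat, Nat.cast_zero]; rw [ev_mul])
      convert this using 3 with M v
      show Structure.funMap _ _ = Structure.funMap _ _
      congr 1; funext i; fin_cases i <;> rfl

theorem Cd.congr {P Q : Fam m} (h : Cd k P) (h' : ∀ M v, P M v ↔ Q M v) : Cd k Q := by
  have : P = Q := by funext M v; exact propext (h' M v)
  rwa [← this]
theorem Cd.eq {f g : ∀ M : PAM, (Fin m → M) → M} (hf : Cf k f) (hg : Cf k g) : Cd k (fun M v => f M v = g M v) := by
  classical
  have := Cf.app2 hf hg (npp 0 8) (h := fun M x y => if x = y then 1 else 0) fun M x y => by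
    simp only [npp_cast, Nat.cast_ofNat, Nat.cast_zero]; rw [ev_eq]
  unfold Cd; convert this
theorem Cd.le {f g : ∀ M : PAM, (Fin m → M) → M} (hf : Cf k f) (hg : Cf k g) : Cd k (fun M v => f M v ≤ g M v) := by
  classical
  refine Cf.app2 hf hg (npp 0 9) (h := fun M x y => if x ≤ y then 1 else 0) fun M x y => ?_
  simp only [npp_cast, Nat.cast_ofNat, Nat.cast_zero]; rw [ev_le]
theorem Cd.imp {P Q : Fam m} (hf : Cd k P) (hg : Cd k Q) : Cd k (fun M v => P M v → Q M v) := by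
  classical
  have := Cf.app2 hf hg (npp 0 10) (h := fun M x y => if (x = 1 → y = 1) then 1 else 0) fun M x y => by
    simp only [npp_cast, Nat.cast_ofNat, Nat.cast_zero]; rw [ev_imp]
  unfold Cd
  convert this using 3 with M v
  by_cases h1 : P M v <;> by_cases h2 : Q M v <;> simp [h1, h2]
theorem Cd.false : Cd k (fun (M : PAM) (_ : Fin m → M) => False) := by
  have := Cf.const (k := k) (m := m) 0
  unfold Cd
  convert this using 3 with M v; simp
theorem Cd.not {P : Fam m} (hf : Cd k P) : Cd k (fun M v => ¬ P M v) := hf.imp Cd.false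
theorem Cd.ball {f : ∀ M : PAM, (Fin m → M) → M} (hf : Cf k f) {P : Fam (m+1)} (hP : Cd k P) :
    Cd k (fun M v => ∀ x ≤ f M v, P M (Fin.snoc v x)) := by
  classical
  obtain ⟨e, he⟩ := hP
  obtain ⟨e', he'⟩ := hf
  refine ⟨npp 3 (npp (npp 4 e) (npp 2 (npp e' (npp 0 1)))), fun M v => ?_⟩
  simp only [npp_cast, Nat.cast_ofNat, Nat.cast_zero, Nat.cast_one]; rw [ev_comp]
  refine ⟨_, (ev_pair _).2 ⟨_, _, rfl, he' M v, (ev_id _).2 rfl⟩, (ev_ball _).2 ⟨_, _, rfl, ?_⟩⟩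
  by_cases h : ∀ x ≤ f M v, P M (Fin.snoc v x)
  · rw [if_pos h]
    refine .inl ⟨rfl, fun x hx => ?_⟩
    have := he M (Fin.snoc v x); beta_reduce at this; rwa [if_pos (h x hx), stk_snoc] at this
  · rw [if_neg h]
    push Not at h
    obtain ⟨x, hx, h⟩ := h
    refine .inr ⟨rfl, x, hx, ?_⟩
    have := he M (Fin.snoc v x); beta_reduce at this; rwa [if_neg h, stk_snoc] at this
theorem Cd.orc (a : ℕ) : Cd k (fun (M : PAM) (v : Fin m → M) => Orc k M (pp (a : M) (stk v))) := by
  classical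
  refine Cf.app2 (Cf.const a) Cf.id (npp 3 (npp (npp 0 11) (npp 0 1))) (h := fun M x y => if Orc k M (pp x y) then 1 else 0) fun M x y => ?_
  simp only [npp_cast, Nat.cast_ofNat, Nat.cast_zero, Nat.cast_one]; rw [ev_comp]
  exact ⟨_, (ev_id _).2 rfl, (ev_orc _).2 rfl⟩

theorem Cd.delta0 {m : ℕ} {φ : LA.BoundedFormula Empty m} (h : IsDelta0 φ) : Cd k (fun M v => φ.Realize default v) := by
  induction h with
  | falsum => exact Cd.false
  | equal t u => exact (Cd.eq (Cf.term t) (Cf.term u)).congr (fun M v => by simp)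
  | le t u => exact (Cd.le (Cf.term t) (Cf.term u)).congr (fun M v => by simp)
  | imp h1 h2 ih1 ih2 => exact (ih1.imp ih2).congr (fun M v => by simp)
  | @ball m u ψ h ih =>
    refine (Cd.ball (Cf.term u) ih).congr (fun M v => ?_)
    simp [snoc_rl']
  | @bex m u ψ h ih =>
    refine (Cd.ball (Cf.term u) ih.not).not.congr (fun M v => ?_)
    simp [snoc_rl']

def Ex (k : ℕ) {m : ℕ} (P : Fam m) : Prop := ∃ a : ℕ, ∀ M v, P M v ↔ Orc (k+1) M (pp (a : M) (stk v))

theorem Ex.cd {P : Fam m} (h : Ex k P) : Cd (k+1) P := by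
  obtain ⟨a, ha⟩ := h
  exact (Cd.orc a).congr (fun M v => (ha M v).symm)
theorem Cd.ex {P : Fam m} (h : Cd k P) : Ex k P := by
  obtain ⟨e, he⟩ := h
  refine ⟨npp 3 (npp e (npp 0 5)), fun M v => ?_⟩
  simp only [npp_cast, Nat.cast_ofNat, Nat.cast_zero, orc_succ, ev_comp, ev_snd]
  have := he M v
  beta_reduce at this
  constructor
  · intro h; rw [if_pos h] at this; exact ⟨0, _, ⟨0, rfl⟩, this⟩
  · rintro ⟨y, u, ⟨y', h1⟩, h2⟩
    by_contra h; rw [if_neg h] at this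
    simp only [pp_iff] at h1
    rw [← h1.2] at h2
    exact zero_ne_one (ev_uniq _ _ _ _ _ this h2)
theorem Ex.ex {P : Fam (m+1)} (h : Ex k P) : Ex k (fun M v => ∃ x, P M (Fin.snoc v x)) := by
  obtain ⟨a, ha⟩ := h
  refine ⟨npp 3 (npp a (npp 2 (npp (npp 3 (npp (npp 0 4) (npp 0 4))) (npp 2 (npp (npp 3 (npp (npp 0 5) (npp 0 4))) (npp 0 5)))))), fun M v => ?_⟩
  simp only [ha, stk_snoc, npp_cast, Nat.cast_ofNat, Nat.cast_zero, orc_succ, ev_comp, ev_snd, ev_fst, ev_pair]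
  constructor
  · rintro ⟨x, y, h⟩
    exact ⟨pp y x, _, ⟨_, _, rfl, ⟨_, ⟨_, rfl⟩, ⟨_, rfl⟩⟩, _, _, rfl, ⟨_, ⟨_, rfl⟩, ⟨_, rfl⟩⟩, ⟨_, rfl⟩⟩, h⟩
  · rintro ⟨y, u, ⟨x1, x2, rfl, ⟨x3, ⟨x4, h1⟩, ⟨x5, rfl⟩⟩, x6, x7, rfl, ⟨x8, ⟨x9, h2⟩, ⟨x10, rfl⟩⟩, ⟨x11, h3⟩⟩, h⟩
    simp only [pp_iff] at h1 h2 h3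
    obtain ⟨rfl, rfl⟩ := h1
    obtain ⟨h2, rfl⟩ := h2
    obtain ⟨_, rfl⟩ := h3
    simp only [pp_iff] at h2
    obtain ⟨rfl, rfl⟩ := h2
    exact ⟨_, _, h⟩
end

structure Uni (k : ℕ) : Prop where
  sg : ∀ {m : ℕ} {φ : LA.BoundedFormula Empty m}, IsSigmaFml k φ → Cd k (fun M v => φ.Realize default v)
  pi : ∀ {m : ℕ} {φ : LA.BoundedFormula Empty m}, IsPiFml k φ → Cd k (fun M v => φ.Realize default v)

theorem Ex.congr {k m : ℕ} {P Q : Fam m} (h : Ex k P) (h' : ∀ M v, P M v ↔ Q M v) : Ex k Q := by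
  have : P = Q := by funext M v; exact propext (h' M v)
  rwa [← this]

theorem uni_sg {k : ℕ} (u : Uni k) : ∀ {m : ℕ} {φ : LA.BoundedFormula Empty m} (_ : IsSigmaFml (k+1) φ), Ex k (fun M v => φ.Realize default v)
  | _, _, .ofPi h => (u.pi h).ex
  | _, _, .ex h => (uni_sg u h).ex.congr (fun M v => by simp)
theorem uni_pi {k : ℕ} (u : Uni k) : ∀ {m : ℕ} {φ : LA.BoundedFormula Empty m} (_ : IsPiFml (k+1) φ), Ex k (fun M v => ¬ φ.Realize default v)
  | _, _, .ofSigma h => (u.sg h).not.ex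
  | _, _, .all h => (uni_pi u h).ex.congr (fun M v => by simp)
theorem uni : ∀ k, Uni k
  | 0 => ⟨fun h => by cases h with | ofDelta0 h => exact .delta0 h, fun h => by cases h with | ofDelta0 h => exact .delta0 h⟩
  | k+1 => ⟨fun h => (uni_sg (uni k) h).cd, fun h => (uni_pi (uni k) h).cd.not.congr (fun M v => not_not)⟩

theorem universal {k m : ℕ} {P : Fam m} (h : SigF (k+1) P) :
    ∃ a : ℕ, ∀ M v, P M v ↔ Orc (k+1) M (pp (a : M) (stk v)) := by
  obtain ⟨⟨φ, h1, h2⟩, _⟩ := h.fml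
  exact (uni_sg (uni k) h1).congr h2

end Part9

section Part10


noncomputable def cst {m : ℕ} (v : Fin m → ℕ) : Fin m → NN := fun i => (v i : NN)

class NT {m : ℕ} (f : (Fin m → ℕ) → ℕ) : Prop where
  out : ∃ F : ∀ M : PAM, (Fin m → M) → M, UT F ∧ ∀ v, F NN (cst v) = (f v : NN)
class R0 {m : ℕ} (P : (Fin m → ℕ) → Prop) : Prop where
  out : ∃ Q : Fam m, Dl 0 Q ∧ ∀ v, Q NN (cst v) ↔ P v
class S1 {m : ℕ} (P : (Fin m → ℕ) → Prop) : Prop where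
  out : ∃ Q : Fam m, Sg 1 Q ∧ ∀ v, Q NN (cst v) ↔ P v

section
variable {m : ℕ}
instance (priority := 2000) NT.var (i : Fin m) : NT (fun v : Fin m → ℕ => v i) := ⟨fun M v => v i, inferInstance, fun v => rfl⟩
instance (priority := 1900) NT.const (n : ℕ) : NT (fun _ : Fin m → ℕ => n) := ⟨fun M v => n, inferInstance, fun v => rfl⟩
instance NT.add (f g : (Fin m → ℕ) → ℕ) [hf : NT f] [hg : NT g] : NT (fun v => f v + g v) := by
  obtain ⟨F, h1, h2⟩ := hf; obtain ⟨G, h3, h4⟩ := hg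
  exact ⟨fun M v => F M v + G M v, inferInstance, fun v => by simp [h2, h4]⟩
instance NT.mul (f g : (Fin m → ℕ) → ℕ) [hf : NT f] [hg : NT g] : NT (fun v => f v * g v) := by
  obtain ⟨F, h1, h2⟩ := hf; obtain ⟨G, h3, h4⟩ := hg
  exact ⟨fun M v => F M v * G M v, inferInstance, fun v => by simp [h2, h4]⟩
instance NT.npp (f g : (Fin m → ℕ) → ℕ) [hf : NT f] [hg : NT g] : NT (fun v => npp (f v) (g v)) := by
  unfold Guaspari.npp; infer_instance

theorem R0.congr {P Q : (Fin m → ℕ) → Prop} (h : R0 P) (h' : ∀ v, P v ↔ Q v) : R0 Q := by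
  obtain ⟨R, h1, h2⟩ := h; exact ⟨R, h1, fun v => (h2 v).trans (h' v)⟩
theorem S1.congr {P Q : (Fin m → ℕ) → Prop} (h : S1 P) (h' : ∀ v, P v ↔ Q v) : S1 Q := by
  obtain ⟨R, h1, h2⟩ := h; exact ⟨R, h1, fun v => (h2 v).trans (h' v)⟩
theorem subst_aux {n : ℕ} (f : Fin n → (Fin m → ℕ) → ℕ) (hf : ∀ i, NT (f i)) :
    ∃ F : Fin n → ∀ M : PAM, (Fin m → M) → M, (∀ i, UT (F i)) ∧ ∀ v, (fun i => F i NN (cst v)) = cst (fun i => f i v) := by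
  choose F h1 h2 using fun i => (hf i).out
  exact ⟨F, h1, fun v => funext fun i => h2 i v⟩
theorem R0.subst {n : ℕ} {P : (Fin n → ℕ) → Prop} (h : R0 P) (f : Fin n → (Fin m → ℕ) → ℕ) (hf : ∀ i, NT (f i)) :
    R0 (fun v => P (fun i => f i v)) := by
  obtain ⟨Q, h1, h2⟩ := h; obtain ⟨F, h3, h4⟩ := subst_aux f hf
  exact ⟨_, h1.subst F h3, fun v => by beta_reduce; rw [h4, h2]⟩
theorem S1.subst {n : ℕ} {P : (Fin n → ℕ) → Prop} (h : S1 P) (f : Fin n → (Fin m → ℕ) → ℕ) (hf : ∀ i, NT (f i)) :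
    S1 (fun v => P (fun i => f i v)) := by
  obtain ⟨Q, h1, h2⟩ := h; obtain ⟨F, h3, h4⟩ := subst_aux f hf
  exact ⟨_, h1.subst F h3, fun v => by beta_reduce; rw [h4, h2]⟩

instance R0.eq (f g : (Fin m → ℕ) → ℕ) [hf : NT f] [hg : NT g] : R0 (fun v => f v = g v) := by
  obtain ⟨F, h1, h2⟩ := hf; obtain ⟨G, h3, h4⟩ := hg
  exact ⟨fun M v => F M v = G M v, inferInstance, fun v => by simp [h2, h4]⟩
instance R0.le (f g : (Fin m → ℕ) → ℕ) [hf : NT f] [hg : NT g] : R0 (fun v => f v ≤ g v) := by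
  obtain ⟨F, h1, h2⟩ := hf; obtain ⟨G, h3, h4⟩ := hg
  exact ⟨fun M v => F M v ≤ G M v, inferInstance, fun v => by simp [h2, h4]⟩
instance R0.lt (f g : (Fin m → ℕ) → ℕ) [hf : NT f] [hg : NT g] : R0 (fun v => f v < g v) := by
  obtain ⟨F, h1, h2⟩ := hf; obtain ⟨G, h3, h4⟩ := hg
  exact ⟨fun M v => F M v < G M v, inferInstance, fun v => by simp [h2, h4]⟩
instance R0.not (P : (Fin m → ℕ) → Prop) [hf : R0 P] : R0 (fun v => ¬ P v) := by
  obtain ⟨F, h1, h2⟩ := hf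
  exact ⟨fun M v => ¬ F M v, inferInstance, fun v => by simp [h2]⟩
instance R0.ne (f g : (Fin m → ℕ) → ℕ) [hf : NT f] [hg : NT g] : R0 (fun v => f v ≠ g v) := R0.not _
instance R0.and (P Q : (Fin m → ℕ) → Prop) [hf : R0 P] [hg : R0 Q] : R0 (fun v => P v ∧ Q v) := by
  obtain ⟨F, h1, h2⟩ := hf; obtain ⟨G, h3, h4⟩ := hg
  exact ⟨fun M v => F M v ∧ G M v, inferInstance, fun v => by simp [h2, h4]⟩
instance R0.or (P Q : (Fin m → ℕ) → Prop) [hf : R0 P] [hg : R0 Q] : R0 (fun v => P v ∨ Q v) := by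
  obtain ⟨F, h1, h2⟩ := hf; obtain ⟨G, h3, h4⟩ := hg
  exact ⟨fun M v => F M v ∨ G M v, inferInstance, fun v => by simp [h2, h4]⟩
instance R0.imp (P Q : (Fin m → ℕ) → Prop) [hf : R0 P] [hg : R0 Q] : R0 (fun v => P v → Q v) := by
  obtain ⟨F, h1, h2⟩ := hf; obtain ⟨G, h3, h4⟩ := hg
  exact ⟨fun M v => F M v → G M v, inferInstance, fun v => by simp [h2, h4]⟩
instance R0.iff (P Q : (Fin m → ℕ) → Prop) [hf : R0 P] [hg : R0 Q] : R0 (fun v => P v ↔ Q v) := by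
  obtain ⟨F, h1, h2⟩ := hf; obtain ⟨G, h3, h4⟩ := hg
  exact ⟨fun M v => F M v ↔ G M v, inferInstance, fun v => by simp [h2, h4]⟩
instance R0.prop (p : Prop) : R0 (fun _ : Fin m → ℕ => p) := by
  by_cases h : p
  · exact ⟨fun _ _ => True, inferInstance, fun v => by simp [h]⟩
  · exact ⟨fun _ _ => False, inferInstance, fun v => by simp [h]⟩
theorem cst_snoc (v : Fin m → ℕ) (k : ℕ) : (Fin.snoc (cst v) (k : NN) : Fin (m+1) → NN) = cst (Fin.snoc v k : Fin (m+1) → ℕ) :=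
  snoc_cast NN v k
theorem bex_aux {f : (Fin m → ℕ) → ℕ} {P : ℕ → (Fin m → ℕ) → Prop} {F : ∀ M : PAM, (Fin m → M) → M}
    {Q : Fam (m+1)} (h2 : ∀ v, F NN (cst v) = (f v : NN))
    (h4 : ∀ v, Q NN (cst v) ↔ P (v (Fin.last m)) (fun i => v i.castSucc)) (v : Fin m → ℕ) :
    (∃ x, x ≤ F NN (cst v) ∧ Q NN (Fin.snoc (cst v) x)) ↔ ∃ x, x ≤ f v ∧ P x v := by
  rw [h2]
  constructor
  · rintro ⟨x, hx, h⟩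
    obtain ⟨k, rfl⟩ := NN_std x
    rw [cst_snoc, h4] at h
    exact ⟨k, by exact_mod_cast hx, by simpa using h⟩
  · rintro ⟨x, hx, h⟩
    exact ⟨x, by exact_mod_cast hx, by rw [cst_snoc, h4]; simpa using h⟩
theorem ball_aux {f : (Fin m → ℕ) → ℕ} {P : ℕ → (Fin m → ℕ) → Prop} {F : ∀ M : PAM, (Fin m → M) → M}
    {Q : Fam (m+1)} (h2 : ∀ v, F NN (cst v) = (f v : NN))
    (h4 : ∀ v, Q NN (cst v) ↔ P (v (Fin.last m)) (fun i => v i.castSucc)) (v : Fin m → ℕ) :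
    (∀ x, x ≤ F NN (cst v) → Q NN (Fin.snoc (cst v) x)) ↔ ∀ x, x ≤ f v → P x v := by
  rw [h2]
  constructor
  · intro h x hx
    have := h x (by exact_mod_cast hx)
    rw [cst_snoc, h4] at this; simpa using this
  · intro h x hx
    obtain ⟨k, rfl⟩ := NN_std x
    rw [cst_snoc, h4]; simpa using h k (by exact_mod_cast hx)
instance R0.bex (P : ℕ → (Fin m → ℕ) → Prop) (f : (Fin m → ℕ) → ℕ) [hf : NT f]
    [h : R0 (fun w : Fin (m+1) → ℕ => P (w (Fin.last m)) (fun i => w i.castSucc))] : R0 (fun v => ∃ x, x ≤ f v ∧ P x v) := by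
  obtain ⟨F, h1, h2⟩ := hf; obtain ⟨Q, h3, h4⟩ := h
  refine ⟨fun M v => ∃ x, x ≤ F M v ∧ Q M (Fin.snoc v x), Dl.bex _ F (h := h3.congr (fun M v => by rw [snoc_cs])), bex_aux h2 h4⟩
instance R0.ball (P : ℕ → (Fin m → ℕ) → Prop) (f : (Fin m → ℕ) → ℕ) [hf : NT f]
    [h : R0 (fun w : Fin (m+1) → ℕ => P (w (Fin.last m)) (fun i => w i.castSucc))] : R0 (fun v => ∀ x, x ≤ f v → P x v) := by
  obtain ⟨F, h1, h2⟩ := hf; obtain ⟨Q, h3, h4⟩ := h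
  refine ⟨fun M v => ∀ x, x ≤ F M v → Q M (Fin.snoc v x), Dl.ball _ F (h := h3.congr (fun M v => by rw [snoc_cs])), ball_aux h2 h4⟩

theorem Dl.up {P : Fam m} (h : Dl 0 P) : Dl 1 P := h.succ
instance (priority := 500) S1.of_n0 (P : (Fin m → ℕ) → Prop) [h : R0 P] : S1 P := by
  obtain ⟨Q, h1, h2⟩ := h
  exact ⟨Q, ⟨h1.up.pos⟩, h2⟩
instance S1.and (P Q : (Fin m → ℕ) → Prop) [hf : S1 P] [hg : S1 Q] : S1 (fun v => P v ∧ Q v) := by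
  obtain ⟨F, h1, h2⟩ := hf; obtain ⟨G, h3, h4⟩ := hg
  exact ⟨fun M v => F M v ∧ G M v, inferInstance, fun v => by simp [h2, h4]⟩
instance S1.or (P Q : (Fin m → ℕ) → Prop) [hf : S1 P] [hg : S1 Q] : S1 (fun v => P v ∨ Q v) := by
  obtain ⟨F, h1, h2⟩ := hf; obtain ⟨G, h3, h4⟩ := hg
  exact ⟨fun M v => F M v ∨ G M v, inferInstance, fun v => by simp [h2, h4]⟩
instance S1.imp (P Q : (Fin m → ℕ) → Prop) [hf : R0 P] [hg : S1 Q] : S1 (fun v => P v → Q v) := by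
  obtain ⟨F, h1, h2⟩ := hf; obtain ⟨G, h3, h4⟩ := hg
  have := h1.up
  exact ⟨fun M v => F M v → G M v, inferInstance, fun v => by simp [h2, h4]⟩
instance S1.ex (P : ℕ → (Fin m → ℕ) → Prop)
    [h : S1 (fun w : Fin (m+1) → ℕ => P (w (Fin.last m)) (fun i => w i.castSucc))] : S1 (fun v => ∃ x, P x v) := by
  obtain ⟨Q, h3, h4⟩ := h
  refine ⟨fun M v => ∃ x, Q M (Fin.snoc v x), Sg.ex _ (h := h3.congr (fun M v => by rw [snoc_cs])), fun v => ?_⟩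
  constructor
  · rintro ⟨x, h⟩
    obtain ⟨k, rfl⟩ := NN_std x
    rw [cst_snoc, h4] at h
    exact ⟨k, by simpa using h⟩
  · rintro ⟨x, h⟩
    exact ⟨x, by rw [cst_snoc, h4]; simpa using h⟩
instance S1.bex (P : ℕ → (Fin m → ℕ) → Prop) (f : (Fin m → ℕ) → ℕ) [hf : NT f]
    [h : S1 (fun w : Fin (m+1) → ℕ => P (w (Fin.last m)) (fun i => w i.castSucc))] : S1 (fun v => ∃ x, x ≤ f v ∧ P x v) := by
  obtain ⟨F, h1, h2⟩ := hf; obtain ⟨Q, h3, h4⟩ := h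
  refine ⟨fun M v => ∃ x, x ≤ F M v ∧ Q M (Fin.snoc v x), Sg.bex _ F (h := h3.congr (fun M v => by rw [snoc_cs])), bex_aux h2 h4⟩
instance S1.ball (P : ℕ → (Fin m → ℕ) → Prop) (f : (Fin m → ℕ) → ℕ) [hf : NT f]
    [h : S1 (fun w : Fin (m+1) → ℕ => P (w (Fin.last m)) (fun i => w i.castSucc))] : S1 (fun v => ∀ x, x ≤ f v → P x v) := by
  obtain ⟨F, h1, h2⟩ := hf; obtain ⟨Q, h3, h4⟩ := h
  refine ⟨fun M v => ∀ x, x ≤ F M v → Q M (Fin.snoc v x), Sg.ball _ F (h := h3.congr (fun M v => by rw [snoc_cs])), ball_aux h2 h4⟩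
end

theorem S1.ap1 {m : ℕ} {P : ℕ → Prop} (h : S1 (fun v : Fin 1 → ℕ => P (v 0))) (f : (Fin m → ℕ) → ℕ) (hf : NT f) :
    S1 (fun v => P (f v)) := h.subst (fun _ => f) (fun _ => hf)
theorem S1.ap2 {m : ℕ} {P : ℕ → ℕ → Prop} (h : S1 (fun v : Fin 2 → ℕ => P (v 0) (v 1))) (f g : (Fin m → ℕ) → ℕ) (hf : NT f) (hg : NT g) :
    S1 (fun v => P (f v) (g v)) := h.subst ![f, g] (by intro i; fin_cases i <;> assumption)
theorem S1.ap3 {m : ℕ} {P : ℕ → ℕ → ℕ → Prop} (h : S1 (fun v : Fin 3 → ℕ => P (v 0) (v 1) (v 2)))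
    (f g k : (Fin m → ℕ) → ℕ) (hf : NT f) (hg : NT g) (hk : NT k) :
    S1 (fun v => P (f v) (g v) (k v)) := h.subst ![f, g, k] (by intro i; fin_cases i <;> assumption)
theorem R0.ap3 {m : ℕ} {P : ℕ → ℕ → ℕ → Prop} (h : R0 (fun v : Fin 3 → ℕ => P (v 0) (v 1) (v 2)))
    (f g k : (Fin m → ℕ) → ℕ) (hf : NT f) (hg : NT g) (hk : NT k) :
    R0 (fun v => P (f v) (g v) (k v)) := h.subst ![f, g, k] (by intro i; fin_cases i <;> assumption)

/-- coded sets of naturals -/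
def nMem (i W : ℕ) : Prop := Mem (i : NN) (W : NN)
instance {m : ℕ} (f g : (Fin m → ℕ) → ℕ) [hf : NT f] [hg : NT g] : R0 (fun v => nMem (f v) (g v)) := by
  obtain ⟨F, h1, h2⟩ := hf; obtain ⟨G, h3, h4⟩ := hg
  exact ⟨fun M v => Mem (F M v) (G M v), inferInstance, fun v => by simp [h2, h4, nMem]⟩
theorem nMem.le {i W : ℕ} (h : nMem i W) : i ≤ W := by exact_mod_cast Mem.le h
theorem ncomp (S : Finset ℕ) : ∃ W, ∀ i, nMem i W ↔ i ∈ S := by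
  have : DP (fun v : Fin 1 → NN => ∃ a ∈ S, v 0 = (a : NN)) := by
    induction S using Finset.induction_on with
    | empty => exact (DP.prop False).congr (by simp)
    | insert a S _ ih => exact (DP.or (fun v : Fin 1 → NN => v 0 = (a : NN)) _ (hg := ih)).congr (by simp)
  obtain ⟨W, hW⟩ := comp (fun x : NN => ∃ a ∈ S, x = (a : NN)) ((S.sup id : ℕ) : NN)
  obtain ⟨W, rfl⟩ := NN_std W
  refine ⟨W, fun i => ?_⟩
  unfold nMem; rw [hW]
  constructor
  · rintro ⟨_, a, ha, h⟩; rwa [Nat.cast_inj.1 h]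
  · intro h; exact ⟨Nat.cast_le.2 (Finset.le_sup (f := id) h), i, h, rfl⟩

theorem npp_le_left (x y : ℕ) : x ≤ npp x y := Nat.le_add_left _ _
theorem npp_le_right (x y : ℕ) : y ≤ npp x y := by unfold npp; nlinarith

/-- inductive derivability -/
inductive Der (J0 : ℕ → Prop) (J : ℕ → ℕ → ℕ → Prop) : ℕ → Prop
  | ax {x : ℕ} : J0 x → Der J0 J x
  | step {x a b : ℕ} : J x a b → Der J0 J a → Der J0 J b → Der J0 J x

theorem Der.fin {J0 : ℕ → Prop} {J : ℕ → ℕ → ℕ → Prop} {x : ℕ} (h : Der J0 J x) :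
    ∃ (S : Finset ℕ) (t : ℕ), npp t x ∈ S ∧ ∀ s y, npp s y ∈ S → s ≤ t ∧ (J0 y ∨ ∃ a b s1 s2, s1 < s ∧ s2 < s ∧ npp s1 a ∈ S ∧
      npp s2 b ∈ S ∧ J y a b) := by
  induction h with
  | @ax x h =>
    refine ⟨{npp 0 x}, 0, by simp, fun s y hy => ?_⟩
    simp only [Finset.mem_singleton, npp_inj] at hy
    rw [hy.1, hy.2]; exact ⟨le_rfl, .inl h⟩
  | @step x a b h _ _ ih1 ih2 =>
    obtain ⟨Sa, t1, h1, h2⟩ := ih1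
    obtain ⟨Sb, t2, h3, h4⟩ := ih2
    refine ⟨insert (npp (t1 + t2 + 1) x) (Sa ∪ Sb), t1 + t2 + 1, by simp, fun s y hy => ?_⟩
    rcases Finset.mem_insert.1 hy with hy | hy
    · rw [npp_inj] at hy
      obtain ⟨rfl, rfl⟩ := hy
      exact ⟨le_rfl, .inr ⟨a, b, t1, t2, by omega, by omega, by simp [h1], by simp [h3], h⟩⟩
    · rcases Finset.mem_union.1 hy with hy | hy
      · refine ⟨by have := (h2 s y hy).1; omega, (h2 s y hy).2.imp_right ?_⟩
        rintro ⟨a, b, s1, s2, q1, q2, q3, q4, q5⟩; exact ⟨a, b, s1, s2, q1, q2, by simp [q3], by simp [q4], q5⟩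
      · refine ⟨by have := (h4 s y hy).1; omega, (h4 s y hy).2.imp_right ?_⟩
        rintro ⟨a, b, s1, s2, q1, q2, q3, q4, q5⟩; exact ⟨a, b, s1, s2, q1, q2, by simp [q3], by simp [q4], q5⟩

theorem der_s1 {J0 : ℕ → Prop} {J : ℕ → ℕ → ℕ → Prop} (h0 : S1 (fun v : Fin 1 → ℕ => J0 (v 0)))
    (h1 : S1 (fun v : Fin 3 → ℕ => J (v 0) (v 1) (v 2))) : S1 (fun v : Fin 1 → ℕ => Der J0 J (v 0)) := by
  have i0 : ∀ (m : ℕ) (f : (Fin m → ℕ) → ℕ) [NT f], S1 (fun v => J0 (f v)) := fun m f hf => h0.ap1 f hf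
  have i1 : ∀ (m : ℕ) (f g k : (Fin m → ℕ) → ℕ) [NT f] [NT g] [NT k], S1 (fun v => J (f v) (g v) (k v)) := 
    fun m f g k _ _ _ => h1.ap3 f g k ‹_› ‹_› ‹_›
  have : S1 (fun v : Fin 1 → ℕ => ∃ W t, nMem (npp t (v 0)) W ∧ ∀ s ≤ W, ∀ y ≤ W, nMem (npp s y) W →
     (J0 y ∨ ∃ a b s1 s2, s1 < s ∧ s2 < s ∧ nMem (npp s1 a) W ∧ nMem (npp s2 b) W ∧ J y a b)) := inferInstance
  refine this.congr fun v => ⟨?_, fun h => ?_⟩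
  · rintro ⟨W, t, ht, h⟩
    have key : ∀ s y, nMem (npp s y) W → Der J0 J y := by
      intro s
      induction s using Nat.strong_induction_on with
      | _ s ih =>
        intro y hy
        rcases h s ((npp_le_left _ _).trans hy.le) y ((npp_le_right _ _).trans hy.le) hy with h | ⟨a, b, s1, s2, q1, q2, q3, q4, q5⟩
        · exact .ax h
        · exact .step q5 (ih _ q1 _ q3) (ih _ q2 _ q4)
    exact key _ _ ht
  · obtain ⟨S, t, h2, h3⟩ := h.fin
    obtain ⟨W, hW⟩ := ncomp S
    simp only [← hW] at h2 h3
    exact ⟨W, t, h2, fun s _ y _ hy => (h3 s y hy).2⟩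

end Part10

section Part11


instance R0.pair {m : ℕ} (f g h : (Fin m → ℕ) → ℕ) [NT f] [NT g] [NT h] : R0 (fun v => f v = Nat.pair (g v) (h v)) := by
  have : R0 (fun v => (g v < h v ∧ f v = h v * h v + g v) ∨ (¬ g v < h v ∧ f v = g v * g v + g v + h v)) := inferInstance
  refine this.congr fun v => ?_
  unfold Nat.pair
  split_ifs with hh <;> simp [hh]

theorem partrec_s1 {f : ℕ →. ℕ} (h : Nat.Partrec f) : S1 (fun v : Fin 2 → ℕ => v 1 ∈ f (v 0)) := by
  induction h with
  | zero =>
    have : S1 (fun v : Fin 2 → ℕ => v 1 = 0) := inferInstance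
    exact this.congr fun v => by simp [pure, PFun.pure]
  | succ =>
    have : S1 (fun v : Fin 2 → ℕ => v 1 = v 0 + 1) := inferInstance
    exact this.congr fun v => by simp
  | left =>
    have : S1 (fun v : Fin 2 → ℕ => ∃ b, v 0 = Nat.pair (v 1) b) := inferInstance
    refine this.congr fun v => ?_
    simp only [PFun.coe_val, Part.mem_some_iff]
    constructor
    · rintro ⟨b, h⟩; rw [h]; simp
    · intro h; exact ⟨(Nat.unpair (v 0)).2, by rw [h]; simp⟩
  | right =>
    have : S1 (fun v : Fin 2 → ℕ => ∃ b, v 0 = Nat.pair b (v 1)) := inferInstance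
    refine this.congr fun v => ?_
    simp only [PFun.coe_val, Part.mem_some_iff]
    constructor
    · rintro ⟨b, h⟩; rw [h]; simp
    · intro h; exact ⟨(Nat.unpair (v 0)).1, by rw [h]; simp⟩
  | @pair f g _ _ ihf ihg =>
    have i1 : ∀ (m : ℕ) (a b : (Fin m → ℕ) → ℕ) [NT a] [NT b], S1 (fun v => b v ∈ f (a v)) :=
      fun m a b _ _ => S1.ap2 (P := fun x y => y ∈ f x) ihf a b ‹_› ‹_›
    have i2 : ∀ (m : ℕ) (a b : (Fin m → ℕ) → ℕ) [NT a] [NT b], S1 (fun v => b v ∈ g (a v)) :=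
      fun m a b _ _ => S1.ap2 (P := fun x y => y ∈ g x) ihg a b ‹_› ‹_›
    have : S1 (fun v : Fin 2 → ℕ => ∃ a b, a ∈ f (v 0) ∧ b ∈ g (v 0) ∧ v 1 = Nat.pair a b) := inferInstance
    refine this.congr fun v => ?_
    simp only [Seq.seq, Part.map_eq_map, Part.bind_eq_bind, Part.mem_bind_iff, Part.mem_map_iff]
    constructor
    · rintro ⟨a, b, h1, h2, h3⟩; exact ⟨_, ⟨a, h1, rfl⟩, b, h2, h3.symm⟩
    · rintro ⟨_, ⟨a, h1, rfl⟩, b, h2, h3⟩; exact ⟨a, b, h1, h2, h3.symm⟩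
  | @comp f g _ _ ihf ihg =>
    have i1 : ∀ (m : ℕ) (a b : (Fin m → ℕ) → ℕ) [NT a] [NT b], S1 (fun v => b v ∈ f (a v)) :=
      fun m a b _ _ => S1.ap2 (P := fun x y => y ∈ f x) ihf a b ‹_› ‹_›
    have i2 : ∀ (m : ℕ) (a b : (Fin m → ℕ) → ℕ) [NT a] [NT b], S1 (fun v => b v ∈ g (a v)) :=
      fun m a b _ _ => S1.ap2 (P := fun x y => y ∈ g x) ihg a b ‹_› ‹_›
    have : S1 (fun v : Fin 2 → ℕ => ∃ a, a ∈ g (v 0) ∧ v 1 ∈ f a) := inferInstance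
    refine this.congr fun v => ?_
    exact (Part.mem_bind_iff (f := g (v 0)) (g := f)).symm
  | @prec f g _ _ ihf ihg =>
    have i1 : ∀ (m : ℕ) (a b : (Fin m → ℕ) → ℕ) [NT a] [NT b], S1 (fun v => b v ∈ f (a v)) :=
      fun m a b _ _ => S1.ap2 (P := fun x y => y ∈ f x) ihf a b ‹_› ‹_›
    have i2 : ∀ (m : ℕ) (a b : (Fin m → ℕ) → ℕ) [NT a] [NT b], S1 (fun v => b v ∈ g (a v)) :=
      fun m a b _ _ => S1.ap2 (P := fun x y => y ∈ g x) ihg a b ‹_› ‹_›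
    let J0 : ℕ → Prop := fun x => ∃ a y, x = npp (npp a 0) y ∧ y ∈ f a
    let J : ℕ → ℕ → ℕ → Prop := fun x p _ => ∃ a n i y z w, p = npp (npp a n) i ∧ x = npp (npp a (n+1)) y ∧
      z = Nat.pair n i ∧ w = Nat.pair a z ∧ y ∈ g w
    have j0 : S1 (fun v : Fin 1 → ℕ => J0 (v 0)) := by unfold J0; infer_instance
    have j1 : S1 (fun v : Fin 3 → ℕ => J (v 0) (v 1) (v 2)) := by unfold J; infer_instance
    have hd := der_s1 j0 j1
    have i3 : ∀ (m : ℕ) (a : (Fin m → ℕ) → ℕ) [NT a], S1 (fun v => Der J0 J (a v)) :=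
      fun m a _ => S1.ap1 (P := Der J0 J) hd a ‹_›
    have : S1 (fun v : Fin 2 → ℕ => ∃ a n, v 0 = Nat.pair a n ∧ Der J0 J (npp (npp a n) (v 1))) := inferInstance
    refine this.congr fun v => ?_
    have key : ∀ a n y, Der J0 J (npp (npp a n) y) ↔
        y ∈ (Nat.rec (f a) (fun y IH => IH.bind fun i => g (Nat.pair a (Nat.pair y i))) n : Part ℕ) := by
      intro a n
      induction n with
      | zero =>
        intro y
        constructor
        · intro h
          cases h with
          | ax h => obtain ⟨a', y', h, h'⟩ := h; simp only [npp_inj] at h; rw [h.1.1, h.2]; exact h'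
          | step h _ _ => obtain ⟨a', n, i, y', z, w, _, h, _⟩ := h; simp only [npp_inj] at h; omega
        · intro h; exact .ax ⟨a, y, rfl, h⟩
      | succ n ih =>
        intro y
        simp only [Part.mem_bind_iff]
        constructor
        · intro h
          cases h with
          | ax h => obtain ⟨a', y', h, h'⟩ := h; simp only [npp_inj] at h; omega
          | step h h1 _ =>
            obtain ⟨a', n', i, y', z, w, rfl, h, rfl, rfl, h'⟩ := h
            simp only [npp_inj, Nat.add_right_cancel_iff] at h
            obtain ⟨⟨rfl, rfl⟩, rfl⟩ := h
            exact ⟨i, (ih i).1 h1, h'⟩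
        · rintro ⟨i, hi, h⟩
          exact .step ⟨a, n, i, y, _, _, rfl, rfl, rfl, rfl, h⟩ ((ih i).2 hi) ((ih i).2 hi)
    simp only [Nat.unpaired, key]
    constructor
    · rintro ⟨a, n, h, h'⟩; rw [h]; simpa using h'
    · intro h; exact ⟨_, _, (Nat.pair_unpair _).symm, h⟩
  | @rfind f _ ihf =>
    have i1 : ∀ (m : ℕ) (a b : (Fin m → ℕ) → ℕ) [NT a] [NT b], S1 (fun v => b v ∈ f (a v)) :=
      fun m a b _ _ => S1.ap2 (P := fun x y => y ∈ f x) ihf a b ‹_› ‹_›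
    have : S1 (fun v : Fin 2 → ℕ => (∃ w, w = Nat.pair (v 0) (v 1) ∧ 0 ∈ f w) ∧ ∀ m ≤ v 1, m < v 1 →
       ∃ w z, w = Nat.pair (v 0) m ∧ z ≠ 0 ∧ z ∈ f w) := inferInstance
    refine this.congr fun v => ?_
    refine Iff.trans ?_ Nat.mem_rfind.symm
    simp only [Part.map_eq_map, Part.mem_map_iff, decide_eq_true_eq, exists_eq_left, exists_eq_right, decide_eq_false_iff_not]
    refine and_congr Iff.rfl ⟨fun h m hm => ?_, fun h m _ hm => ?_⟩
    · obtain ⟨w, z, rfl, h1, h2⟩ := h m hm.le hm; exact ⟨z, h2, h1⟩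
    · obtain ⟨z, h1, h2⟩ := h hm; exact ⟨_, z, rfl, h2, h1⟩

theorem re_s1 {p : ℕ → Prop} (h : REPred p) : S1 (fun v : Fin 1 → ℕ => p (v 0)) := by
  have h1 : ∃ f : ℕ →. ℕ, Nat.Partrec f ∧ ∀ x, (∃ y, y ∈ f x) ↔ p x := ⟨_, h, fun x => by simp [Part.assert]⟩
  obtain ⟨f, h1, h3⟩ := h1
  have i1 : ∀ (m : ℕ) (a b : (Fin m → ℕ) → ℕ) [NT a] [NT b], S1 (fun v => b v ∈ f (a v)) :=
      fun m a b _ _ => S1.ap2 (P := fun x y => y ∈ f x) (partrec_s1 h1) a b ‹_› ‹_›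
  have : S1 (fun v : Fin 1 → ℕ => ∃ y, y ∈ f (v 0)) := inferInstance
  exact this.congr fun v => h3 _

theorem comp_s1 {f : ℕ → ℕ} (h : Computable f) : S1 (fun v : Fin 2 → ℕ => v 1 = f (v 0)) := by
  have h1 : Nat.Partrec f := by simpa using Partrec.nat_iff.1 h
  exact (partrec_s1 h1).congr fun v => by simp


end Part11

section Part12


abbrev tt : ℕ := npp 3 0
abbrev ff : ℕ := npp 4 0
/-- a clause `p ∧ q ∧ r → u ∨ y` -/
abbrev cls (p q r u y : ℕ) : ℕ := npp p (npp q (npp r (npp u y)))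
def Sat (C : ℕ → Prop) (w : ℕ → Prop) : Prop :=
  w tt ∧ ¬ w ff ∧ ∀ p q r u y, C (cls p q r u y) → w p → w q → w r → w u ∨ w y

def UJ0 (Cl : ℕ → ℕ → Prop) (z : ℕ) : Prop := ∃ x s, z = npp x s ∧ (nMem (npp 0 tt) s ∨ nMem (npp 1 ff) s ∨
  ∃ p q r u y, Cl x (cls p q r u y) ∧ nMem (npp 1 p) s ∧ nMem (npp 1 q) s ∧ nMem (npp 1 r) s ∧ nMem (npp 0 u) s ∧ nMem (npp 0 y) s)
def UJ (z a b : ℕ) : Prop := ∃ x s s1 s0 p, z = npp x s ∧ a = npp x s1 ∧ b = npp x s0 ∧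
  (∀ i ≤ s1, nMem i s1 → nMem i s ∨ i = npp 1 p) ∧ (∀ i ≤ s0, nMem i s0 → nMem i s ∨ i = npp 0 p)

theorem der_sound {Cl : ℕ → ℕ → Prop} {z : ℕ} (h : Der (UJ0 Cl) UJ z) : ∀ x s, z = npp x s → ∀ w, Sat (Cl x) w →
    ¬ ((∀ p, nMem (npp 1 p) s → w p) ∧ (∀ p, nMem (npp 0 p) s → ¬ w p)) := by
  induction h with
  | @ax z h =>
    rintro x s rfl w hw ⟨h1, h2⟩
    obtain ⟨x', s', e, h⟩ := h
    obtain ⟨rfl, rfl⟩ := npp_inj.1 e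
    rcases h with h | h | ⟨p, q, r, u, y, hc, a1, a2, a3, a4, a5⟩
    · exact h2 _ h hw.1
    · exact hw.2.1 (h1 _ h)
    · rcases hw.2.2 p q r u y hc (h1 _ a1) (h1 _ a2) (h1 _ a3) with h | h
      · exact h2 _ a4 h
      · exact h2 _ a5 h
  | @step z a b h _ _ iha ihb =>
    rintro x s rfl w hw ⟨h1, h2⟩
    obtain ⟨x', s', s1, s0, p, e, rfl, rfl, g1, g0⟩ := h
    obtain ⟨rfl, rfl⟩ := npp_inj.1 e
    by_cases hp : w p
    · refine iha _ _ rfl w hw ⟨fun q hq => ?_, fun q hq => ?_⟩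
      · rcases g1 _ hq.le hq with h | h
        · exact h1 _ h
        · rw [(npp_inj.1 h).2]; exact hp
      · rcases g1 _ hq.le hq with h | h
        · exact h2 _ h
        · exact absurd (npp_inj.1 h).1 (by decide)
    · refine ihb _ _ rfl w hw ⟨fun q hq => ?_, fun q hq => ?_⟩
      · rcases g0 _ hq.le hq with h | h
        · exact h1 _ h
        · exact absurd (npp_inj.1 h).1 (by decide)
      · rcases g0 _ hq.le hq with h | h
        · exact h2 _ h
        · rw [(npp_inj.1 h).2]; exact hp

open Classical in
noncomputable def lit (w : ℕ → Prop) (i : ℕ) : ℕ := npp (if w i then 1 else 0) i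

theorem der_complete (x : ℕ) (Cl : ℕ → ℕ → Prop)
    (h : ∀ s, (∀ i, ¬ nMem i s) → ¬ Der (UJ0 Cl) UJ (npp x s)) : ∃ w, Sat (Cl x) w := by
  have key : ∀ N, ∃ w : ℕ → Prop, ∀ s, (∀ z, nMem z s → ∃ i < N, z = lit w i) → ¬ Der (UJ0 Cl) UJ (npp x s) := by
    intro N
    induction N with
    | zero => exact ⟨fun _ => True, fun s hs => h s fun i hi => by obtain ⟨_, h, _⟩ := hs i hi; omega⟩
    | succ N ih =>
      obtain ⟨w, hw⟩ := ih
      by_contra hcon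
      push Not at hcon
      obtain ⟨s1, h1, d1⟩ := hcon (fun i => i = N ∨ w i)
      obtain ⟨s0, h0, d0⟩ := hcon (fun i => i ≠ N ∧ w i)
      obtain ⟨s, hs⟩ := ncomp ((Finset.range N).image (lit w))
      refine hw s (fun z hz => ?_) (.step (J := UJ) ⟨x, s, s1, s0, N, rfl, rfl, rfl, fun z _ hz => ?_, fun z _ hz => ?_⟩ d1 d0)
      · rw [hs] at hz; simp at hz; obtain ⟨i, hi, e⟩ := hz; exact ⟨i, hi, e.symm⟩
      · obtain ⟨i, hi, e⟩ := h1 z hz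
        by_cases hiN : i = N
        · subst hiN; right; rw [e]; simp [lit]
        · left; rw [hs, e]; simp only [Finset.mem_image, Finset.mem_range]
          exact ⟨i, by omega, by by_cases hwi : w i <;> simp [lit, hiN, hwi]⟩
      · obtain ⟨i, hi, e⟩ := h0 z hz
        by_cases hiN : i = N
        · subst hiN; right; rw [e]; simp [lit]
        · left; rw [hs, e]; simp only [Finset.mem_image, Finset.mem_range]
          exact ⟨i, by omega, by by_cases hwi : w i <;> simp [lit, hiN, hwi]⟩
  choose w hw using key
  have key2 : ∀ N, ∃ s, (∀ i < N, (w N i → nMem (npp 1 i) s) ∧ (¬ w N i → nMem (npp 0 i) s)) ∧ ¬ UJ0 Cl (npp x s) := by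
    intro N
    obtain ⟨s, hs⟩ := ncomp ((Finset.range N).image (lit (w N)))
    refine ⟨s, fun i hi => ⟨fun h => ?_, fun h => ?_⟩, fun hu => hw N s (fun z hz => ?_) (.ax hu)⟩
    · rw [hs]; exact Finset.mem_image.2 ⟨i, Finset.mem_range.2 hi, by simp [lit, h]⟩
    · rw [hs]; exact Finset.mem_image.2 ⟨i, Finset.mem_range.2 hi, by simp [lit, h]⟩
    · rw [hs] at hz; simp at hz; obtain ⟨i, hi, e⟩ := hz; exact ⟨i, hi, e.symm⟩
  have ev : ∀ i, ∀ᶠ N in (Filter.hyperfilter ℕ : Filter ℕ), i < N := fun i =>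
    (Nat.hyperfilter_le_atTop : (Filter.hyperfilter ℕ : Filter ℕ) ≤ Filter.atTop) (Filter.eventually_gt_atTop i)
  refine ⟨fun p => ∀ᶠ N in (Filter.hyperfilter ℕ : Filter ℕ), w N p, ?_, ?_, ?_⟩
  · filter_upwards [ev tt] with N hN
    obtain ⟨s, h1, h2⟩ := key2 N
    by_contra hc
    exact h2 ⟨x, s, rfl, .inl ((h1 _ hN).2 hc)⟩
  · intro hc
    have := ((hc.and (ev ff)).exists)
    obtain ⟨N, hc, hN⟩ := this
    obtain ⟨s, h1, h2⟩ := key2 N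
    exact h2 ⟨x, s, rfl, .inr (.inl ((h1 _ hN).1 hc))⟩
  · intro p q r u y hC hp hq hr
    rw [← Ultrafilter.eventually_or]
    filter_upwards [hp, hq, hr, ev p, ev q, ev r, ev u, ev y] with N hp hq hr ep eq er eu ey
    by_contra hc
    push Not at hc
    obtain ⟨s, h1, h2⟩ := key2 N
    exact h2 ⟨x, s, rfl, .inr (.inr ⟨p, q, r, u, y, hC, (h1 _ ep).1 hp, (h1 _ eq).1 hq, (h1 _ er).1 hr, (h1 _ eu).2 hc.1, (h1 _ ey).2 hc.2⟩)⟩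

theorem unsat_s1 {Cl : ℕ → ℕ → Prop} (h : S1 (fun v : Fin 2 → ℕ => Cl (v 0) (v 1))) :
    S1 (fun v : Fin 1 → ℕ => ¬ ∃ w, Sat (Cl (v 0)) w) := by
  have i1 : ∀ (m : ℕ) (f g : (Fin m → ℕ) → ℕ) [NT f] [NT g], S1 (fun v => Cl (f v) (g v)) := 
    fun m f g _ _ => h.ap2 f g ‹_› ‹_›
  have j0 : S1 (fun v : Fin 1 → ℕ => UJ0 Cl (v 0)) := by unfold UJ0; infer_instance
  have j1 : S1 (fun v : Fin 3 → ℕ => UJ (v 0) (v 1) (v 2)) := by unfold UJ; infer_instance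
  have hd := der_s1 j0 j1
  have i3 : ∀ (m : ℕ) (a : (Fin m → ℕ) → ℕ) [NT a], S1 (fun v => Der (UJ0 Cl) UJ (a v)) :=
      fun m a _ => S1.ap1 (P := Der (UJ0 Cl) UJ) hd a ‹_›
  have : S1 (fun v : Fin 1 → ℕ => ∃ s, (∀ i ≤ s, ¬ nMem i s) ∧ Der (UJ0 Cl) UJ (npp (v 0) s)) := inferInstance
  refine this.congr fun v => ⟨?_, fun hh => ?_⟩
  · rintro ⟨s, hs, hd⟩ ⟨w, hw⟩
    exact der_sound hd _ _ rfl w hw ⟨fun p hp => absurd hp (hs _ hp.le), fun p hp => absurd hp (hs _ hp.le)⟩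
  · by_contra hc
    push Not at hc
    exact hh (der_complete (v 0) Cl fun s hs => hc s fun i _ => hs i)

end Part12

section Part13


inductive TC (m : ℕ) : ℕ → LA.Term (Empty ⊕ Fin m) → Prop
  | var (i : Fin m) : TC m (npp 0 i) (vT i)
  | zero : TC m (npp 1 0) zeroT
  | succ {t : ℕ} {τ : LA.Term (Empty ⊕ Fin m)} : TC m t τ → TC m (npp 2 t) (succT τ)
  | add {t u : ℕ} {τ σ : LA.Term (Empty ⊕ Fin m)} : TC m t τ → TC m u σ → TC m (npp 3 (npp t u)) (addT τ σ)
  | mul {t u : ℕ} {τ σ : LA.Term (Empty ⊕ Fin m)} : TC m t τ → TC m u σ → TC m (npp 4 (npp t u)) (mulT τ σ)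

inductive FC : (m : ℕ) → ℕ → LA.BoundedFormula Empty m → Prop
  | fls {m : ℕ} : FC m (npp 0 0) .falsum
  | eq {m t u : ℕ} {τ σ : LA.Term (Empty ⊕ Fin m)} : TC m t τ → TC m u σ → FC m (npp 1 (npp t u)) (.equal τ σ)
  | le {m t u : ℕ} {τ σ : LA.Term (Empty ⊕ Fin m)} : TC m t τ → TC m u σ → FC m (npp 2 (npp t u)) (leF τ σ)
  | imp {m a b : ℕ} {φ ψ : LA.BoundedFormula Empty m} : FC m a φ → FC m b ψ → FC m (npp 3 (npp a b)) (φ.imp ψ)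
  | all {m a : ℕ} {φ : LA.BoundedFormula Empty (m+1)} : FC (m+1) a φ → FC m (npp 4 a) (φ.all)

theorem TC.rewr {m : ℕ} {a b : LA.Term (Empty ⊕ Fin m)} (e : a = b) {t : ℕ} (h : TC m t b) : ∃ t, TC m t a := ⟨t, e ▸ h⟩
theorem FC.rewr {m : ℕ} {a b : LA.BoundedFormula Empty m} (e : a = b) {t : ℕ} (h : FC m t b) : ∃ t, FC m t a := ⟨t, e ▸ h⟩
theorem TC.ex {m : ℕ} (τ : LA.Term (Empty ⊕ Fin m)) : ∃ t, TC m t τ := by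
  induction τ with
  | var i => rcases i with i | i
             · exact i.elim
             · exact ⟨_, .var i⟩
  | @func l f ts ih =>
    match l, f, ts, ih with
    | 0, (), ts, _ =>
      have : Term.func (L := LA) (show LA.Functions 0 from ()) ts = zeroT := by
        unfold zeroT Constants.term; congr 1; exact Subsingleton.elim _ _
      exact TC.rewr this (.zero)
    | 1, (), ts, ih =>
      have : Term.func (L := LA) (show LA.Functions 1 from ()) ts = succT (ts 0) := by
        unfold succT Functions.apply₁; congr 1; funext i; fin_cases i; rfl
      obtain ⟨t, ht⟩ := ih 0
      exact TC.rewr this (.succ ht)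
    | 2, false, ts, ih =>
      have : Term.func (L := LA) (show LA.Functions 2 from false) ts = addT (ts 0) (ts 1) := by
        unfold addT Functions.apply₂; congr 1; funext i; fin_cases i <;> rfl
      obtain ⟨t, ht⟩ := ih 0
      obtain ⟨u, hu⟩ := ih 1
      exact TC.rewr this (.add ht hu)
    | 2, true, ts, ih =>
      have : Term.func (L := LA) (show LA.Functions 2 from true) ts = mulT (ts 0) (ts 1) := by
        unfold mulT Functions.apply₂; congr 1; funext i; fin_cases i <;> rfl
      obtain ⟨t, ht⟩ := ih 0
      obtain ⟨u, hu⟩ := ih 1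
      exact TC.rewr this (.mul ht hu)
    | n+3, f, _, _ => exact Empty.elim f

theorem FC.ex {m : ℕ} (φ : LA.BoundedFormula Empty m) : ∃ a, FC m a φ := by
  induction φ with
  | falsum => exact ⟨_, .fls⟩
  | equal t u => obtain ⟨t', ht⟩ := TC.ex t; obtain ⟨u', hu⟩ := TC.ex u; exact ⟨_, .eq ht hu⟩
  | imp _ _ h1 h2 => obtain ⟨a, ha⟩ := h1; obtain ⟨b, hb⟩ := h2; exact ⟨_, .imp ha hb⟩
  | all _ h1 => obtain ⟨a, ha⟩ := h1; exact ⟨_, .all ha⟩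
  | @rel m l R ts =>
    match l, R, ts with
    | 0, R, _ => exact Empty.elim R
    | 1, R, _ => exact Empty.elim R
    | 2, (), ts =>
      have : BoundedFormula.rel (L := LA) (show LA.Relations 2 from ()) ts = leF (ts 0) (ts 1) := by
        unfold leF Relations.boundedFormula₂ Relations.boundedFormula; congr 1; funext i; fin_cases i <;> rfl
      obtain ⟨t', ht⟩ := TC.ex (ts 0); obtain ⟨u', hu⟩ := TC.ex (ts 1)
      exact FC.rewr this (.le ht hu)
    | n+3, R, _ => exact Empty.elim R

theorem srec {A : Type*} (step : ℕ → (ℕ → A) → A) (d : A) :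
    ∃ F : ℕ → A, ∀ x, F x = step x (fun y => if y < x then F y else d) := by
  let G := fun x (ih : ∀ y, y < x → A) => step x (fun y => if h : y < x then ih y h else d)
  refine ⟨fun x => Nat.lt_wfRel.wf.fix G x, fun x => ?_⟩
  exact WellFounded.fix_eq Nat.lt_wfRel.wf G x

noncomputable def hd (x : ℕ) : ℕ := by classical exact if h : ∃ a b, x = npp a b then h.choose else 0
noncomputable def tl (x : ℕ) : ℕ := by classical exact if h : ∃ a b, x = npp a b then h.choose_spec.choose else 0
@[simp] theorem hd_npp (a b : ℕ) : hd (npp a b) = a := by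
  have h : ∃ a' b', npp a b = npp a' b' := ⟨a, b, rfl⟩
  unfold hd; rw [dif_pos h]; exact (npp_inj.1 h.choose_spec.choose_spec).1.symm
@[simp] theorem tl_npp (a b : ℕ) : tl (npp a b) = b := by
  have h : ∃ a' b', npp a b = npp a' b' := ⟨a, b, rfl⟩
  unfold tl; rw [dif_pos h]; exact (npp_inj.1 h.choose_spec.choose_spec).2.symm
theorem lt_npp (a b : ℕ) : b < npp (a+1) b := by unfold npp; nlinarith

theorem tm_ex : ∃ F : ℕ → ∀ m, LA.Term (Empty ⊕ Fin m), (∀ m (i : Fin m), F (npp 0 i) m = vT i) ∧ (∀ m i, ¬ i < m → F (npp 0 i) m = zeroT) ∧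
    (∀ m, F (npp 1 0) m = zeroT) ∧ (∀ m t, F (npp 2 t) m = succT (F t m)) ∧
    (∀ m t u, F (npp 3 (npp t u)) m = addT (F t m) (F u m)) ∧ (∀ m t u, F (npp 4 (npp t u)) m = mulT (F t m) (F u m)) := by
  classical
  obtain ⟨F, hF⟩ := srec (A := ∀ m, LA.Term (Empty ⊕ Fin m)) (fun x f m =>
    if hd x = 0 then (if h : tl x < m then vT ⟨tl x, h⟩ else zeroT) else
    if hd x = 1 then zeroT else if hd x = 2 then succT (f (tl x) m) else
    if hd x = 3 then addT (f (hd (tl x)) m) (f (tl (tl x)) m) else mulT (f (hd (tl x)) m) (f (tl (tl x)) m)) (fun _ => zeroT)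
  refine ⟨F, fun m i => by rw [hF]; simp, fun m i h => by rw [hF]; simp; omega, fun m => by rw [hF]; simp, fun m t => ?_, fun m t u => ?_, fun m t u => ?_⟩
  · rw [hF]; simp [lt_npp 1]
  · have h1 : t < npp 3 (npp t u) := (npp_le_left t u).trans_lt (lt_npp 2 _)
    have h2 : u < npp 3 (npp t u) := (npp_le_right t u).trans_lt (lt_npp 2 _)
    rw [hF]; simp [h1, h2]
  · have h1 : t < npp 4 (npp t u) := (npp_le_left t u).trans_lt (lt_npp 3 _)
    have h2 : u < npp 4 (npp t u) := (npp_le_right t u).trans_lt (lt_npp 3 _)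
    rw [hF]; simp [h1, h2]
noncomputable def tm (m t : ℕ) : LA.Term (Empty ⊕ Fin m) := tm_ex.choose t m

theorem fm_ex : ∃ F : ℕ → ∀ m, LA.BoundedFormula Empty m, (∀ m, F (npp 0 0) m = .falsum) ∧
    (∀ m t u, F (npp 1 (npp t u)) m = .equal (tm m t) (tm m u)) ∧ (∀ m t u, F (npp 2 (npp t u)) m = leF (tm m t) (tm m u)) ∧
    (∀ m a b, F (npp 3 (npp a b)) m = (F a m).imp (F b m)) ∧ (∀ m a, F (npp 4 a) m = (F a (m+1)).all) := by
  classical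
  obtain ⟨F, hF⟩ := srec (A := ∀ m, LA.BoundedFormula Empty m) (fun x f m =>
    if hd x = 0 then .falsum else
    if hd x = 1 then .equal (tm m (hd (tl x))) (tm m (tl (tl x))) else if hd x = 2 then leF (tm m (hd (tl x))) (tm m (tl (tl x))) else
    if hd x = 3 then (f (hd (tl x)) m).imp (f (tl (tl x)) m) else (f (tl x) (m+1)).all) (fun _ => .falsum)
  refine ⟨F, fun m => by rw [hF]; simp, fun m t u => by rw [hF]; simp, fun m t u => by rw [hF]; simp, fun m t u => ?_, fun m t => ?_⟩
  · have h1 : t < npp 3 (npp t u) := (npp_le_left t u).trans_lt (lt_npp 2 _)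
    have h2 : u < npp 3 (npp t u) := (npp_le_right t u).trans_lt (lt_npp 2 _)
    rw [hF]; simp [h1, h2]
  · rw [hF]; simp [lt_npp 3]
noncomputable def fm (m t : ℕ) : LA.BoundedFormula Empty m := fm_ex.choose t m

@[simp] theorem tm_var {m : ℕ} (i : Fin m) : tm m (npp 0 i) = vT i := tm_ex.choose_spec.1 m i
theorem tm_junk {m i : ℕ} (h : ¬ i < m) : tm m (npp 0 i) = zeroT := tm_ex.choose_spec.2.1 m i h
@[simp] theorem tm_zero {m : ℕ} : tm m (npp 1 0) = zeroT := tm_ex.choose_spec.2.2.1 m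
@[simp] theorem tm_succ {m t : ℕ} : tm m (npp 2 t) = succT (tm m t) := tm_ex.choose_spec.2.2.2.1 m t
@[simp] theorem tm_add {m t u : ℕ} : tm m (npp 3 (npp t u)) = addT (tm m t) (tm m u) := tm_ex.choose_spec.2.2.2.2.1 m t u
@[simp] theorem tm_mul {m t u : ℕ} : tm m (npp 4 (npp t u)) = mulT (tm m t) (tm m u) := tm_ex.choose_spec.2.2.2.2.2 m t u
@[simp] theorem fm_fls {m : ℕ} : fm m (npp 0 0) = .falsum := fm_ex.choose_spec.1 m
@[simp] theorem fm_eq {m t u : ℕ} : fm m (npp 1 (npp t u)) = .equal (tm m t) (tm m u) := fm_ex.choose_spec.2.1 m t u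
@[simp] theorem fm_le {m t u : ℕ} : fm m (npp 2 (npp t u)) = leF (tm m t) (tm m u) := fm_ex.choose_spec.2.2.1 m t u
@[simp] theorem fm_imp {m t u : ℕ} : fm m (npp 3 (npp t u)) = (fm m t).imp (fm m u) := fm_ex.choose_spec.2.2.2.1 m t u
@[simp] theorem fm_all {m t : ℕ} : fm m (npp 4 t) = (fm (m+1) t).all := fm_ex.choose_spec.2.2.2.2 m t

theorem TC.tm {m t : ℕ} {τ : LA.Term (Empty ⊕ Fin m)} (h : TC m t τ) : tm m t = τ := by
  induction h <;> simp_all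
theorem FC.fm {m a : ℕ} {φ : LA.BoundedFormula Empty m} (h : FC m a φ) : fm m a = φ := by
  induction h with
  | fls => simp
  | eq h1 h2 => simp [h1.tm, h2.tm]
  | le h1 h2 => simp [h1.tm, h2.tm]
  | imp _ _ h1 h2 => simp [h1, h2]
  | all _ h1 => simp [h1]

end Part13

section Part14


abbrev TL (m : ℕ) := List ((Empty ⊕ Fin m) ⊕ (Σ i, LA.Functions i))
abbrev FL := List ((Σ k, LA.Term (Empty ⊕ Fin k)) ⊕ ((Σ n, LA.Relations n) ⊕ ℕ))
def cz : ℕ := 2 * Encodable.encode (⟨0, ()⟩ : Σ i, LA.Functions i) + 1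
def cS : ℕ := 2 * Encodable.encode (⟨1, ()⟩ : Σ i, LA.Functions i) + 1
def ca : ℕ := 2 * Encodable.encode (⟨2, false⟩ : Σ i, LA.Functions i) + 1
def cm : ℕ := 2 * Encodable.encode (⟨2, true⟩ : Σ i, LA.Functions i) + 1
def cl : ℕ := 2 * (2 * Encodable.encode (⟨2, ()⟩ : Σ i, LA.Relations i)) + 1

theorem le_var {m : ℕ} (i : Fin m) (L : TL m) : Encodable.encode ((vT i).listEncode ++ L) = Nat.pair (2 * (2 * i + 1)) (Encodable.encode L) + 1 := by
  simp only [vT, Term.listEncode, List.cons_append, List.nil_append, Encodable.encode_list_cons, Encodable.encode_inl, Encodable.encode_inr]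
  rfl
theorem le_zero {m : ℕ} (L : TL m) : Encodable.encode ((zeroT (α := Empty) (n := m)).listEncode ++ L) = Nat.pair cz (Encodable.encode L) + 1 := by
  simp only [zeroT, Constants.term, Term.listEncode, List.cons_append, Encodable.encode_list_cons, Encodable.encode_inr, cz]
  simp
theorem le_succ' {m : ℕ} (τ : LA.Term (Empty ⊕ Fin m)) (L : TL m) :
    Encodable.encode ((succT τ).listEncode ++ L) = Nat.pair cS (Encodable.encode (τ.listEncode ++ L)) + 1 := by
  simp only [succT, Functions.apply₁, Term.listEncode, List.cons_append, Encodable.encode_list_cons, Encodable.encode_inr, cS]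
  simp [List.finRange_succ]
theorem le_add {m : ℕ} (τ σ : LA.Term (Empty ⊕ Fin m)) (L : TL m) :
    Encodable.encode ((addT τ σ).listEncode ++ L) = Nat.pair ca (Encodable.encode (τ.listEncode ++ (σ.listEncode ++ L))) + 1 := by
  simp only [addT, Functions.apply₂, Term.listEncode, List.cons_append, Encodable.encode_list_cons, Encodable.encode_inr, ca]
  simp [List.finRange_succ]
theorem le_mul {m : ℕ} (τ σ : LA.Term (Empty ⊕ Fin m)) (L : TL m) :
    Encodable.encode ((mulT τ σ).listEncode ++ L) = Nat.pair cm (Encodable.encode (τ.listEncode ++ (σ.listEncode ++ L))) + 1 := by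
  simp only [mulT, Functions.apply₂, Term.listEncode, List.cons_append, Encodable.encode_list_cons, Encodable.encode_inr, cm]
  simp [List.finRange_succ]

def TJ0 (x : ℕ) : Prop := ∃ m y z p, y = p + 1 ∧ ((∃ i, i < m ∧ x = npp (npp m (npp 0 i)) (npp y z) ∧ p = Nat.pair (2 * (2 * i + 1)) z) ∨
  (x = npp (npp m (npp 1 0)) (npp y z) ∧ p = Nat.pair cz z))
def TJ (x a b : ℕ) : Prop := ∃ m t t' y z p w u, y = p + 1 ∧ (
  (x = npp (npp m (npp 2 t)) (npp y z) ∧ a = npp (npp m t) (npp w z) ∧ p = Nat.pair cS w) ∨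
  (x = npp (npp m (npp 3 (npp t t'))) (npp y z) ∧ a = npp (npp m t) (npp w u) ∧ b = npp (npp m t') (npp u z) ∧ p = Nat.pair ca w) ∨
  (x = npp (npp m (npp 4 (npp t t'))) (npp y z) ∧ a = npp (npp m t) (npp w u) ∧ b = npp (npp m t') (npp u z) ∧ p = Nat.pair cm w))
def TE (m t y z : ℕ) : Prop := Der TJ0 TJ (npp (npp m t) (npp y z))

theorem te_fwd {m t : ℕ} {τ : LA.Term (Empty ⊕ Fin m)} (h : TC m t τ) : ∀ L : TL m,
    TE m t (Encodable.encode (τ.listEncode ++ L)) (Encodable.encode L) := by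
  induction h with
  | var i => intro L; exact .ax ⟨m, _, Encodable.encode L, _, le_var i L, .inl ⟨i, i.2, rfl, rfl⟩⟩
  | zero => intro L; exact .ax ⟨m, _, Encodable.encode L, _, le_zero L, .inr ⟨rfl, rfl⟩⟩
  | succ _ ih => intro L; exact .step ⟨m, _, 0, _, _, _, _, 0, le_succ' _ L, .inl ⟨rfl, rfl, rfl⟩⟩ (ih L) (ih L)
  | add _ _ ih1 ih2 => intro L; exact .step ⟨m, _, _, _, _, _, _, _, le_add _ _ L, .inr (.inl ⟨rfl, rfl, rfl, rfl⟩)⟩ (ih1 _) (ih2 L)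
  | mul _ _ ih1 ih2 => intro L; exact .step ⟨m, _, _, _, _, _, _, _, le_mul _ _ L, .inr (.inr ⟨rfl, rfl, rfl, rfl⟩)⟩ (ih1 _) (ih2 L)

theorem te_bwd {x : ℕ} (h : Der TJ0 TJ x) : ∀ m t y z, x = npp (npp m t) (npp y z) →
    ∃ τ, TC m t τ ∧ ∀ L : TL m, z = Encodable.encode L → y = Encodable.encode (τ.listEncode ++ L) := by
  induction h with
  | ax h =>
    obtain ⟨m, y, z, p, rfl, ⟨i, hi, rfl, rfl⟩ | ⟨rfl, rfl⟩⟩ := h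
    · intro m' t y' z' e
      simp only [npp_inj] at e
      obtain ⟨⟨rfl, rfl⟩, rfl, rfl⟩ := e
      exact ⟨_, .var ⟨i, hi⟩, fun L hL => by rw [hL, le_var]⟩
    · intro m' t y' z' e
      simp only [npp_inj] at e
      obtain ⟨⟨rfl, rfl⟩, rfl, rfl⟩ := e
      exact ⟨_, .zero, fun L hL => by rw [hL, le_zero]⟩
  | step h _ _ iha ihb =>
    obtain ⟨m, t, t', y, z, p, w, u, rfl, ⟨rfl, rfl, rfl⟩ | ⟨rfl, rfl, rfl, rfl⟩ | ⟨rfl, rfl, rfl, rfl⟩⟩ := h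
    · intro m' t y' z' e
      simp only [npp_inj] at e
      obtain ⟨⟨rfl, rfl⟩, rfl, rfl⟩ := e
      obtain ⟨τ, h1, h2⟩ := iha _ _ _ _ rfl
      exact ⟨_, .succ h1, fun L hL => by rw [h2 L hL, le_succ']⟩
    · intro m' t y' z' e
      simp only [npp_inj] at e
      obtain ⟨⟨rfl, rfl⟩, rfl, rfl⟩ := e
      obtain ⟨τ, h1, h2⟩ := iha _ _ _ _ rfl
      obtain ⟨σ, h3, h4⟩ := ihb _ _ _ _ rfl
      exact ⟨_, .add h1 h3, fun L hL => by rw [h2 _ (h4 L hL), le_add]⟩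
    · intro m' t y' z' e
      simp only [npp_inj] at e
      obtain ⟨⟨rfl, rfl⟩, rfl, rfl⟩ := e
      obtain ⟨τ, h1, h2⟩ := iha _ _ _ _ rfl
      obtain ⟨σ, h3, h4⟩ := ihb _ _ _ _ rfl
      exact ⟨_, .mul h1 h3, fun L hL => by rw [h2 _ (h4 L hL), le_mul]⟩

set_option synthInstance.maxSize 4000 in
set_option synthInstance.maxHeartbeats 1000000 in
set_option maxHeartbeats 1000000 in
instance te_s1 {m : ℕ} (f g h k : (Fin m → ℕ) → ℕ) [NT f] [NT g] [NT h] [NT k] : S1 (fun v => TE (f v) (g v) (h v) (k v)) := by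
  have j0 : S1 (fun v : Fin 1 → ℕ => TJ0 (v 0)) := by unfold TJ0; infer_instance
  have j1 : S1 (fun v : Fin 3 → ℕ => TJ (v 0) (v 1) (v 2)) := by unfold TJ; infer_instance
  exact S1.ap1 (P := Der TJ0 TJ) (der_s1 j0 j1) (fun v => npp (npp (f v) (g v)) (npp (h v) (k v))) inferInstance

theorem te_iff {m t y : ℕ} : TE m t y 0 ↔ ∃ τ : LA.Term (Empty ⊕ Fin m), TC m t τ ∧ y = Encodable.encode τ := by
  constructor
  · intro h
    obtain ⟨τ, h1, h2⟩ := te_bwd h _ _ _ _ rfl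
    exact ⟨τ, h1, by rw [h2 [] rfl, List.append_nil]; rfl⟩
  · rintro ⟨τ, h, rfl⟩
    have := te_fwd h []
    rwa [List.append_nil] at this

theorem fe_fls {m : ℕ} (L : FL) : Encodable.encode ((BoundedFormula.falsum : LA.BoundedFormula Empty m).listEncode ++ L) =
    Nat.pair (2 * (2 * (m+2) + 1) + 1) (Encodable.encode L) + 1 := by
  simp only [BoundedFormula.listEncode, List.cons_append, List.nil_append, Encodable.encode_list_cons, Encodable.encode_inl, Encodable.encode_inr]
  rfl
theorem fe_eq {m : ℕ} (τ σ : LA.Term (Empty ⊕ Fin m)) (L : FL) : Encodable.encode ((BoundedFormula.equal τ σ).listEncode ++ L) =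
    Nat.pair (2 * Nat.pair m (Encodable.encode τ)) (Nat.pair (2 * Nat.pair m (Encodable.encode σ)) (Encodable.encode L) + 1) + 1 := by
  simp only [BoundedFormula.listEncode, List.cons_append, List.nil_append, Encodable.encode_list_cons, Encodable.encode_inl,
    Encodable.encode_inr, Encodable.encode_sigma_val]
  rfl
theorem fe_le {m : ℕ} (τ σ : LA.Term (Empty ⊕ Fin m)) (L : FL) : Encodable.encode ((leF τ σ).listEncode ++ L) =
    Nat.pair cl (Nat.pair (2 * (2 * m + 1) + 1) (Nat.pair (2 * Nat.pair m (Encodable.encode τ)) (Nat.pair (2 * Nat.pair m (Encodable.encode σ)) (Encodable.encode L) + 1) + 1) + 1) + 1 := by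
  have : (leF τ σ).listEncode = [Sum.inr (Sum.inl ⟨2, ()⟩), Sum.inr (Sum.inr m), Sum.inl ⟨m, τ⟩, Sum.inl ⟨m, σ⟩] := by
    simp only [leF, Relations.boundedFormula₂, Relations.boundedFormula, BoundedFormula.listEncode]
    simp [List.finRange_succ]
  rw [this]
  simp only [List.cons_append, List.nil_append, Encodable.encode_list_cons, Encodable.encode_inl, Encodable.encode_inr, cl]
  rfl
theorem fe_imp {m : ℕ} (φ ψ : LA.BoundedFormula Empty m) (L : FL) : Encodable.encode ((φ.imp ψ).listEncode ++ L) =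
    Nat.pair 3 (Encodable.encode (φ.listEncode ++ (ψ.listEncode ++ L))) + 1 := by
  simp only [BoundedFormula.listEncode, List.cons_append, List.append_assoc, Encodable.encode_list_cons, Encodable.encode_inl, Encodable.encode_inr]
  rfl
theorem fe_all {m : ℕ} (φ : LA.BoundedFormula Empty (m+1)) (L : FL) : Encodable.encode ((φ.all).listEncode ++ L) =
    Nat.pair 7 (Encodable.encode (φ.listEncode ++ L)) + 1 := by
  simp only [BoundedFormula.listEncode, List.cons_append, List.append_assoc, Encodable.encode_list_cons, Encodable.encode_inl, Encodable.encode_inr]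
  rfl

def Eqq (m t u y z : ℕ) : Prop := ∃ e e' p p' q q', TE m t e 0 ∧ TE m u e' 0 ∧ p = Nat.pair m e ∧ p' = Nat.pair m e' ∧
   q' = Nat.pair (2 * p') z ∧ q = Nat.pair (2 * p) (q' + 1) ∧ y = q + 1
def FJ0 (x : ℕ) : Prop := ∃ m y z p, y = p + 1 ∧ ((x = npp (npp m (npp 0 0)) (npp y z) ∧ p = Nat.pair (2 * (2 * (m+2) + 1) + 1) z) ∨
  (∃ t u, x = npp (npp m (npp 1 (npp t u))) (npp y z) ∧ Eqq m t u y z) ∨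
  (∃ t u w p', x = npp (npp m (npp 2 (npp t u))) (npp y z) ∧ Eqq m t u w z ∧ p' = Nat.pair (2 * (2 * m + 1) + 1) w ∧ p = Nat.pair cl (p' + 1)))
def FJ (x a b : ℕ) : Prop := ∃ m t t' y z p w u, y = p + 1 ∧ (
  (x = npp (npp m (npp 4 t)) (npp y z) ∧ a = npp (npp (m+1) t) (npp w z) ∧ p = Nat.pair 7 w) ∨
  (x = npp (npp m (npp 3 (npp t t'))) (npp y z) ∧ a = npp (npp m t) (npp w u) ∧ b = npp (npp m t') (npp u z) ∧ p = Nat.pair 3 w))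
def FE (m t y z : ℕ) : Prop := Der FJ0 FJ (npp (npp m t) (npp y z))

theorem fe_fwd {m t : ℕ} {φ : LA.BoundedFormula Empty m} (h : FC m t φ) : ∀ L : FL,
    FE m t (Encodable.encode (φ.listEncode ++ L)) (Encodable.encode L) := by
  induction h with
  | fls => intro L; exact .ax ⟨_, _, _, _, fe_fls L, .inl ⟨rfl, rfl⟩⟩
  | eq h1 h2 =>
    intro L
    exact .ax ⟨_, _, _, _, fe_eq _ _ L, .inr (.inl ⟨_, _, rfl, _, _, _, _, _, _, te_iff.2 ⟨_, h1, rfl⟩, te_iff.2 ⟨_, h2, rfl⟩, rfl, rfl, rfl, rfl, fe_eq _ _ L⟩)⟩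
  | le h1 h2 =>
    intro L
    exact .ax ⟨_, _, _, _, fe_le _ _ L, .inr (.inr ⟨_, _, _, _, rfl, ⟨_, _, _, _, _, _, te_iff.2 ⟨_, h1, rfl⟩, te_iff.2 ⟨_, h2, rfl⟩, rfl, rfl, rfl, rfl, rfl⟩, rfl, rfl⟩)⟩
  | imp _ _ ih1 ih2 => intro L; exact .step ⟨_, _, _, _, _, _, _, _, fe_imp _ _ L, .inr ⟨rfl, rfl, rfl, rfl⟩⟩ (ih1 _) (ih2 L)
  | all _ ih => intro L; exact .step ⟨_, _, 0, _, _, _, _, 0, fe_all _ L, .inl ⟨rfl, rfl, rfl⟩⟩ (ih L) (ih L)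

theorem fe_bwd {x : ℕ} (h : Der FJ0 FJ x) : ∀ m t y z, x = npp (npp m t) (npp y z) →
    ∃ φ, FC m t φ ∧ ∀ L : FL, z = Encodable.encode L → y = Encodable.encode (φ.listEncode ++ L) := by
  induction h with
  | ax h =>
    obtain ⟨m, y, z, p, rfl, ⟨rfl, rfl⟩ | ⟨t, u, rfl, e, e', p1, p', q, q', h1, h2, rfl, rfl, rfl, rfl, h3⟩ |
      ⟨t, u, w, p', rfl, ⟨e, e', p1, p', q, q', h1, h2, rfl, rfl, rfl, rfl, rfl⟩, rfl, rfl⟩⟩ := h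
    · intro m' t y' z' e
      simp only [npp_inj] at e
      obtain ⟨⟨rfl, rfl⟩, rfl, rfl⟩ := e
      exact ⟨_, .fls, fun L hL => by rw [hL, fe_fls]⟩
    · intro m' t y' z' e
      simp only [npp_inj] at e
      obtain ⟨⟨rfl, rfl⟩, rfl, rfl⟩ := e
      obtain ⟨τ, h4, rfl⟩ := te_iff.1 h1
      obtain ⟨σ, h5, rfl⟩ := te_iff.1 h2
      exact ⟨_, .eq h4 h5, fun L hL => by rw [h3, hL, fe_eq]⟩
    · intro m' t y' z' e
      simp only [npp_inj] at e
      obtain ⟨⟨rfl, rfl⟩, rfl, rfl⟩ := e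
      obtain ⟨τ, h4, rfl⟩ := te_iff.1 h1
      obtain ⟨σ, h5, rfl⟩ := te_iff.1 h2
      exact ⟨_, .le h4 h5, fun L hL => by rw [hL, fe_le]⟩
  | step h _ _ iha ihb =>
    obtain ⟨m, t, t', y, z, p, w, u, rfl, ⟨rfl, rfl, rfl⟩ | ⟨rfl, rfl, rfl, rfl⟩⟩ := h
    · intro m' t y' z' e
      simp only [npp_inj] at e
      obtain ⟨⟨rfl, rfl⟩, rfl, rfl⟩ := e
      obtain ⟨τ, h1, h2⟩ := iha _ _ _ _ rfl
      exact ⟨_, .all h1, fun L hL => by rw [h2 L hL, fe_all]⟩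
    · intro m' t y' z' e
      simp only [npp_inj] at e
      obtain ⟨⟨rfl, rfl⟩, rfl, rfl⟩ := e
      obtain ⟨τ, h1, h2⟩ := iha _ _ _ _ rfl
      obtain ⟨σ, h3, h4⟩ := ihb _ _ _ _ rfl
      exact ⟨_, .imp h1 h3, fun L hL => by rw [h2 _ (h4 L hL), fe_imp]⟩

set_option synthInstance.maxSize 2000 in
set_option synthInstance.maxHeartbeats 400000 in
instance fe_s1 {m : ℕ} (f g h k : (Fin m → ℕ) → ℕ) [NT f] [NT g] [NT h] [NT k] : S1 (fun v => FE (f v) (g v) (h v) (k v)) := by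
  have j0 : S1 (fun v : Fin 1 → ℕ => FJ0 (v 0)) := by unfold FJ0 Eqq; infer_instance
  have j1 : S1 (fun v : Fin 3 → ℕ => FJ (v 0) (v 1) (v 2)) := by unfold FJ; infer_instance
  exact S1.ap1 (P := Der FJ0 FJ) (der_s1 j0 j1) (fun v => npp (npp (f v) (g v)) (npp (h v) (k v))) inferInstance

theorem fe_iff {t y : ℕ} : FE 0 t y 0 ↔ ∃ φ : Snt, FC 0 t φ ∧ y = gnum φ := by
  constructor
  · intro h
    obtain ⟨τ, h1, h2⟩ := fe_bwd h _ _ _ _ rfl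
    exact ⟨τ, h1, by rw [h2 [] rfl, List.append_nil]; rfl⟩
  · rintro ⟨τ, h, rfl⟩
    have := fe_fwd h []
    rwa [List.append_nil] at this

theorem gnum_inj {φ ψ : Snt} (h : gnum φ = gnum ψ) : φ = ψ := by
  have h1 := BoundedFormula.encoding.encode_injective (Encodable.encode_injective h)
  simpa using h1

theorem thy_s1 {T : Thy} (h : CompThy T) : S1 (fun v : Fin 1 → ℕ => ∃ φ ∈ T, FC 0 (v 0) φ) := by
  have h1 : S1 (fun v : Fin 1 → ℕ => ∃ φ ∈ T, gnum φ = v 0) := re_s1 (p := fun m => ∃ φ ∈ T, gnum φ = m) (ComputablePred.to_re h)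
  have i1 : ∀ (m : ℕ) (f : (Fin m → ℕ) → ℕ) [NT f], S1 (fun v => ∃ φ ∈ T, gnum φ = f v) :=
    fun m f _ => h1.ap1 (P := fun m => ∃ φ ∈ T, gnum φ = m) f ‹_›
  have : S1 (fun v : Fin 1 → ℕ => ∃ y, FE 0 (v 0) y 0 ∧ ∃ φ ∈ T, gnum φ = y) := S1.ex (fun y v => FE 0 (v 0) y 0 ∧ ∃ φ ∈ T, gnum φ = y)
  refine this.congr fun v => ?_
  simp only [fe_iff]
  constructor
  · rintro ⟨y, ⟨φ, h1, rfl⟩, ψ, h2, h3⟩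
    rw [gnum_inj h3] at h2; exact ⟨φ, h2, h1⟩
  · rintro ⟨φ, h1, h2⟩; exact ⟨_, ⟨φ, h2, rfl⟩, φ, h1, rfl⟩

end Part14

section Part15


/-! ### Arbitrary structures -/
section gen
variable {M : Type} [LA.Structure M]
def gz : M := Structure.funMap (L := LA) (n := 0) (show LA.Functions 0 from Unit.unit) ![]
def gs (x : M) : M := Structure.funMap (L := LA) (n := 1) (show LA.Functions 1 from Unit.unit) ![x]
def ga (x y : M) : M := Structure.funMap (L := LA) (n := 2) (show LA.Functions 2 from false) ![x, y]
def gm (x y : M) : M := Structure.funMap (L := LA) (n := 2) (show LA.Functions 2 from true) ![x, y]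
def gl (x y : M) : Prop := Structure.RelMap (L := LA) (n := 2) (show LA.Relations 2 from Unit.unit) ![x, y]
@[simp] theorem gr_zeroT {α : Type} {n : ℕ} (v : α ⊕ Fin n → M) : (zeroT : LA.Term (α ⊕ Fin n)).realize v = gz := by
  show (Constants.term _ : LA.Term _).realize v = _
  rw [Term.realize_constants]
  show Structure.funMap _ _ = Structure.funMap _ _
  congr 1
@[simp] theorem gr_succT {α : Type} {n : ℕ} (v : α ⊕ Fin n → M) (t : LA.Term (α ⊕ Fin n)) :
    (succT t).realize v = gs (t.realize v) := Term.realize_functions_apply₁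
@[simp] theorem gr_addT {α : Type} {n : ℕ} (v : α ⊕ Fin n → M) (t u : LA.Term (α ⊕ Fin n)) :
    (addT t u).realize v = ga (t.realize v) (u.realize v) := Term.realize_functions_apply₂
@[simp] theorem gr_mulT {α : Type} {n : ℕ} (v : α ⊕ Fin n → M) (t u : LA.Term (α ⊕ Fin n)) :
    (mulT t u).realize v = gm (t.realize v) (u.realize v) := Term.realize_functions_apply₂
@[simp] theorem gr_leF {α : Type} {n : ℕ} (v : α → M) (xs : Fin n → M) (t u : LA.Term (α ⊕ Fin n)) :
    (leF t u).Realize v xs ↔ gl (t.realize (Sum.elim v xs)) (u.realize (Sum.elim v xs)) :=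
  BoundedFormula.realize_rel₂
@[simp] theorem gr_vT {n : ℕ} (v : Empty → M) (xs : Fin n → M) (i : Fin n) :
    (vT i).realize (Sum.elim v xs) = xs i := rfl
def gn : ℕ → M
  | 0 => gz
  | x+1 => gs (gn x)
end gen

abbrev eZ : ℕ := npp 0 0
abbrev eS (a : ℕ) : ℕ := npp 1 a
abbrev eA (a b : ℕ) : ℕ := npp 2 (npp a b)
abbrev eM (a b : ℕ) : ℕ := npp 3 (npp a b)
abbrev eC (m t s : ℕ) : ℕ := npp 4 (npp m (npp t s))
abbrev eW (m a s : ℕ) : ℕ := npp 5 (npp m (npp a s))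
abbrev eN (x : ℕ) : ℕ := npp 6 x
abbrev aE (a b : ℕ) : ℕ := npp 0 (npp a b)
abbrev aL (a b : ℕ) : ℕ := npp 1 (npp a b)
abbrev aF (m a s : ℕ) : ℕ := npp 2 (npp m (npp a s))
abbrev un (p : ℕ) : ℕ := cls tt tt tt p ff

def CA (z : ℕ) : Prop := ∃ a b c d, z = un (aE a a) ∨ z = cls (aE a b) tt tt (aE b a) ff ∨
  z = cls (aE a b) (aE b c) tt (aE a c) ff ∨ z = cls (aE a b) tt tt (aE (eS a) (eS b)) ff ∨
  z = cls (aE a b) (aE c d) tt (aE (eA a c) (eA b d)) ff ∨ z = cls (aE a b) (aE c d) tt (aE (eM a c) (eM b d)) ff ∨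
  z = cls (aE a b) (aE c d) (aL a c) (aL b d) ff
def CB (z : ℕ) : Prop := ∃ m t u s, z = un (aE (eC m (npp 1 0) s) eZ) ∨ z = un (aE (eC m (npp 2 t) s) (eS (eC m t s))) ∨
  z = un (aE (eC m (npp 3 (npp t u)) s) (eA (eC m t s) (eC m u s))) ∨
  z = un (aE (eC m (npp 4 (npp t u)) s) (eM (eC m t s) (eC m u s))) ∨
  z = un (aE (eC (m+1) (npp 0 m) (npp u s)) u) ∨
  (t < m ∧ z = un (aE (eC (m+1) (npp 0 t) (npp u s)) (eC m (npp 0 t) s)))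
def CC (z : ℕ) : Prop := ∃ m a b s, z = cls (aF m (npp 0 0) s) tt tt ff ff ∨
  z = cls (aF m (npp 1 (npp a b)) s) tt tt (aE (eC m a s) (eC m b s)) ff ∨
  z = cls (aE (eC m a s) (eC m b s)) tt tt (aF m (npp 1 (npp a b)) s) ff ∨
  z = cls (aF m (npp 2 (npp a b)) s) tt tt (aL (eC m a s) (eC m b s)) ff ∨
  z = cls (aL (eC m a s) (eC m b s)) tt tt (aF m (npp 2 (npp a b)) s) ff
def CD (z : ℕ) : Prop := ∃ m a b s, 
  z = cls (aF m (npp 3 (npp a b)) s) (aF m a s) tt (aF m b s) ff ∨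
  z = cls tt tt tt (aF m (npp 3 (npp a b)) s) (aF m a s) ∨
  z = cls (aF m b s) tt tt (aF m (npp 3 (npp a b)) s) ff ∨
  z = cls (aF m (npp 4 a) s) tt tt (aF (m+1) a (npp b s)) ff ∨
  z = cls (aF (m+1) a (npp (eW m a s) s)) tt tt (aF m (npp 4 a) s) ff
def CE (Ax : ℕ → Prop) (g x z : ℕ) : Prop := z = un (aE (eN 0) eZ) ∨ (∃ a, z = un (aE (eN (a+1)) (eS (eN a)))) ∨
  (∃ k, Ax k ∧ z = un (aF 0 k 0)) ∨ z = cls (aF 1 g (npp (eN x) 0)) tt tt ff ff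
def ClT (Ax : ℕ → Prop) (g x z : ℕ) : Prop := CA z ∨ CB z ∨ CC z ∨ CD z ∨ CE Ax g x z

set_option synthInstance.maxSize 4000 in
set_option synthInstance.maxHeartbeats 1000000 in
set_option maxHeartbeats 1000000 in
theorem clT_s1 {Ax : ℕ → Prop} (h : S1 (fun v : Fin 1 → ℕ => Ax (v 0))) (g : ℕ) : S1 (fun v : Fin 2 → ℕ => ClT Ax g (v 0) (v 1)) := by
  have i1 : ∀ (m) (f : (Fin m → ℕ) → ℕ) [NT f], S1 (fun v => Ax (f v)) := fun m f _ => h.ap1 (P := Ax) f ‹_›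
  have hA : S1 (fun v : Fin 1 → ℕ => CA (v 0)) := by unfold CA; infer_instance
  have hB : S1 (fun v : Fin 1 → ℕ => CB (v 0)) := by unfold CB; infer_instance
  have hC : S1 (fun v : Fin 1 → ℕ => CC (v 0)) := by unfold CC; infer_instance
  have hD : S1 (fun v : Fin 1 → ℕ => CD (v 0)) := by unfold CD; infer_instance
  have hE : S1 (fun v : Fin 2 → ℕ => CE Ax g (v 0) (v 1)) := by unfold CE; infer_instance
  have kA : S1 (fun v : Fin 2 → ℕ => CA (v 1)) := hA.ap1 (P := CA) (fun v => v 1) inferInstance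
  have kB : S1 (fun v : Fin 2 → ℕ => CB (v 1)) := hB.ap1 (P := CB) (fun v => v 1) inferInstance
  have kC : S1 (fun v : Fin 2 → ℕ => CC (v 1)) := hC.ap1 (P := CC) (fun v => v 1) inferInstance
  have kD : S1 (fun v : Fin 2 → ℕ => CD (v 1)) := hD.ap1 (P := CD) (fun v => v 1) inferInstance
  unfold ClT
  infer_instance

end Part15

section Part16


theorem hd_le (x : ℕ) : hd x ≤ x := by
  by_cases h : ∃ a b, x = npp a b
  · obtain ⟨a, b, rfl⟩ := h; rw [hd_npp]; exact npp_le_left a b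
  · unfold hd; rw [dif_neg h]; exact Nat.zero_le _
theorem tl_le (x : ℕ) : tl x ≤ x := by
  by_cases h : ∃ a b, x = npp a b
  · obtain ⟨a, b, rfl⟩ := h; rw [tl_npp]; exact npp_le_right a b
  · unfold tl; rw [dif_neg h]; exact Nat.zero_le _

section sound
variable {M : Type} [LA.Structure M]
noncomputable def env (f : ℕ → M) : (m : ℕ) → ℕ → (Fin m → M)
  | 0, _ => default
  | m+1, s => Fin.snoc (env f m (tl s)) (f (hd s))
theorem env_congr {f g : ℕ → M} : ∀ (m s : ℕ), (∀ y ≤ s, f y = g y) → env f m s = env g m s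
  | 0, _, _ => rfl
  | m+1, s, h => by
    unfold env
    rw [env_congr m (tl s) fun y hy => h y (hy.trans (tl_le s)), h _ (hd_le s)]

noncomputable def TR (f : ℕ → M) (m t s : ℕ) : M := (tm m t).realize (Sum.elim default (env f m s))
def FR (f : ℕ → M) (m t s : ℕ) : Prop := (fm m t).Realize default (env f m s)
noncomputable def WR (W : ∀ m, ℕ → (Fin m → M) → M) (f : ℕ → M) (m t s : ℕ) : M := W m t (env f m s)

theorem el_ex : ∃ f : ℕ → M, f eZ = gz ∧ (∀ a, f (eS a) = gs (f a)) ∧ (∀ a b, f (eA a b) = ga (f a) (f b)) ∧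
    (∀ a b, f (eM a b) = gm (f a) (f b)) ∧ (∀ m t s, f (eC m t s) = (tm m t).realize (Sum.elim default (env f m s))) ∧
    (∀ m a s, (fm (m+1) a).Realize default (Fin.snoc (env f m s) (f (eW m a s)) : Fin (m+1) → M) → (fm m (npp 4 a)).Realize default (env f m s)) ∧
    (∀ x, f (eN x) = gn x) := by
  classical
  have hW : ∀ (m a : ℕ) (e : Fin m → M), ∃ x : M, (fm (m+1) a).Realize default (Fin.snoc e x : Fin (m+1) → M) → (fm m (npp 4 a)).Realize default e := by
    intro m a e
    by_cases h : (fm m (npp 4 a)).Realize default e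
    · exact ⟨gz, fun _ => h⟩
    · have h' := h
      rw [fm_all, BoundedFormula.realize_all] at h'
      push Not at h'
      obtain ⟨x, hx⟩ := h'
      exact ⟨x, fun h => absurd h hx⟩
  choose W hW using hW
  obtain ⟨f, hf⟩ := srec (A := M) (fun x f =>
    if hd x = 0 then gz else if hd x = 1 then gs (f (tl x)) else
    if hd x = 2 then ga (f (hd (tl x))) (f (tl (tl x))) else
    if hd x = 3 then gm (f (hd (tl x))) (f (tl (tl x))) else
    if hd x = 4 then TR f (hd (tl x)) (hd (tl (tl x))) (tl (tl (tl x))) else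
    if hd x = 5 then WR W f (hd (tl x)) (hd (tl (tl x))) (tl (tl (tl x))) else gn (tl x)) gz
  have h3 : ∀ k m t s, s < npp (k+1) (npp m (npp t s)) := fun k m t s =>
    (npp_le_right t s).trans_lt ((npp_le_right m _).trans_lt (lt_npp k _))
  have hE : ∀ k m t s, env (fun y => if y < npp (k+1) (npp m (npp t s)) then f y else gz) m s = env f m s := fun k m t s =>
    env_congr m s fun y hy => if_pos (hy.trans_lt (h3 k m t s))
  refine ⟨f, by rw [hf]; simp, fun a => ?_, fun a b => ?_, fun a b => ?_, fun m t s => ?_, fun m a s => ?_, fun x => by rw [hf]; simp⟩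
  · rw [hf]; simp [lt_npp 0]
  · have h1 : a < npp 2 (npp a b) := (npp_le_left a b).trans_lt (lt_npp 1 _)
    have h2 : b < npp 2 (npp a b) := (npp_le_right a b).trans_lt (lt_npp 1 _)
    rw [hf]; simp [h1, h2]
  · have h1 : a < npp 3 (npp a b) := (npp_le_left a b).trans_lt (lt_npp 2 _)
    have h2 : b < npp 3 (npp a b) := (npp_le_right a b).trans_lt (lt_npp 2 _)
    rw [hf]; simp [h1, h2]
  · have := hE 3 m t s
    rw [hf]; simp; simp only [TR, WR, this]
  · have : f (eW m a s) = W m a (env f m s) := by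
      have := hE 4 m a s
      rw [hf]; simp; simp only [TR, WR, this]
    rw [this]; exact hW _ _ _

theorem clT_sound {T : Thy} (hM : M ⊨ T) {Ψ : LA.BoundedFormula Empty 1} {g x : ℕ} (hg : FC 1 g Ψ)
    (hx : ¬ Ψ.Realize default (fun _ => (gn x : M))) : ∃ w, Sat (ClT (fun k => ∃ φ ∈ T, FC 0 k φ) g x) w := by
  obtain ⟨f, h0, h1, h2, h3, h4, h5, h6⟩ := el_ex (M := M)
  let w : ℕ → Prop := fun p => (hd p = 0 ∧ f (hd (tl p)) = f (tl (tl p))) ∨ (hd p = 1 ∧ gl (f (hd (tl p))) (f (tl (tl p)))) ∨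
    (hd p = 2 ∧ FR f (hd (tl p)) (hd (tl (tl p))) (tl (tl (tl p)))) ∨ hd p = 3
  have wE : ∀ a b, w (aE a b) ↔ f a = f b := fun a b => by simp [w]
  have wL : ∀ a b, w (aL a b) ↔ gl (f a) (f b) := fun a b => by simp [w]
  have wF : ∀ m a s, w (aF m a s) ↔ (fm m a).Realize default (env f m s) := fun m a s => by simp [w]; rfl
  have wt : w tt := by simp [w]
  have wf : ¬ w ff := by simp [w]
  refine ⟨w, wt, wf, fun p q r u y hc hp hq hr => ?_⟩
  rcases hc with ⟨a, b, c, d, hc⟩ | ⟨m, t, v, s, hc⟩ | ⟨m, a, b, s, hc⟩ | ⟨m, a, b, s, hc⟩ | hc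
  · rcases hc with hc | hc | hc | hc | hc | hc | hc <;> (simp only [npp_inj, cls] at hc; obtain ⟨rfl, rfl, rfl, rfl, rfl⟩ := hc; left)
    · rw [wE]
    · rw [wE] at *; exact hp.symm
    · rw [wE] at *; exact hp.trans hq
    · rw [wE] at *; rw [h1, h1, hp]
    · rw [wE] at *; rw [h2, h2, hp, hq]
    · rw [wE] at *; rw [h3, h3, hp, hq]
    · rw [wE, wL] at *; rwa [← hp, ← hq]
  · rcases hc with hc | hc | hc | hc | hc | ⟨ht, hc⟩ <;> (simp only [npp_inj, cls] at hc; obtain ⟨rfl, rfl, rfl, rfl, rfl⟩ := hc; left; rw [wE])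
    · rw [h4, h0, tm_zero, gr_zeroT]
    · rw [h1, h4, h4, tm_succ, gr_succT]
    · rw [h2, h4, h4, h4, tm_add, gr_addT]
    · rw [h3, h4, h4, h4, tm_mul, gr_mulT]
    · rw [h4]
      have := tm_var (Fin.last m)
      rw [Fin.val_last] at this
      rw [this, gr_vT]
      simp [env]
    · rw [h4, h4]
      have e1 := tm_var (Fin.castSucc (⟨t, ht⟩ : Fin m))
      have e2 := tm_var (⟨t, ht⟩ : Fin m)
      rw [Fin.val_castSucc] at e1
      dsimp only at e1 e2
      rw [e1, e2, gr_vT, gr_vT]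
      simp only [env, tl_npp, hd_npp, Fin.snoc_castSucc]
  · rcases hc with hc | hc | hc | hc | hc <;> (simp only [npp_inj, cls] at hc; obtain ⟨rfl, rfl, rfl, rfl, rfl⟩ := hc; left)
    · rw [wF, fm_fls] at hp; exact hp.elim
    · rw [wF, fm_eq] at hp; rw [wE, h4, h4]; exact hp
    · rw [wE, h4, h4] at hp; rw [wF, fm_eq]; exact hp
    · rw [wF, fm_le, gr_leF] at hp; rw [wL, h4, h4]; exact hp
    · rw [wL, h4, h4] at hp; rw [wF, fm_le, gr_leF]; exact hp
  · rcases hc with hc | hc | hc | hc | hc <;> (simp only [npp_inj, cls] at hc; obtain ⟨rfl, rfl, rfl, rfl, rfl⟩ := hc)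
    · left; rw [wF] at *; rw [fm_imp] at hp; exact hp hq
    · rw [wF, wF, fm_imp]
      by_cases h : (fm m a).Realize default (env f m s)
      · exact Or.inr h
      · exact Or.inl fun h' => absurd h' h
    · left; rw [wF] at *; rw [fm_imp]; exact fun _ => hp
    · left; rw [wF] at *; rw [fm_all] at hp
      have := hp (f b)
      simpa [env] using this
    · left; rw [wF] at *
      apply h5
      simpa [env] using hp
  · rcases hc with hc | ⟨a, hc⟩ | ⟨k, ⟨φ, hφ, hk⟩, hc⟩ | hc <;> (simp only [npp_inj, cls] at hc; obtain ⟨rfl, rfl, rfl, rfl, rfl⟩ := hc)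
    · left; rw [wE, h6, h0]; rfl
    · left; rw [wE, h1, h6, h6]; rfl
    · left; rw [wF, hk.fm]; exact hM.realize_of_mem φ hφ
    · exfalso; rw [wF, hg.fm] at hp
      apply hx
      convert hp using 1
      funext i; fin_cases i; simp [env, Fin.snoc, h6]
end sound

section complete
variable {Ax : ℕ → Prop} {g x : ℕ} {w : ℕ → Prop}

theorem Sat.one {C : ℕ → Prop} (h : Sat C w) {p q r u : ℕ} (hc : C (cls p q r u ff)) (hp : w p) (hq : w q) (hr : w r) : w u :=
  (h.2.2 p q r u ff hc hp hq hr).resolve_right h.2.1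

def Sat.sd (h : Sat (ClT Ax g x) w) : Setoid ℕ where
  r a b := w (aE a b)
  iseqv := by
    have ht := h.1
    refine ⟨fun a => h.one (p := tt) (q := tt) (r := tt) (Or.inl ⟨a, 0, 0, 0, by simp⟩) ht ht ht,
      fun {a b} k => h.one (q := tt) (r := tt) (Or.inl ⟨a, b, 0, 0, by simp⟩) k ht ht,
      fun {a b c} k l => h.one (r := tt) (Or.inl ⟨a, b, c, 0, by simp⟩) k l ht⟩

def Sat.Q (h : Sat (ClT Ax g x) w) : Type := Quotient h.sd
def Sat.mk (h : Sat (ClT Ax g x) w) (a : ℕ) : h.Q := Quotient.mk h.sd a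
theorem Sat.mk_eq (h : Sat (ClT Ax g x) w) {a b : ℕ} : h.mk a = h.mk b ↔ w (aE a b) := Quotient.eq (r := h.sd)
theorem Sat.mk_surj (h : Sat (ClT Ax g x) w) (a : h.Q) : ∃ b, h.mk b = a := Quotient.exists_rep a

def Sat.qs (h : Sat (ClT Ax g x) w) : h.Q → h.Q := Quotient.map (sa := h.sd) (sb := h.sd) (fun a => eS a) fun a b k =>
  h.one (q := tt) (r := tt) (Or.inl ⟨a, b, 0, 0, by simp⟩) k h.1 h.1
def Sat.qa (h : Sat (ClT Ax g x) w) : h.Q → h.Q → h.Q := Quotient.map₂ (sa := h.sd) (sb := h.sd) (sc := h.sd) (fun a b => eA a b) fun a b k c d l =>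
  h.one (r := tt) (Or.inl ⟨a, b, c, d, by simp⟩) k l h.1
def Sat.qm (h : Sat (ClT Ax g x) w) : h.Q → h.Q → h.Q := Quotient.map₂ (sa := h.sd) (sb := h.sd) (sc := h.sd) (fun a b => eM a b) fun a b k c d l =>
  h.one (r := tt) (Or.inl ⟨a, b, c, d, by simp⟩) k l h.1
def Sat.ql (h : Sat (ClT Ax g x) w) : h.Q → h.Q → Prop := Quotient.lift₂ (s₁ := h.sd) (s₂ := h.sd) (fun a b => w (aL a b)) fun a b c d k l => by
  refine propext ⟨fun z => h.one (Or.inl ⟨a, c, b, d, by simp⟩) k l z, fun z => h.one (Or.inl ⟨c, a, d, b, by simp⟩) (h.sd.symm k) (h.sd.symm l) z⟩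

instance Sat.str (h : Sat (ClT Ax g x) w) : LA.Structure h.Q where
  funMap {n} f xs := match n, f, xs with
    | 0, _, _ => h.mk eZ
    | 1, _, xs => h.qs (xs 0)
    | 2, false, xs => h.qa (xs 0) (xs 1)
    | 2, true, xs => h.qm (xs 0) (xs 1)
    | _+3, f, _ => Empty.elim f
  RelMap {n} R xs := match n, R, xs with
    | 0, R, _ => Empty.elim R
    | 1, R, _ => Empty.elim R
    | 2, _, xs => h.ql (xs 0) (xs 1)
    | _+3, R, _ => Empty.elim R

theorem Sat.mz (h : Sat (ClT Ax g x) w) : (gz : h.Q) = h.mk eZ := rfl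
theorem Sat.ms (h : Sat (ClT Ax g x) w) (a : ℕ) : gs (h.mk a) = h.mk (eS a) := rfl
theorem Sat.ma (h : Sat (ClT Ax g x) w) (a b : ℕ) : ga (h.mk a) (h.mk b) = h.mk (eA a b) := rfl
theorem Sat.mm (h : Sat (ClT Ax g x) w) (a b : ℕ) : gm (h.mk a) (h.mk b) = h.mk (eM a b) := rfl
theorem Sat.ml (h : Sat (ClT Ax g x) w) (a b : ℕ) : gl (h.mk a) (h.mk b) ↔ w (aL a b) := Iff.rfl

inductive Stk (h : Sat (ClT Ax g x) w) : (m : ℕ) → ℕ → (Fin m → h.Q) → Prop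
  | nil {e : Fin 0 → h.Q} : Stk h 0 0 e
  | cons {m s : ℕ} {e : Fin m → h.Q} (a : ℕ) : Stk h m s e → Stk h (m+1) (npp a s) (Fin.snoc e (h.mk a))

theorem Sat.unB (h : Sat (ClT Ax g x) w) {a b : ℕ} (k : CB (un (aE a b))) : h.mk a = h.mk b :=
  h.mk_eq.2 (h.one (p := tt) (q := tt) (r := tt) (Or.inr (Or.inl k)) h.1 h.1 h.1)
theorem Sat.unE (h : Sat (ClT Ax g x) w) {a : ℕ} (k : CE Ax g x (un a)) : w a :=
  (h.one (p := tt) (q := tt) (r := tt) (Or.inr (Or.inr (Or.inr (Or.inr k)))) h.1 h.1 h.1)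

theorem Stk.var {h : Sat (ClT Ax g x) w} {m s : ℕ} {e : Fin m → h.Q} (k : Stk h m s e) : ∀ i : Fin m, e i = h.mk (eC m (npp 0 i) s) := by
  induction k with
  | nil => exact fun i => i.elim0
  | @cons m s e a _ ih =>
    intro i
    refine Fin.lastCases ?_ (fun i => ?_) i
    · rw [Fin.snoc_last]
      exact (h.unB ⟨m, 0, a, s, by simp⟩).symm
    · rw [Fin.snoc_castSucc, ih i]
      exact (h.unB ⟨m, i, a, s, by simp⟩).symm

theorem Stk.tm {h : Sat (ClT Ax g x) w} {m s : ℕ} {e : Fin m → h.Q} (k : Stk h m s e) {t : ℕ} {τ : LA.Term (Empty ⊕ Fin m)}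
    (ht : TC m t τ) : τ.realize (Sum.elim default e) = h.mk (eC m t s) := by
  induction ht with
  | var i => rw [gr_vT]; exact k.var i
  | zero => rw [gr_zeroT]; exact (h.unB ⟨m, 0, 0, s, by simp⟩).symm
  | @succ t _ _ ih => rw [gr_succT, ih, h.ms]; exact (h.unB ⟨m, t, 0, s, by simp⟩).symm
  | @add t u _ _ _ _ ih ih' => rw [gr_addT, ih, ih', h.ma]; exact (h.unB ⟨m, t, u, s, by simp⟩).symm
  | @mul t u _ _ _ _ ih ih' => rw [gr_mulT, ih, ih', h.mm]; exact (h.unB ⟨m, t, u, s, by simp⟩).symm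

theorem truth (h : Sat (ClT Ax g x) w) {m a : ℕ} {φ : LA.BoundedFormula Empty m} (hf : FC m a φ) :
    ∀ (s : ℕ) (e : Fin m → h.Q), Stk h m s e → (φ.Realize default e ↔ w (aF m a s)) := by
  have ht := h.1
  have cC : ∀ {p q r u}, CC (cls p q r u ff) → w p → w q → w r → w u := fun k => h.one (Or.inr (Or.inr (Or.inl k)))
  have cD : ∀ {p q r u}, CD (cls p q r u ff) → w p → w q → w r → w u := fun k => h.one (Or.inr (Or.inr (Or.inr (Or.inl k))))
  induction hf with
  | @fls m => exact fun s e _ => ⟨fun k => k.elim, fun k => h.2.1 (cC (q := tt) (r := tt) ⟨m, 0, 0, s, by simp⟩ k ht ht)⟩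
  | @eq m t u _ _ h1 h2 =>
    intro s e k
    show Term.realize _ _ = Term.realize _ _ ↔ _
    rw [k.tm h1, k.tm h2, h.mk_eq]
    exact ⟨fun l => cC (q := tt) (r := tt) ⟨m, t, u, s, by simp⟩ l ht ht, fun l => cC (q := tt) (r := tt) ⟨m, t, u, s, by simp⟩ l ht ht⟩
  | @le m t u _ _ h1 h2 =>
    intro s e k
    rw [gr_leF, k.tm h1, k.tm h2, h.ml]
    exact ⟨fun l => cC (q := tt) (r := tt) ⟨m, t, u, s, by simp⟩ l ht ht, fun l => cC (q := tt) (r := tt) ⟨m, t, u, s, by simp⟩ l ht ht⟩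
  | @imp m a b _ _ _ _ ih1 ih2 =>
    intro s e k
    rw [BoundedFormula.realize_imp, ih1 s e k, ih2 s e k]
    constructor
    · intro l
      rcases h.2.2 tt tt tt (aF m (npp 3 (npp a b)) s) (aF m a s) (Or.inr (Or.inr (Or.inr (Or.inl ⟨m, a, b, s, by simp⟩)))) ht ht ht with l' | l'
      · exact l'
      · exact cD (q := tt) (r := tt) ⟨m, a, b, s, by simp⟩ (l l') ht ht
    · exact fun l l' => cD (r := tt) ⟨m, a, b, s, by simp⟩ l l' ht
  | @all m a _ _ ih =>
    intro s e k
    rw [BoundedFormula.realize_all]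
    constructor
    · intro l
      exact cD (q := tt) (r := tt) ⟨m, a, 0, s, by simp⟩ ((ih _ _ (k.cons (eW m a s))).1 (l _)) ht ht
    · intro l y
      obtain ⟨b, rfl⟩ := h.mk_surj y
      exact (ih _ _ (k.cons b)).2 (cD (q := tt) (r := tt) ⟨m, a, b, s, by simp⟩ l ht ht)

theorem Sat.num (h : Sat (ClT Ax g x) w) : ∀ y : ℕ, (gn y : h.Q) = h.mk (eN y)
  | 0 => (h.mk_eq.2 (h.unE (Or.inl rfl))).symm
  | y+1 => by
    show gs (gn y) = _
    rw [h.num y, h.ms]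
    exact (h.mk_eq.2 (h.unE (Or.inr (Or.inl ⟨y, rfl⟩)))).symm
end complete

theorem clT_complete {T : Thy} {Ψ : LA.BoundedFormula Empty 1} {g x : ℕ} (hg : FC 1 g Ψ) {w : ℕ → Prop}
    (h : Sat (ClT (fun k => ∃ φ ∈ T, FC 0 k φ) g x) w) : h.Q ⊨ T ∧ ¬ Ψ.Realize default (fun _ => (gn x : h.Q)) := by
  constructor
  · refine ⟨fun φ hφ => ?_⟩
    obtain ⟨k, hk⟩ := FC.ex φ
    exact (truth h hk 0 default .nil).2 (h.unE (Or.inr (Or.inr (Or.inl ⟨k, ⟨φ, hφ, hk⟩, rfl⟩))))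
  · intro l
    have e : (fun _ => (gn x : h.Q)) = (Fin.snoc (default : Fin 0 → h.Q) (h.mk (eN x)) : Fin 1 → h.Q) := by
      funext i; fin_cases i; simp [Fin.snoc, h.num]
    rw [e] at l
    have := (truth h hg _ _ (Stk.nil.cons (eN x))).1 l
    exact h.2.1 (h.one (q := tt) (r := tt) (Or.inr (Or.inr (Or.inr (Or.inr (Or.inr (Or.inr (Or.inr rfl))))))) this h.1 h.1)

theorem val_s1 {T : Thy} (hT : CompThy T) (Ψ : LA.BoundedFormula Empty 1) : S1 (fun v : Fin 1 → ℕ =>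
    ∀ (M : Type) [LA.Structure M], M ⊨ T → Ψ.Realize default (fun _ => (gn (v 0) : M))) := by
  obtain ⟨g, hg⟩ := FC.ex Ψ
  refine (unsat_s1 (clT_s1 (Ax := fun k => ∃ φ ∈ T, FC 0 k φ) (thy_s1 hT) g)).congr fun v => ?_
  constructor
  · intro h M _ hM
    by_contra hx
    exact h (clT_sound hM hg hx)
  · rintro h ⟨w, hw⟩
    obtain ⟨h1, h2⟩ := clT_complete hg hw
    exact h2 (h _ h1)

end Part16

section Part17


/-- The class of models of a theory, as a predicate on models of `PA`. -/
def Mod (T : Thy) (M : PAM) : Prop := (M : Type) ⊨ T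

theorem prv_iff {T : Thy} {φ : Snt} : Prv T φ ↔ ∀ (M : Type) [LA.Structure M], M ⊨ T → φ.Realize M := by
  constructor
  · intro h M _ hM
    haveI : Nonempty M := ⟨gz⟩
    exact h.realize_sentence M
  · intro h
    refine Theory.models_sentence_iff.2 fun M => h M inferInstance

theorem ext_pam {T : Thy} (hT : ExtPA T) (M : Type) [LA.Structure M] (hM : M ⊨ T) : M ⊨ PAAx :=
  ⟨fun φ hφ => prv_iff.1 (hT φ hφ) M hM⟩

theorem prv_mod {T : Thy} (hT : ExtPA T) {φ : Snt} : Prv T φ ↔ ∀ M : PAM, Mod T M → φ.Realize M := by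
  rw [prv_iff]
  constructor
  · intro h M hM; exact h M hM
  · intro h M _ hM; exact h ⟨M, ext_pam hT M hM⟩ hM

theorem prv_add {T : Thy} (hT : ExtPA T) {φ γ : Snt} :
    Prv (add T φ) γ ↔ ∀ M : PAM, Mod T M → φ.Realize M → γ.Realize M := by
  rw [prv_iff]
  constructor
  · intro h M hM hφ
    refine h M ⟨fun ψ hψ => ?_⟩
    rcases hψ with rfl | hψ
    · exact hφ
    · exact hM.realize_of_mem ψ hψ
  · intro h M _ hM
    have hM' : M ⊨ T := ⟨fun ψ hψ => hM.realize_of_mem ψ (Or.inr hψ)⟩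
    exact h ⟨M, ext_pam hT M hM'⟩ hM' (hM.realize_of_mem φ (Or.inl rfl))

theorem con_mod {T : Thy} (hT : ExtPA T) (h : Con T) : ∃ M : PAM, Mod T M := by
  by_contra hx
  push Not at hx
  exact h ((prv_mod hT).2 fun M hM => absurd hM (hx M))

theorem gn_cast {M : PAM} : ∀ x : ℕ, (gn x : M) = (x : M)
  | 0 => by rw [Nat.cast_zero]; rfl
  | x+1 => by
    rw [Nat.cast_succ, ← gn_cast x, ← sc_eq]; rfl

/-- Provability from a class of models is recursively enumerable. -/
def ER (X : PAM → Prop) : Prop := ∀ (k : ℕ) (P : Fam 2), Dl k P → S1 (fun v : Fin 2 → ℕ => ∀ M, X M → P M (fun i => (v i : M)))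

theorem mod_er {T : Thy} (hc : CompThy T) (hT : ExtPA T) : ER (Mod T) := by
  intro k P hP
  have hd : Dl k (fun (M : PAM) (v : Fin 1 → M) => ∀ a, a ≤ v 0 → ∀ b, b ≤ v 0 → v 0 = pp a b → P M ![a, b]) := by
    have i1 : ∀ (m : ℕ) (f g : ∀ M : PAM, (Fin m → M) → M) [UT f] [UT g], Dl k (fun M v => P M ![f M v, g M v]) := by
      intro m f g _ _
      refine (hP.subst (m := m) ![f, g] (by intro i; fin_cases i <;> (dsimp; infer_instance))).congr fun M v => ?_
      have : (fun i => (![f, g] : Fin 2 → ∀ M : PAM, (Fin m → M) → M) i M v) = ![f M v, g M v] := by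
        funext i; fin_cases i <;> rfl
      rw [this]
    infer_instance
  obtain ⟨Ψ, hΨ⟩ := hd.pos.ud
  have h1 := (val_s1 hc Ψ).subst (m := 2) (fun _ v => npp (v 0) (v 1)) (fun i => inferInstance)
  refine h1.congr fun v => ?_
  constructor
  · intro h M hM
    have h2 := (hΨ M _).1 (h M hM)
    have e : (fun i => (v i : M)) = ![(v 0 : M), (v 1 : M)] := by funext i; fin_cases i <;> rfl
    rw [e]
    simp only [gn_cast, npp_cast] at h2
    exact h2 _ (le_pp_left _ _) _ (le_pp_right _ _) rfl
  · intro h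
    have h3 : ∀ M : PAM, Mod T M → Ψ.Realize default (fun _ => (gn (npp (v 0) (v 1)) : M)) := by
      intro M hM
      have h4 := h M hM
      refine (hΨ M _).2 ?_
      have e : (fun i => (v i : M)) = ![(v 0 : M), (v 1 : M)] := by funext i; fin_cases i <;> rfl
      rw [e] at h4
      intro a ha b hb hab
      rw [gn_cast, npp_cast, pp_iff] at hab
      rw [← hab.1, ← hab.2]; exact h4
    intro M _ hM
    exact h3 ⟨M, ext_pam hT M hM⟩ hM

/-- The step-bounded universal recursively enumerable relation. -/
def Rh (M : PAM) (e x t : M) : Prop :=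
  ∃ y, y ≤ t ∧ ∃ W, W ≤ t ∧ Good (fun _ => False) W ∧ Mem (pp e (pp (pp y (pp x (pp e 0))) 1)) W

theorem Rh.mono {M : PAM} {e x t t' : M} (h : Rh M e x t) (ht : t ≤ t') : Rh M e x t' := by
  obtain ⟨y, hy, W, hW, h⟩ := h; exact ⟨y, hy.trans ht, W, hW.trans ht, h⟩

instance rh_dl {k m : ℕ} (f g h : ∀ M : PAM, (Fin m → M) → M) [UT f] [UT g] [UT h] :
    Dl k (fun M v => Rh M (f M v) (g M v) (h M v)) := by
  have h0 : Dl k (fun (M : PAM) (v : Fin 3 → M) => Rh M (v 0) (v 1) (v 2)) := by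
    have : ∀ (m : ℕ) (g : ∀ M : PAM, (Fin m → M) → M) [UT g], Dl k (fun M v => Good (fun _ : M => False) (g M v)) :=
      fun m g _ => good_dl (fun _ _ => False) inferInstance g
    unfold Rh; infer_instance
  exact h0.subst (fun i => ![f, g, h] i) (by intro i; fin_cases i <;> (dsimp; infer_instance))

theorem rh_abs (M : PAM) (e x t : ℕ) : Rh M (e:M) (x:M) (t:M) ↔ Rh NN (e:NN) (x:NN) (t:NN) :=
  Dl.abs (P := fun (M : PAM) (v : Fin 3 → M) => Rh M (v 0) (v 1) (v 2)) inferInstance M ![e, x, t]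

theorem rh_diag {R : ℕ → ℕ → Prop} (hR : S1 (fun v : Fin 2 → ℕ => R (v 0) (v 1))) :
    ∃ e : ℕ, ∀ x, R e x ↔ ∃ t : ℕ, Rh NN (e:NN) (x:NN) (t:NN) := by
  obtain ⟨Q, hQ, h⟩ := hR
  obtain ⟨a, ha⟩ := universal hQ.out
  refine ⟨a, fun x => ?_⟩
  have h1 := h ![a, x]
  rw [ha] at h1
  have e : stk (cst ![a, x]) = pp (x : NN) (pp (a : NN) 0) := rfl
  rw [e, orc_succ] at h1
  refine h1.symm.trans ?_
  constructor
  · rintro ⟨y, W, hW, hm⟩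
    obtain ⟨y, rfl⟩ := NN_std y
    obtain ⟨W, rfl⟩ := NN_std W
    refine ⟨y + W, y, ?_, W, ?_, hW, hm⟩
    · exact_mod_cast (by omega : y ≤ y + W)
    · exact_mod_cast (by omega : W ≤ y + W)
  · rintro ⟨t, y, _, W, _, hW, hm⟩
    exact ⟨y, W, hW, hm⟩

end Part17

section Part18


theorem mem_abs (M : PAM) (i W : ℕ) : Mem (i:M) (W:M) ↔ nMem i W :=
  Dl.abs (P := fun (M : PAM) (v : Fin 2 → M) => Mem (v 0) (v 1)) inferInstance M ![i, W]

/-- Uniform truth predicate for Boolean combinations of `Σ_n` sentences. -/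
def Tr (n : ℕ) (M : PAM) (k : M) : Prop :=
  ∀ p, p ≤ k → Mem p k → ∀ a, a ≤ p → ∀ b, b ≤ p → p = pp a b → Orc n M a → Orc n M b

instance tr_dl (n : ℕ) {m : ℕ} (f : ∀ M : PAM, (Fin m → M) → M) [hf : UT f] : Dl (n+1) (fun M v => Tr n M (f M v)) := by
  refine Dl.ap1 (P := fun M x => Tr n M x) ?_ f hf
  unfold Tr; infer_instance

theorem tr_nat {n : ℕ} {M : PAM} {k : ℕ} :
    Tr n M (k:M) ↔ ∀ a b : ℕ, nMem (npp a b) k → Orc n M (a:M) → Orc n M (b:M) := by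
  constructor
  · intro h a b hm ha
    have hm' := (mem_abs M _ _).2 hm
    rw [npp_cast] at hm'
    exact h _ hm'.le hm' _ (le_pp_left _ _) _ (le_pp_right _ _) rfl ha
  · intro h p hp hm a ha b hb hab hO
    obtain ⟨p, hp', rfl⟩ := le_nat _ _ hp
    obtain ⟨a, _, rfl⟩ := le_nat _ _ ha
    obtain ⟨b, _, rfl⟩ := le_nat _ _ hb
    rw [← npp_cast, Nat.cast_inj] at hab
    subst hab
    exact h a b ((mem_abs M _ _).1 hm) hO

def CNF (n : ℕ) (P : PAM → Prop) : Prop :=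
  ∃ S : Finset (ℕ × ℕ), ∀ M, P M ↔ ∀ q ∈ S, Orc n M (q.1 : M) → Orc n M (q.2 : M)

theorem CNF.congr {n : ℕ} {P Q : PAM → Prop} (h : CNF n P) (h' : ∀ M, P M ↔ Q M) : CNF n Q := by
  obtain ⟨S, h⟩ := h; exact ⟨S, fun M => (h' M).symm.trans (h M)⟩

theorem CNF.tr {n : ℕ} {P : PAM → Prop} (h : CNF n P) : ∃ k : ℕ, ∀ M, P M ↔ Tr n M (k:M) := by
  obtain ⟨S, h⟩ := h
  obtain ⟨k, hk⟩ := ncomp (S.image fun q => npp q.1 q.2)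
  refine ⟨k, fun M => ?_⟩
  rw [h, tr_nat]
  constructor
  · intro H a b hab
    obtain ⟨q, hq, e⟩ := Finset.mem_image.1 ((hk _).1 hab)
    obtain ⟨e1, e2⟩ := npp_inj.1 e
    rw [← e1, ← e2]; exact H q hq
  · intro H q hq
    exact H _ _ ((hk _).2 (Finset.mem_image.2 ⟨q, hq, rfl⟩))

theorem tr_cnf (n k : ℕ) : CNF n (fun M => Tr n M (k:M)) := by
  classical
  refine ⟨((Finset.range (k+1)) ×ˢ (Finset.range (k+1))).filter (fun q => nMem (npp q.1 q.2) k), fun M => ?_⟩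
  beta_reduce; rw [tr_nat]
  constructor
  · intro h q hq; exact h _ _ (Finset.mem_filter.1 hq).2
  · intro h a b hab
    have hl : npp a b ≤ k := by
      have : ((npp a b : ℕ) : NN) ≤ (k : NN) := Mem.le hab
      exact_mod_cast this
    have h1 := npp_le_left a b
    have h2 := npp_le_right a b
    refine h (a, b) (Finset.mem_filter.2 ⟨Finset.mem_product.2 ⟨Finset.mem_range.2 ?_, Finset.mem_range.2 ?_⟩, hab⟩)
    · show a < k + 1
      omega
    · show b < k + 1
      omega

theorem sg_code {n : ℕ} {P : PAM → Prop} (h : Sg (n+1) (fun (M : PAM) (_ : Fin 0 → M) => P M)) :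
    ∃ a : ℕ, ∀ M, P M ↔ Orc (n+1) M (a:M) := by
  obtain ⟨a, ha⟩ := universal h.out
  refine ⟨npp a 0, fun M => ?_⟩
  rw [ha M default, npp_cast, Nat.cast_zero]; rfl

section
variable {n : ℕ} {P Q : PAM → Prop}
theorem CNF.cl (a b : ℕ) : CNF n (fun M => Orc n M (a:M) → Orc n M (b:M)) := ⟨{(a, b)}, fun M => by simp⟩
theorem CNF.and (h : CNF n P) (h' : CNF n Q) : CNF n (fun M => P M ∧ Q M) := by
  classical
  obtain ⟨S, h⟩ := h; obtain ⟨S', h'⟩ := h'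
  refine ⟨S ∪ S', fun M => ?_⟩
  beta_reduce; rw [h, h']
  constructor
  · rintro ⟨h1, h2⟩ q hq
    rcases Finset.mem_union.1 hq with hq | hq
    · exact h1 q hq
    · exact h2 q hq
  · intro h
    exact ⟨fun q hq => h q (Finset.mem_union_left _ hq), fun q hq => h q (Finset.mem_union_right _ hq)⟩
theorem CNF.or (h : CNF (n+1) P) (h' : CNF (n+1) Q) : CNF (n+1) (fun M => P M ∨ Q M) := by
  classical
  obtain ⟨S, h⟩ := h; obtain ⟨S', h'⟩ := h'
  have hc : ∀ a b : ℕ, ∃ c : ℕ, ∀ M : PAM, (Orc (n+1) M (a:M) ∧ Orc (n+1) M (b:M)) ↔ Orc (n+1) M (c:M) :=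
    fun a b => sg_code inferInstance
  have hd : ∀ a b : ℕ, ∃ c : ℕ, ∀ M : PAM, (Orc (n+1) M (a:M) ∨ Orc (n+1) M (b:M)) ↔ Orc (n+1) M (c:M) :=
    fun a b => sg_code inferInstance
  choose c hc using hc
  choose d hd using hd
  refine ⟨(S ×ˢ S').image (fun q => (c q.1.1 q.2.1, d q.1.2 q.2.2)), fun M => ?_⟩
  beta_reduce; rw [h, h']
  constructor
  · intro H r hr
    obtain ⟨q, hq, rfl⟩ := Finset.mem_image.1 hr
    obtain ⟨h1, h2⟩ := Finset.mem_product.1 hq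
    show Orc (n+1) M (c _ _ : ℕ) → Orc (n+1) M (d _ _ : ℕ)
    rw [← hc, ← hd]
    rintro ⟨o1, o2⟩
    rcases H with H | H
    · exact Or.inl (H _ h1 o1)
    · exact Or.inr (H _ h2 o2)
  · intro H
    by_contra hx
    push Not at hx
    obtain ⟨⟨q, hq, o1, o2⟩, r, hr, o3, o4⟩ := hx
    have := H _ (Finset.mem_image.2 ⟨(q, r), Finset.mem_product.2 ⟨hq, hr⟩, rfl⟩)
    have := this ((hc _ _ M).1 ⟨o1, o3⟩)
    rcases (hd _ _ M).2 this with h | h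
    · exact o2 h
    · exact o4 h
theorem CNF.base (h : Sg (n+1) (fun (M : PAM) (_ : Fin 0 → M) => P M)) : CNF (n+1) P := by
  obtain ⟨a, ha⟩ := sg_code h
  obtain ⟨t, ht⟩ := sg_code (n := n) (P := fun _ => True) inferInstance
  exact (CNF.cl t a).congr fun M => by rw [← ht, ← ha]; simp
theorem CNF.nbase (h : Sg (n+1) (fun (M : PAM) (_ : Fin 0 → M) => P M)) : CNF (n+1) (fun M => ¬ P M) := by
  obtain ⟨a, ha⟩ := sg_code h
  obtain ⟨t, ht⟩ := sg_code (n := n) (P := fun _ => False) inferInstance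
  exact (CNF.cl a t).congr fun M => by rw [← ht, ← ha]
theorem CNF.not (h : CNF (n+1) P) : CNF (n+1) (fun M => ¬ P M) := by
  classical
  obtain ⟨S, h⟩ := h
  induction S using Finset.induction_on generalizing P with
  | empty => exact (CNF.base (n := n) (P := fun _ => False) inferInstance).congr fun M => by simp [h]
  | insert q S hq ih =>
    have h1 := ih (P := fun M => ∀ q ∈ S, Orc (n+1) M (q.1 : M) → Orc (n+1) M (q.2 : M)) fun M => Iff.rfl
    have h2 : CNF (n+1) (fun M => Orc (n+1) M (q.1 : M) ∧ ¬ Orc (n+1) M (q.2:M)) :=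
      (CNF.base inferInstance).and (CNF.nbase inferInstance)
    refine (h2.or h1).congr fun M => ?_
    rw [h, Finset.forall_mem_insert]
    tauto
theorem CNF.imp (h : CNF (n+1) P) (h' : CNF (n+1) Q) : CNF (n+1) (fun M => P M → Q M) :=
  (h.not.or h').congr fun M => by tauto
theorem CNF.bool {φ : Snt} (h : IsBoolSigma (n+1) φ) : CNF (n+1) (fun M => φ.Realize M) := by
  induction h with
  | base hφ =>
    obtain ⟨a, ha⟩ := uni_sg (uni n) hφ
    refine (CNF.base (P := fun M => Orc (n+1) M ((npp a 0 : ℕ) : M)) inferInstance).congr fun M => ?_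
    rw [npp_cast, Nat.cast_zero]
    exact (ha M default).symm
  | not _ ih => exact ih.not.congr fun M => (Formula.realize_not).symm
  | imp _ _ ih1 ih2 => exact (ih1.imp ih2).congr fun M => (Formula.realize_imp).symm
  | inf _ _ ih1 ih2 => exact (ih1.and ih2).congr fun M => (Formula.realize_inf).symm
  | sup _ _ ih1 ih2 => exact (ih1.or ih2).congr fun M => (Formula.realize_sup).symm
theorem tr_conj (n : ℕ) (F : Finset ℕ) : ∃ h : ℕ, ∀ M : PAM, Tr n M (h:M) ↔ ∀ k ∈ F, Tr n M (k:M) := by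
  classical
  suffices H : CNF n (fun M => ∀ k ∈ F, Tr n M (k:M)) by
    obtain ⟨h, hh⟩ := H.tr
    exact ⟨h, fun M => (hh M).symm⟩
  induction F using Finset.induction_on with
  | empty => exact ⟨∅, fun M => by simp⟩
  | insert k F _ ih =>
    refine ((tr_cnf n k).and ih).congr fun M => ?_
    rw [Finset.forall_mem_insert]
end

end Part18

section Part19


def cd : Bool → ℕ
  | false => 0
  | true => 1

def Ph (n j : ℕ) (M : PAM) (e : M) : Prop :=
  ∀ w, Rh M (j:M) 0 w → ∃ t, t ≤ w ∧ (∃ k, k ≤ t ∧ (Rh M e (pp 0 k) t ∨ Rh M e (pp 1 k) t) ∧ ¬ Tr n M k) ∧ ¬ Rh M e (pp 2 0) t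

theorem ph_iff {n j : ℕ} {M : PAM} {e : M} : Ph n j M e ↔
  ∀ w, Rh M (j:M) 0 w → ∃ t, t ≤ w ∧ (∃ k, k ≤ t ∧ (∃ i, Rh M e (pp (cd i : M) k) t) ∧ ¬ Tr n M k) ∧ ¬ Rh M e (pp 2 0) t := by
  unfold Ph
  simp only [Bool.exists_bool, cd, Nat.cast_zero, Nat.cast_one]

theorem halt_dl (m : ℕ) {l : ℕ} (f : ∀ M : PAM, (Fin l → M) → M) [UT f] :
    Dl (m+2) (fun M v => ∃ w, Rh M (f M v) 0 w) := by
  have h0 : Sg 1 (fun (M : PAM) (v : Fin 1 → M) => ∃ w, Rh M (v 0) 0 w) := inferInstance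
  have h1 : Dl (m+2) (fun (M : PAM) (v : Fin 1 → M) => ∃ w, Rh M (v 0) 0 w) := Dl.of_sg (h0.mono (by omega))
  exact Dl.ap1 (P := fun M x => ∃ w, Rh M x 0 w) h1 f inferInstance

theorem ph_dl (m j : ℕ) {l : ℕ} (f : ∀ M : PAM, (Fin l → M) → M) [hf : UT f] : Dl (m+2) (fun M v => Ph (m+1) j M (f M v)) := by
  refine Dl.ap1 (P := fun M x => Ph (m+1) j M x) ?_ f hf
  have hh : Dl (m+2) (fun (M : PAM) (_ : Fin 1 → M) => ∃ w, Rh M (j:M) 0 w) := halt_dl m (fun M _ => (j:M))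
  constructor
  · have h1 : Sg (m+2) (fun (M : PAM) (v : Fin 1 → M) => ∃ w, Rh M (j:M) 0 w ∧ ∀ w', w' ≤ w → Rh M (j:M) 0 w' →
       ∃ t, t ≤ w' ∧ (∃ k, k ≤ t ∧ (Rh M (v 0) (pp 0 k) t ∨ Rh M (v 0) (pp 1 k) t) ∧ ¬ Tr (m+1) M k) ∧ ¬ Rh M (v 0) (pp 2 0) t) :=
      inferInstance
    have h2 : Sg (m+2) (fun (M : PAM) (_ : Fin 1 → M) => ¬ ∃ w, Rh M (j:M) 0 w) := inferInstance
    refine ((Sg.or _ _ (h := h2) (h' := h1)).congr fun M v => ?_).out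
    constructor
    · rintro (h | ⟨w, hw, h⟩) w' hw'
      · exact absurd ⟨w', hw'⟩ h
      · rcases le_total w' w with hl | hl
        · exact h w' hl hw'
        · obtain ⟨t, ht, h⟩ := h w le_rfl hw
          exact ⟨t, ht.trans hl, h⟩
    · intro h
      by_cases hw : ∃ w, Rh M (j:M) 0 w
      · obtain ⟨w, hw⟩ := hw
        exact Or.inr ⟨w, hw, fun w' _ => h w'⟩
      · exact Or.inl hw
  · have h1 : Sg (m+2) (fun (M : PAM) (v : Fin 1 → M) => ∃ w, Rh M (j:M) 0 w ∧ ¬ 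
       ∃ t, t ≤ w ∧ (∃ k, k ≤ t ∧ (Rh M (v 0) (pp 0 k) t ∨ Rh M (v 0) (pp 1 k) t) ∧ ¬ Tr (m+1) M k) ∧ ¬ Rh M (v 0) (pp 2 0) t) :=
      inferInstance
    refine (h1.congr fun M v => ?_).out
    unfold Ph
    push Not
    rfl

theorem rel_s1 {E B : Bool → ℕ → ℕ → Prop} (hE : ∀ i, S1 (fun v : Fin 2 → ℕ => E i (v 0) (v 1)))
    (hB : ∀ i, S1 (fun v : Fin 2 → ℕ => B i (v 0) (v 1))) :
    S1 (fun v : Fin 2 → ℕ => (∃ k, v 1 = npp 0 k ∧ E false (v 0) k) ∨ (∃ k, v 1 = npp 1 k ∧ E true (v 0) k) ∨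
      (v 1 = npp 2 0 ∧ (B false (v 0) 0 ∨ B true (v 0) 0))) := by
  have i1 : ∀ (i : Bool) (m : ℕ) (f g : (Fin m → ℕ) → ℕ) [NT f] [NT g], S1 (fun v => E i (f v) (g v)) := 
    fun i m f g _ _ => (hE i).ap2 (P := E i) f g ‹_› ‹_›
  have i2 : ∀ (i : Bool) (m : ℕ) (f g : (Fin m → ℕ) → ℕ) [NT f] [NT g], S1 (fun v => B i (f v) (g v)) := 
    fun i m f g _ _ => (hB i).ap2 (P := B i) f g ‹_› ‹_›
  infer_instance

theorem halt_ex {m : ℕ} {V : Bool → PAM → Prop} (hV : ∀ i, ER (V i))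
    (H : ∀ i, ∀ k : ℕ, (∀ M, V (!i) M → Tr (m+1) M (k:M)) → ∃ M, V i M ∧ Tr (m+1) M (k:M)) :
    ∃ j : ℕ, (∀ (t : ℕ) (M : PAM), ¬ Rh M (j:M) 0 (t:M)) ∧
    ∀ i, ∀ k : ℕ, (∀ M, V (!i) M → Tr (m+1) M (k:M)) → ∃ M, V i M ∧ Tr (m+1) M (k:M) ∧ ∃ w, Rh M (j:M) 0 w := by
  let Bd : Bool → ℕ → ℕ → Prop := fun i j k => (∀ M, V (!i) M → Tr (m+1) M (k:M)) ∧ ∀ M, V i M → Tr (m+1) M (k:M) → ¬ ∃ w, Rh M (j:M) 0 w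
  have hs : ∀ i, S1 (fun v : Fin 2 → ℕ => Bd i (v 0) (v 1)) := by
    intro i
    have h1 := hV (!i) (m+2) (fun M v => Tr (m+1) M (v 1)) inferInstance
    have i2 : Dl (m+2) (fun (M : PAM) (v : Fin 2 → M) => ∃ w, Rh M (v 0) 0 w) := halt_dl m _
    have h2 := hV i (m+2) (fun M v => Tr (m+1) M (v 1) → ¬ ∃ w, Rh M (v 0) 0 w) inferInstance
    exact S1.and _ _ (hf := h1) (hg := h2)
  have hs' : S1 (fun v : Fin 2 → ℕ => (∃ k, Bd false (v 0) k) ∨ (∃ k, Bd true (v 0) k)) := by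
    have i1 : ∀ (i : Bool) (m : ℕ) (f g : (Fin m → ℕ) → ℕ) [NT f] [NT g], S1 (fun v => Bd i (f v) (g v)) := 
      fun i m f g _ _ => (hs i).ap2 (P := Bd i) f g ‹_› ‹_›
    infer_instance
  obtain ⟨j, hj⟩ := rh_diag (R := fun j _ => (∃ k, Bd false j k) ∨ (∃ k, Bd true j k)) hs'
  have hj := hj 0
  rw [← Bool.exists_bool (p := fun i => ∃ k, Bd i j k)] at hj
  simp only [Nat.cast_zero] at hj
  have hn : ¬ ∃ i, ∃ k, Bd i j k := by
    rintro ⟨i, k, h1, h2⟩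
    obtain ⟨t, ht⟩ := hj.1 ⟨i, k, h1, h2⟩
    obtain ⟨M, hM, hk⟩ := H i k h1
    refine h2 M hM hk ⟨t, ?_⟩
    have := (rh_abs M j 0 t).2 (by simpa using ht)
    simpa using this
  refine ⟨j, fun t M ht => ?_, fun i k h1 => ?_⟩
  · refine hn (hj.2 ⟨t, ?_⟩)
    have := (rh_abs M j 0 t).1 (by simpa using ht)
    simpa using this
  · by_contra hx
    refine hn ⟨i, k, h1, fun M hM hk hw => hx ⟨M, hM, hk, hw⟩⟩

theorem main1 {m : ℕ} {V : Bool → PAM → Prop} (hV : ∀ i, ER (V i))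
    (H : ∀ i, ∀ k : ℕ, (∀ M, V (!i) M → Tr (m+1) M (k:M)) → ∃ M, V i M ∧ Tr (m+1) M (k:M)) :
    ∃ P : PAM → Prop, Dl (m+2) (fun (M : PAM) (_ : Fin 0 → M) => P M) ∧
    (∀ i, ¬ ∀ M, V i M → P M) ∧ ∀ i, ∀ k : ℕ, (∀ M, V i M → P M → Tr (m+1) M (k:M)) → ∀ M, V i M → Tr (m+1) M (k:M) := by
  obtain ⟨j, hj1, hj2⟩ := halt_ex hV H
  let E : Bool → ℕ → ℕ → Prop := fun i e k => ∀ M, V i M → Ph (m+1) j M (e:M) → Tr (m+1) M (k:M)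
  let B : Bool → ℕ → ℕ → Prop := fun i e k => ∀ M, V i M → Ph (m+1) j M (e:M)
  have ip : Dl (m+2) (fun (M : PAM) (v : Fin 2 → M) => Ph (m+1) j M (v 0)) := ph_dl m j _
  have hE : ∀ i, S1 (fun v : Fin 2 → ℕ => E i (v 0) (v 1)) := fun i =>
    hV i (m+2) (fun M v => Ph (m+1) j M (v 0) → Tr (m+1) M (v 1)) inferInstance
  have hB : ∀ i, S1 (fun v : Fin 2 → ℕ => B i (v 0) (v 1)) := fun i =>
    hV i (m+2) (fun M v => Ph (m+1) j M (v 0)) inferInstance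
  have hR : S1 (fun v : Fin 2 → ℕ => (∃ k, v 1 = npp 0 k ∧ E false (v 0) k) ∨ (∃ k, v 1 = npp 1 k ∧ E true (v 0) k) ∨
      (v 1 = npp 2 0 ∧ (B false (v 0) 0 ∨ B true (v 0) 0))) := rel_s1 hE hB
  obtain ⟨e, he⟩ := rh_diag (R := fun e x => (∃ k, x = npp 0 k ∧ E false e k) ∨ (∃ k, x = npp 1 k ∧ E true e k) ∨
      (x = npp 2 0 ∧ (B false e 0 ∨ B true e 0))) hR
  have heE : ∀ i k, E i e k ↔ ∃ t : ℕ, Rh NN (e:NN) (npp (cd i) k : ℕ) (t:NN) := by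
    intro i k
    rw [← he]
    cases i <;> simp [cd, npp_inj]
  have heB : (∃ i, B i e 0) ↔ ∃ t : ℕ, Rh NN (e:NN) (npp 2 0 : ℕ) (t:NN) := by
    rw [← he]
    simp [npp_inj]
  clear he hR hE hB ip
  have eT : ∀ (M : PAM), (pp 2 0 : M) = ((npp 2 0 : ℕ) : M) := fun M => by simp [npp_cast]
  have L1 : ∀ (M : PAM) (i : Bool) (k t : ℕ), Rh NN (e:NN) (npp (cd i) k : ℕ) (t:NN) → k ≤ t →
      ¬ Rh NN (e:NN) (npp 2 0 : ℕ) (t:NN) → ¬ Tr (m+1) M (k:M) → Ph (m+1) j M (e:M) := by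
    intro M i k t h1 h2 h3 h4
    rw [ph_iff]
    intro w hw
    have htw : (t:M) ≤ w := by
      by_contra hx
      exact hj1 t M (hw.mono (le_of_not_ge hx))
    refine ⟨t, htw, ⟨k, by exact_mod_cast h2, ⟨i, ?_⟩, h4⟩, ?_⟩
    · rw [← npp_cast]; exact (rh_abs M _ _ _).2 h1
    · rw [eT]; exact fun h => h3 ((rh_abs M _ _ _).1 h)
  have L2 : ¬ ∃ t : ℕ, Rh NN (e:NN) (npp 2 0 : ℕ) (t:NN) := by
    classical
    intro hx
    obtain ⟨i, hi⟩ := heB.2 hx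
    obtain ⟨y, hy, hmin⟩ : ∃ y : ℕ, Rh NN (e:NN) (npp 2 0 : ℕ) (y:NN) ∧ ∀ t < y, ¬ Rh NN (e:NN) (npp 2 0 : ℕ) (t:NN) :=
      ⟨Nat.find hx, Nat.find_spec hx, fun t ht => Nat.find_min hx ht⟩
    obtain ⟨h, hh⟩ := tr_conj (m+1) ((Finset.range y).filter fun k => ∃ t < y, Rh NN (e:NN) (npp (cd (!i)) k : ℕ) (t:NN))
    obtain ⟨M, hM, hk, w, hw⟩ := hj2 i h (by
      intro M hM
      rw [hh]
      intro k hk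
      obtain ⟨hky, t, ht, hr⟩ := Finset.mem_filter.1 hk
      have hky := Finset.mem_range.1 hky
      by_contra hn
      have hr' : Rh NN (e:NN) (npp (cd (!i)) k : ℕ) ((y-1 : ℕ):NN) := hr.mono (by exact_mod_cast (by omega : t ≤ y - 1))
      have := L1 M (!i) k (y-1) hr' (by omega) (hmin _ (by omega)) hn
      exact hn ((heE (!i) k).2 ⟨t, hr⟩ M hM this))
    have hP := hi M hM
    obtain ⟨t, htw, ⟨k, hkt, ⟨i', hev⟩, hnk⟩, hB⟩ := ph_iff.1 hP w hw
    have hty : t < (y:M) := by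
      by_contra hx
      refine hB (Rh.mono ?_ (le_of_not_gt hx))
      rw [eT]; exact (rh_abs M _ _ _).2 hy
    obtain ⟨t, _, rfl⟩ := le_nat _ _ hty.le
    obtain ⟨k, hkt', rfl⟩ := le_nat _ _ hkt
    have hty' : t < y := by exact_mod_cast hty
    rw [← npp_cast] at hev
    have hev := (rh_abs M _ _ _).1 hev
    by_cases hii : i' = i
    · subst hii
      exact hnk ((heE _ _).2 ⟨t, hev⟩ M hM hP)
    · have : i' = !i := by cases i <;> cases i' <;> simp_all
      subst this
      exact hnk ((hh M).1 hk k (Finset.mem_filter.2 ⟨Finset.mem_range.2 (by omega), t, hty', hev⟩))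
  refine ⟨fun M => Ph (m+1) j M (e:M), ph_dl m j (fun M _ => (e:M)), fun i hi => L2 (heB.1 ⟨i, hi⟩), fun i k hk M hM => ?_⟩
  by_contra hn
  obtain ⟨t, ht⟩ := (heE i k).1 hk
  have := L1 M i k (t+k) (ht.mono (by exact_mod_cast (by omega : t ≤ t + k))) (by omega) (fun h => L2 ⟨_, h⟩) hn
  exact hn (hk M hM this)

theorem main1' {m : ℕ} {V : PAM → Prop} (hV : ER V) (hc : ∃ M, V M) :
    ∃ P : PAM → Prop, Dl (m+2) (fun (M : PAM) (_ : Fin 0 → M) => P M) ∧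
    (¬ ∀ M, V M → P M) ∧ ∀ k : ℕ, (∀ M, V M → P M → Tr (m+1) M (k:M)) → ∀ M, V M → Tr (m+1) M (k:M) := by
  obtain ⟨M, hM⟩ := hc
  obtain ⟨P, h1, h2, h3⟩ := main1 (m := m) (V := fun _ => V) (fun _ => hV) (fun i k h => ⟨M, hM, h M hM⟩)
  exact ⟨P, h1, h2 true, h3 true⟩

theorem main_case {m : ℕ} {V W : PAM → Prop} (hV : ER V) (hW : ER W) (hv : ∃ M, V M) (hw : ∃ M, W M)
    (k : ℕ) (h1 : ∀ M, V M → Tr (m+1) M (k:M)) (h2 : ∀ M, W M → ¬ Tr (m+1) M (k:M)) :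
    ∃ P : PAM → Prop, Dl (m+2) (fun (M : PAM) (_ : Fin 0 → M) => P M) ∧
    ((¬ ∀ M, V M → P M) ∧ ∀ k : ℕ, (∀ M, V M → P M → Tr (m+1) M (k:M)) → ∀ M, V M → Tr (m+1) M (k:M)) ∧
    ((¬ ∀ M, W M → P M) ∧ ∀ k : ℕ, (∀ M, W M → P M → Tr (m+1) M (k:M)) → ∀ M, W M → Tr (m+1) M (k:M)) := by
  obtain ⟨P, p1, p2, p3⟩ := main1' (m := m) hV hv
  obtain ⟨Q, q1, q2, q3⟩ := main1' (m := m) hW hw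
  have eV : ∀ M, V M → (((Tr (m+1) M (k:M) → P M) ∧ (¬ Tr (m+1) M (k:M) → Q M)) ↔ P M) := 
    fun M hM => by have := h1 M hM; tauto
  have eW : ∀ M, W M → (((Tr (m+1) M (k:M) → P M) ∧ (¬ Tr (m+1) M (k:M) → Q M)) ↔ Q M) := 
    fun M hM => by have := h2 M hM; tauto
  refine ⟨fun M => (Tr (m+1) M (k:M) → P M) ∧ (¬ Tr (m+1) M (k:M) → Q M), inferInstance, ⟨?_, ?_⟩, ?_, ?_⟩
  · exact fun h => p2 fun M hM => (eV M hM).1 (h M hM)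
  · exact fun l h => p3 l fun M hM hP => h M hM ((eV M hM).2 hP)
  · exact fun h => q2 fun M hM => (eW M hM).1 (h M hM)
  · exact fun l h => q3 l fun M hM hP => h M hM ((eW M hM).2 hP)

theorem main2 {m : ℕ} {V W : PAM → Prop} (hV : ER V) (hW : ER W) (hv : ∃ M, V M) (hw : ∃ M, W M) :
    ∃ P : PAM → Prop, Dl (m+2) (fun (M : PAM) (_ : Fin 0 → M) => P M) ∧
    ((¬ ∀ M, V M → P M) ∧ ∀ k : ℕ, (∀ M, V M → P M → Tr (m+1) M (k:M)) → ∀ M, V M → Tr (m+1) M (k:M)) ∧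
    ((¬ ∀ M, W M → P M) ∧ ∀ k : ℕ, (∀ M, W M → P M → Tr (m+1) M (k:M)) → ∀ M, W M → Tr (m+1) M (k:M)) := by
  by_cases c1 : ∃ k : ℕ, (∀ M, V M → Tr (m+1) M (k:M)) ∧ ∀ M, W M → ¬ Tr (m+1) M (k:M)
  · obtain ⟨k, h1, h2⟩ := c1
    exact main_case hV hW hv hw k h1 h2
  by_cases c2 : ∃ k : ℕ, (∀ M, W M → Tr (m+1) M (k:M)) ∧ ∀ M, V M → ¬ Tr (m+1) M (k:M)
  · obtain ⟨k, h1, h2⟩ := c2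
    obtain ⟨P, h1, h2, h3⟩ := main_case hW hV hw hv k h1 h2
    exact ⟨P, h1, h3, h2⟩
  push Not at c1 c2
  obtain ⟨P, h1, h2, h3⟩ := main1 (m := m) (V := fun i => if i then V else W)
    (by intro i; cases i <;> simpa) (by
      intro i k h
      cases i
      · exact c1 k (by simpa using h)
      · exact c2 k (by simpa using h))
  exact ⟨P, h1, ⟨h2 true, h3 true⟩, h2 false, h3 false⟩


end Part19

/-- Theorem 7.4. -/
theorem stmt_16 (T U : Thy) (hT : GoodThy T) (hU : GoodThy U) (n : ℕ) (hn : 1 ≤ n) :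
    ∃ φ : Snt, IsDeltaIn (n + 1) PAAx φ ∧
      ConsIn (BSigmaS n) T φ ∧ ConsIn (BSigmaS n) U φ ∧ ¬ Prv T φ ∧ ¬ Prv U φ := by
  obtain ⟨m, rfl⟩ : ∃ m, n = m + 1 := ⟨n - 1, by omega⟩
  obtain ⟨cT, kT, eT⟩ := hT
  obtain ⟨cU, kU, eU⟩ := hU
  obtain ⟨P, hP, ⟨h1, h2⟩, h3, h4⟩ := main2 (m := m) (mod_er cT eT) (mod_er cU eU) (con_mod eT kT) (con_mod eU kU)
  obtain ⟨φ, hφ, hφ'⟩ := hP.pos.fml.1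
  obtain ⟨ψ, hψ, hψ'⟩ := hP.neg.fml.2
  have eP : ∀ M : PAM, Sentence.Realize M φ ↔ P M := fun M => hφ' M default
  have eP' : ∀ M : PAM, Sentence.Realize M ψ ↔ P M := fun M => (hψ' M default).trans not_not
  have ePA : ExtPA PAAx := fun φ h => prv_iff.2 fun M _ hM => hM.realize_of_mem φ h
  have cons : ∀ {S : Thy}, ExtPA S → (∀ k : ℕ, (∀ M, Mod S M → P M → Tr (m+1) M (k:M)) → ∀ M, Mod S M → Tr (m+1) M (k:M)) →
      ConsIn (BSigmaS (m+1)) S φ := by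
    intro S eS h γ hγ hp
    obtain ⟨k, hk⟩ := (CNF.bool hγ).tr
    rw [prv_add eS] at hp
    rw [prv_mod eS]
    intro M hM
    exact (hk M).2 (h k (fun M hM hP => (hk M).1 (hp M hM ((eP M).2 hP))) M hM)
  refine ⟨φ, ⟨⟨φ, hφ, ?_⟩, ψ, hψ, ?_⟩, cons eT h2, cons eU h4, ?_, ?_⟩
  · rw [prv_mod ePA]; intro M _
    exact Formula.realize_iff.2 Iff.rfl
  · rw [prv_mod ePA]; intro M _
    exact Formula.realize_iff.2 ((eP M).trans (eP' M).symm)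
  · rw [prv_mod eT]; exact fun h => h1 fun M hM => (eP M).1 (h M hM)
  · rw [prv_mod eU]; exact fun h => h3 fun M hM => (eP M).1 (h M hM)

end Guaspari
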